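/- Let m, n ≥ 2. The affine RSK bijection κ : M̂_{m×n} → ⨆_{λ∈𝒫_m∩𝒫_n} CSST_[m](λ) × B_n(λ) commutes with the crystal operators: for every A ∈ M̂_{m×n}, κ(ẽ_i A) = ẽ_i κ(A) and κ(f̃_i A) = f̃_i κ(A) for all i ∈ {1,…,m−1}, and κ(ẽ^t_j A) = ẽ^t_j κ(A) and κ(f̃^t_j A) = f̃^t_j κ(A) for all j ∈ {0,1,…,n−1}, with the convention κ(0) = 0. -/

import Mathlib

open scoped Classical

namespace AffineRSK

/-- `ℤ × ℤ`-matrices with non-negative integer entries. -/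
abbrev Mat : Type := ℤ → ℤ → ℕ

abbrev Cell : Type := ℤ × ℤ

/-- Generalized affine permutations of period `(m, n)`:
`a_{i+m, j+n} = a_{ij}` and each column has finite support. -/
def IsGAP (m n : ℕ) (A : Mat) : Prop :=
  (∀ i j : ℤ, A (i + m) (j + n) = A i j) ∧ ∀ j : ℤ, {i : ℤ | A i j ≠ 0}.Finite

/-- Generalized dual affine permutations: entries in `{0, 1}`. -/
def IsGDAP (m n : ℕ) (A : Mat) : Prop :=
  IsGAP m n A ∧ ∀ i j : ℤ, A i j ≤ 1

def supp (A : Mat) : Set Cell := {c : Cell | A c.1 c.2 ≠ 0}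

def tauC (m n : ℕ) (c : Cell) : Cell := (c.1 + (m : ℤ), c.2 + (n : ℤ))

/-- `NW c₁ c₂` means `c₁ >_NW c₂`. -/
def NW (c₁ c₂ : Cell) : Prop := c₁.1 < c₂.1 ∧ c₁.2 < c₂.2

/-- `nwGe c₁ c₂` means `c₁ ≥_nw c₂`. -/
def nwGe (c₁ c₂ : Cell) : Prop := c₁.1 ≤ c₂.1 ∧ c₁.2 ≤ c₂.2

/-- `neLe c₁ c₂` means `c₁ ≤_ne c₂`. -/
def neLe (c₁ c₂ : Cell) : Prop := c₂.1 ≤ c₁.1 ∧ c₁.2 ≤ c₂.2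

/-- `nWgt c₁ c₂` means `c₁ >_nW c₂` (dual order). -/
def nWgt (c₁ c₂ : Cell) : Prop := c₁.1 ≤ c₂.1 ∧ c₁.2 < c₂.2

/-- `NeLt c₁ c₂` means `c₁ <_Ne c₂` (dual order). -/
def NeLt (c₁ c₂ : Cell) : Prop := c₂.1 < c₁.1 ∧ c₁.2 ≤ c₂.2

/-- A proper numbering on `A`. -/
def IsProper (A : Mat) (d : Cell → ℤ) : Prop :=
  (∀ c₁ ∈ supp A, ∀ c₂ ∈ supp A, NW c₂ c₁ → d c₂ < d c₁) ∧
    ∀ c₁ ∈ supp A, ∃ c₂ ∈ supp A, NW c₂ c₁ ∧ d c₂ = d c₁ - 1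

/-- A dual proper numbering on `A`. -/
def IsProper' (A : Mat) (d : Cell → ℤ) : Prop :=
  (∀ c₁ ∈ supp A, ∀ c₂ ∈ supp A, nWgt c₂ c₁ → d c₂ < d c₁) ∧
    ∀ c₁ ∈ supp A, ∃ c₂ ∈ supp A, nWgt c₂ c₁ ∧ d c₂ = d c₁ - 1

/-- An enumeration of a stream of flow `l`. -/
def IsStreamEnum (m n : ℕ) (e : ℤ → Cell) (l : ℕ) : Prop :=
  0 < l ∧ (∀ i : ℤ, NW (e i) (e (i + 1))) ∧ ∀ i : ℤ, tauC m n (e i) = e (i + l)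

def IsStreamEnum' (m n : ℕ) (e : ℤ → Cell) (l : ℕ) : Prop :=
  0 < l ∧ (∀ i : ℤ, nWgt (e i) (e (i + 1))) ∧ ∀ i : ℤ, tauC m n (e i) = e (i + l)

def IsStream (m n : ℕ) (S : Set Cell) (l : ℕ) : Prop :=
  ∃ e : ℤ → Cell, IsStreamEnum m n e l ∧ Set.range e = S

def IsStream' (m n : ℕ) (S : Set Cell) (l : ℕ) : Prop :=
  ∃ e : ℤ → Cell, IsStreamEnum' m n e l ∧ Set.range e = S

/-- A channel of `A`: a stream contained in `supp A` of maximal flow. -/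
def IsChannel (m n : ℕ) (A : Mat) (C : Set Cell) : Prop :=
  ∃ l : ℕ, IsStream m n C l ∧ C ⊆ supp A ∧
    ∀ (S : Set Cell) (l' : ℕ), IsStream m n S l' → S ⊆ supp A → l' ≤ l

def IsChannel' (m n : ℕ) (A : Mat) (C : Set Cell) : Prop :=
  ∃ l : ℕ, IsStream' m n C l ∧ C ⊆ supp A ∧
    ∀ (S : Set Cell) (l' : ℕ), IsStream' m n S l' → S ⊆ supp A → l' ≤ l

def Csw (A : Mat) (C : Set Cell) : Set Cell :=
  {c ∈ supp A | ∃ c' ∈ C, neLe c c'}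

def Csw' (A : Mat) (C : Set Cell) : Set Cell :=
  {c ∈ supp A | c ∈ C ∨ ∃ c' ∈ C, NeLt c c'}

/-- `swGe A C₁ C₂` means `C₁ ≽_sw C₂`. -/
def swGe (A : Mat) (C₁ C₂ : Set Cell) : Prop := C₁ ⊆ Csw A C₂

def swGe' (A : Mat) (C₁ C₂ : Set Cell) : Prop := C₁ ⊆ Csw' A C₂

/-- The set of values `d₀(c'_k) + k` over `>_NW`-chains from `c` to the channel
enumerated by `e` (where `d₀ (e idx) = idx`). -/
def chainSet (A : Mat) (e : ℤ → Cell) (c : Cell) : Set ℤ :=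
  {v : ℤ | ∃ (k : ℕ) (ch : ℕ → Cell),
      ch 0 = c ∧ (∀ i ≤ k, ch i ∈ supp A) ∧ (∀ i < k, NW (ch (i + 1)) (ch i)) ∧
        ∃ idx : ℤ, e idx = ch k ∧ v = idx + (k : ℤ)}

def chainSet' (A : Mat) (e : ℤ → Cell) (c : Cell) : Set ℤ :=
  {v : ℤ | ∃ (k : ℕ) (ch : ℕ → Cell),
      ch 0 = c ∧ (∀ i ≤ k, ch i ∈ supp A) ∧ (∀ i < k, nWgt (ch (i + 1)) (ch i)) ∧
        ∃ idx : ℤ, e idx = ch k ∧ v = idx + (k : ℤ)}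

/-- `d` is the channel numbering `d^C_A` for the channel enumerated by `e`. -/
def IsChannelNumbering (A : Mat) (e : ℤ → Cell) (d : Cell → ℤ) : Prop :=
  ∀ c ∈ supp A, IsGreatest (chainSet A e c) (d c)

def IsChannelNumbering' (A : Mat) (e : ℤ → Cell) (d : Cell → ℤ) : Prop :=
  ∀ c ∈ supp A, IsGreatest (chainSet' A e c) (d c)

/-- `e` enumerates the southwest channel of `A`. -/
def IsSWChannelEnum (m n : ℕ) (A : Mat) (e : ℤ → Cell) : Prop :=
  (∃ l : ℕ, IsStreamEnum m n e l) ∧ IsChannel m n A (Set.range e) ∧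
    ∀ C : Set Cell, IsChannel m n A C → swGe A (Set.range e) C

def IsSWChannelEnum' (m n : ℕ) (A : Mat) (e : ℤ → Cell) : Prop :=
  (∃ l : ℕ, IsStreamEnum' m n e l) ∧ IsChannel' m n A (Set.range e) ∧
    ∀ C : Set Cell, IsChannel' m n A C → swGe' A (Set.range e) C

/-- `d` is a southwest channel numbering of `A`. -/
def IsSWNumbering (m n : ℕ) (A : Mat) (d : Cell → ℤ) : Prop :=
  ∃ e : ℤ → Cell, IsSWChannelEnum m n A e ∧ IsChannelNumbering A e d

def IsSWNumbering' (m n : ℕ) (A : Mat) (d : Cell → ℤ) : Prop :=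
  ∃ e : ℤ → Cell, IsSWChannelEnum' m n A e ∧ IsChannelNumbering' A e d

/-- A zig-zag: bi-infinite east/north lattice path, eventually east on the
right and coming from the south on the left. -/
def IsZigZag (z : ℤ → Cell) : Prop :=
  (∀ i : ℤ, z (i + 1) = ((z i).1, (z i).2 + 1) ∨ z (i + 1) = ((z i).1 - 1, (z i).2)) ∧
  (∃ N : ℤ, ∀ i : ℤ, N ≤ i → z (i + 1) = ((z i).1, (z i).2 + 1)) ∧
    ∃ N : ℤ, ∀ i : ℤ, i ≤ N → z (i + 1) = ((z i).1 - 1, (z i).2)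

def innerCorners (z : ℤ → Cell) : Set Cell :=
  {c : Cell | ∃ i : ℤ, z i = c ∧ z i = ((z (i - 1)).1 - 1, (z (i - 1)).2) ∧
      z (i + 1) = ((z i).1, (z i).2 + 1)}

def outerCorners (z : ℤ → Cell) : Set Cell :=
  {c : Cell | ∃ i : ℤ, z i = c ∧ z i = ((z (i - 1)).1, (z (i - 1)).2 + 1) ∧
      z (i + 1) = ((z i).1 - 1, (z i).2)}

def levelSet (A : Mat) (d : Cell → ℤ) (k : ℤ) : Set Cell := {c ∈ supp A | d c = k}

/-- `≥_nw`-maximal cells of `S`. -/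
def nwMaximal (S : Set Cell) : Set Cell := {c ∈ S | ∀ c' ∈ S, nwGe c' c → c' = c}

/-- `>_nW`-maximal cells of `S` (dual). -/
def nWMaximal (S : Set Cell) : Set Cell := {c ∈ S | ∀ c' ∈ S, ¬ nWgt c' c}

/-- `z` is the zig-zag at level `k` associated to the numbering `d`. -/
def ZigZagAt (A : Mat) (d : Cell → ℤ) (k : ℤ) (z : ℤ → Cell) : Prop :=
  IsZigZag z ∧ innerCorners z = nwMaximal (levelSet A d k)

def ZigZagAt' (A : Mat) (d : Cell → ℤ) (k : ℤ) (z : ℤ → Cell) : Prop :=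
  IsZigZag z ∧ innerCorners z = nWMaximal (levelSet A d k)

def IsInnerOf (A : Mat) (d : Cell → ℤ) (c : Cell) : Prop :=
  ∃ (k : ℤ) (z : ℤ → Cell), ZigZagAt A d k z ∧ c ∈ innerCorners z

def IsOuterOf (A : Mat) (d : Cell → ℤ) (c : Cell) : Prop :=
  ∃ (k : ℤ) (z : ℤ → Cell), ZigZagAt A d k z ∧ c ∈ outerCorners z

def IsInnerOf' (A : Mat) (d : Cell → ℤ) (c : Cell) : Prop :=
  ∃ (k : ℤ) (z : ℤ → Cell), ZigZagAt' A d k z ∧ c ∈ innerCorners z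

def IsOuterOf' (A : Mat) (d : Cell → ℤ) (c : Cell) : Prop :=
  ∃ (k : ℤ) (z : ℤ → Cell), ZigZagAt' A d k z ∧ c ∈ outerCorners z

/-- `B` is obtained from `A` by subtracting `1` at inner corners and adding `1`
at outer corners. -/
def FlatEntries (A B : Mat) (Inn Out : Cell → Prop) : Prop :=
  ∀ c : Cell,
    (Inn c → B c.1 c.2 + 1 = A c.1 c.2) ∧
    (Out c → B c.1 c.2 = A c.1 c.2 + 1) ∧
    (¬ Inn c → ¬ Out c → B c.1 c.2 = A c.1 c.2)

/-- `B = A^♭`. -/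
def FlatRel (m n : ℕ) (A B : Mat) : Prop :=
  ∃ d : Cell → ℤ, IsSWNumbering m n A d ∧
    FlatEntries A B (IsInnerOf A d) (IsOuterOf A d)

/-- `B = A^{♭'}` (dual). -/
def FlatRel' (m n : ℕ) (A B : Mat) : Prop :=
  ∃ d : Cell → ℤ, IsSWNumbering' m n A d ∧
    FlatEntries A B (IsInnerOf' A d) (IsOuterOf' A d)

/-- `c` is the back-post corner of the zig-zag `z`:
`(row of rightmost inner corner, column of leftmost inner corner)`. -/
def IsBackPost (z : ℤ → Cell) (c : Cell) : Prop :=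
  ∃ cr ∈ innerCorners z, ∃ cl ∈ innerCorners z,
    (∀ c' ∈ innerCorners z, c'.2 ≤ cr.2) ∧ (∀ c' ∈ innerCorners z, cl.2 ≤ c'.2) ∧
      c = (cr.1, cl.2)

def backPostSet (A : Mat) (d : Cell → ℤ) : Set Cell :=
  {c : Cell | ∃ (k : ℤ) (z : ℤ → Cell), ZigZagAt A d k z ∧ IsBackPost z c}

def backPostSet' (A : Mat) (d : Cell → ℤ) : Set Cell :=
  {c : Cell | ∃ (k : ℤ) (z : ℤ → Cell), ZigZagAt' A d k z ∧ IsBackPost z c}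

/-- Defining data `(a, b, r)` of the stream enumerated by `e` of flow `l`. -/
def StreamData (m n : ℕ) (e : ℤ → Cell) (l : ℕ) (a b : ℕ → ℤ) (r : ℤ) : Prop :=
  ∃ r₁ r₂ : ℤ,
    (∀ p : ℕ, p < l → a p = (e (r₁ + 1 + p)).1 ∧ 1 ≤ a p ∧ a p ≤ (m : ℤ)) ∧
    (∀ p : ℕ, p < l → b p = (e (r₂ + 1 + p)).2 ∧ 1 ≤ b p ∧ b p ≤ (n : ℤ)) ∧
      r = r₁ - r₂

/-- The matrix-ball iteration `A = A^(0), A^(t) = (A^(t-1))^♭`, with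
`A^(t) ≠ O` for `t < s` and `A^(s) = O`. -/
def MBCseq (m n : ℕ) (A : Mat) (s : ℕ) (Aseq : ℕ → Mat) : Prop :=
  Aseq 0 = A ∧ (∀ t < s, Aseq t ≠ 0) ∧ Aseq s = 0 ∧
    ∀ t < s, FlatRel m n (Aseq t) (Aseq (t + 1))

def MBCseq' (m n : ℕ) (A : Mat) (s : ℕ) (Aseq : ℕ → Mat) : Prop :=
  Aseq 0 = A ∧ (∀ t < s, Aseq t ≠ 0) ∧ Aseq s = 0 ∧
    ∀ t < s, FlatRel' m n (Aseq t) (Aseq (t + 1))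

/-- `κ₀(A) = (P, Q, ρ)`, with shape given by the column lengths `μ`:
the `t`-th columns (from the left, `0`-based) of `P` and `Q` are the defining
data of the stream of back-post corners of the zig-zags of `d^{sw}_{A^(t)}`. -/
def Kappa0Rel (m n : ℕ) (A : Mat) (s : ℕ) (μ : ℕ → ℕ) (P Q : ℕ → ℕ → ℤ)
    (ρ : ℕ → ℤ) : Prop :=
  ∃ Aseq : ℕ → Mat, MBCseq m n A s Aseq ∧
    ∀ t < s, ∃ (d : Cell → ℤ) (e : ℤ → Cell),
      IsSWNumbering m n (Aseq t) d ∧ IsStreamEnum m n e (μ t) ∧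
        Set.range e = backPostSet (Aseq t) d ∧
        StreamData m n e (μ t) (fun x => P x t) (fun x => Q x t) (ρ t)

def Kappa0Rel' (m n : ℕ) (A : Mat) (s : ℕ) (μ : ℕ → ℕ) (P Q : ℕ → ℕ → ℤ)
    (ρ : ℕ → ℤ) : Prop :=
  ∃ Aseq : ℕ → Mat, MBCseq' m n A s Aseq ∧
    ∀ t < s, ∃ (d : Cell → ℤ) (e : ℤ → Cell),
      IsSWNumbering' m n (Aseq t) d ∧ IsStreamEnum' m n e (μ t) ∧
        Set.range e = backPostSet' (Aseq t) d ∧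
        StreamData m n e (μ t) (fun x => P x t) (fun x => Q x t) (ρ t)

/-! ### Columns and the shift `τ` -/

/-- Extension of a column `c` of length `b` to `ℤ`: `c̃(x + bq) = c(x) + nq`. -/
def colExt (n b : ℕ) (c : ℕ → ℤ) (z : ℤ) : ℤ :=
  c (Int.toNat (Int.emod z (b : ℤ))) + (n : ℤ) * Int.ediv z (b : ℤ)

/-- `τ_n^k` applied to a column of length `b`. -/
def tauPow (n b : ℕ) (k : ℤ) (c : ℕ → ℤ) : ℕ → ℤ :=
  fun x => colExt n b c ((x : ℤ) + k)

/-- The two-column tableau `(column t of T, τ_N^r(column (t+1) of T))`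
(both of height `μ t`) is `ℤ`-semistandard. -/
def pairCond (N : ℕ) (μ : ℕ → ℕ) (T : ℕ → ℕ → ℤ) (t : ℕ) (r : ℕ) : Prop :=
  (∀ x : ℕ, x + 1 < μ t → T x t < T (x + 1) t) ∧
  (∀ x : ℕ, x + 1 < μ t →
    tauPow N (μ t) (r : ℤ) (fun y => T y (t + 1)) x <
      tauPow N (μ t) (r : ℤ) (fun y => T y (t + 1)) (x + 1)) ∧
    ∀ x < μ t, T x t ≤ tauPow N (μ t) (r : ℤ) (fun y => T y (t + 1)) x

/-- The offset `r` for the adjacent pair of columns `(t, t+1)`. -/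
noncomputable def rOff (N : ℕ) (μ : ℕ → ℕ) (T : ℕ → ℕ → ℤ) (t : ℕ) : ℕ :=
  sInf {r : ℕ | pairCond N μ T t r}

/-- Dual version: placing row `t` above row `τ_N^r(row (t+1))` (rows of the
transposed tableau, i.e. columns of `T`) is `ℤ`-semistandard. -/
def dualPairCond (N : ℕ) (μ : ℕ → ℕ) (T : ℕ → ℕ → ℤ) (t : ℕ) (r : ℕ) : Prop :=
  (∀ x : ℕ, x + 1 < μ t → T x t ≤ T (x + 1) t) ∧
  (∀ x : ℕ, x + 1 < μ t →
    tauPow N (μ t) (r : ℤ) (fun y => T y (t + 1)) x ≤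
      tauPow N (μ t) (r : ℤ) (fun y => T y (t + 1)) (x + 1)) ∧
    ∀ x < μ t, T x t < tauPow N (μ t) (r : ℤ) (fun y => T y (t + 1)) x

noncomputable def rOffDual (N : ℕ) (μ : ℕ → ℕ) (T : ℕ → ℕ → ℤ) (t : ℕ) : ℕ :=
  sInf {r : ℕ | dualPairCond N μ T t r}

/-- First column of the rectangle block containing column `t`. -/
noncomputable def blockStart (μ : ℕ → ℕ) (t : ℕ) : ℕ := sInf {t' : ℕ | μ t' = μ t}

/-- The symmetrized offset entry attached to column `t`
(`η_j` where `j` is the position of `t` from the right in its block). -/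
noncomputable def etaCol (N : ℕ) (μ : ℕ → ℕ) (T : ℕ → ℕ → ℤ) (t : ℕ) : ℕ :=
  ∑ u ∈ Finset.Ico (blockStart μ t) t, rOff N μ T u

noncomputable def etaColDual (N : ℕ) (μ : ℕ → ℕ) (T : ℕ → ℕ → ℤ) (t : ℕ) : ℕ :=
  ∑ u ∈ Finset.Ico (blockStart μ t) t, rOffDual N μ T u

/-- Entries outside the shape are normalized to `0`. -/
def PadZeroT (s : ℕ) (μ : ℕ → ℕ) (T : ℕ → ℕ → ℤ) : Prop :=
  ∀ x t : ℕ, s ≤ t ∨ μ t ≤ x → T x t = 0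

/-- `μ` encodes (the conjugate of) a partition `λ ∈ 𝒫_m ∩ 𝒫_n` with `s` columns. -/
def ShapeOK (m n s : ℕ) (μ : ℕ → ℕ) : Prop :=
  (∀ t : ℕ, t + 1 < s → μ (t + 1) ≤ μ t) ∧ (∀ t < s, 0 < μ t ∧ μ t ≤ m ∧ μ t ≤ n) ∧
    ∀ t : ℕ, s ≤ t → μ t = 0

/-- Dual shape condition: `λ ∈ 𝒫_n`. -/
def ShapeOK' (n s : ℕ) (μ : ℕ → ℕ) : Prop :=
  (∀ t : ℕ, t + 1 < s → μ (t + 1) ≤ μ t) ∧ (∀ t < s, 0 < μ t ∧ μ t ≤ n) ∧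
    ∀ t : ℕ, s ≤ t → μ t = 0

/-- `κ(A) = (P, Q)` where `Q` is obtained by shifting the `t`-th column of `Q₀`
by `τ_n^{ρ_t + η_t}` (`η` the symmetrized offset vector of `P₀`). -/
def KappaRel (m n : ℕ) (A : Mat) (s : ℕ) (μ : ℕ → ℕ) (P Q : ℕ → ℕ → ℤ) : Prop :=
  ∃ (P' Q' : ℕ → ℕ → ℤ) (ρ : ℕ → ℤ),
    Kappa0Rel m n A s μ P' Q' ρ ∧
    (∀ t < s, ∀ x < μ t,
      P x t = P' x t ∧
        Q x t = tauPow n (μ t) (ρ t + (etaCol m μ P' t : ℤ)) (fun y => Q' y t) x) ∧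
    PadZeroT s μ P ∧ PadZeroT s μ Q ∧ ∀ t : ℕ, s ≤ t → μ t = 0

def KappaRel' (m n : ℕ) (A : Mat) (s : ℕ) (μ : ℕ → ℕ) (P Q : ℕ → ℕ → ℤ) : Prop :=
  ∃ (P' Q' : ℕ → ℕ → ℤ) (ρ : ℕ → ℤ),
    Kappa0Rel' m n A s μ P' Q' ρ ∧
    (∀ t < s, ∀ x < μ t,
      P x t = P' x t ∧
        Q x t = tauPow n (μ t) (ρ t + (etaColDual m μ P' t : ℤ)) (fun y => Q' y t) x) ∧
    PadZeroT s μ P ∧ PadZeroT s μ Q ∧ ∀ t : ℕ, s ≤ t → μ t = 0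

/-- Membership in `⨆_{λ ∈ 𝒫_m ∩ 𝒫_n} CSST_[m](λ) × B_n(λ)`:
`P` is column semistandard with entries in `{1, …, m}` and `Q` is a
`ℤ`-semistandard filling whose columns span less than `n` and whose rows
weakly increase within each rectangle block. -/
def InTargetRSK (m n s : ℕ) (μ : ℕ → ℕ) (P Q : ℕ → ℕ → ℤ) : Prop :=
  ShapeOK m n s μ ∧ PadZeroT s μ P ∧ PadZeroT s μ Q ∧
  (∀ t < s, ∀ x : ℕ, x + 1 < μ t → P x t < P (x + 1) t) ∧
  (∀ t < s, ∀ x < μ t, 1 ≤ P x t ∧ P x t ≤ (m : ℤ)) ∧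
  (∀ t < s, ∀ x : ℕ, x + 1 < μ t → Q x t < Q (x + 1) t) ∧
  (∀ t < s, Q (μ t - 1) t - Q 0 t < (n : ℤ)) ∧
    ∀ t : ℕ, t + 1 < s → μ t = μ (t + 1) → ∀ x < μ t, Q x t ≤ Q x (t + 1)

/-- Membership in `⨆_{λ ∈ 𝒫_n} RSST_[m](λ') × B_n(λ)`; the first component is
encoded by `P = P₀` (whose columns, weakly increasing with entries in
`{1, …, m}`, are the rows of `P₀ᵗ ∈ RSST_[m](λ')`). -/
def InTargetDual (m n s : ℕ) (μ : ℕ → ℕ) (P Q : ℕ → ℕ → ℤ) : Prop :=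
  ShapeOK' n s μ ∧ PadZeroT s μ P ∧ PadZeroT s μ Q ∧
  (∀ t < s, ∀ x : ℕ, x + 1 < μ t → P x t ≤ P (x + 1) t) ∧
  (∀ t < s, ∀ x < μ t, 1 ≤ P x t ∧ P x t ≤ (m : ℤ)) ∧
  (∀ t < s, ∀ x : ℕ, x + 1 < μ t → Q x t < Q (x + 1) t) ∧
  (∀ t < s, Q (μ t - 1) t - Q 0 t < (n : ℤ)) ∧
    ∀ t : ℕ, t + 1 < s → μ t = μ (t + 1) → ∀ x < μ t, Q x t ≤ Q x (t + 1)

/-- Dominance of a triple `(P, Q, ρ)`: within each rectangle block, the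
sequence `ρ - ζ` (read right to left) is weakly decreasing, where
`ζ = θ - η` with `η`, `θ` the symmetrized offset vectors of `P`, `Q`. -/
def Dominant (m n s : ℕ) (μ : ℕ → ℕ) (P Q : ℕ → ℕ → ℤ) (ρ : ℕ → ℤ) : Prop :=
  ∀ t : ℕ, t + 1 < s → μ t = μ (t + 1) →
    ρ t - ((etaCol n μ Q t : ℤ) - (etaCol m μ P t : ℤ)) ≤
      ρ (t + 1) - ((etaCol n μ Q (t + 1) : ℤ) - (etaCol m μ P (t + 1) : ℤ))

/-- `κ₀(A) = (P, Q, ρ)` with all data normalized outside the shape. -/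
def Kappa0RelPad (m n : ℕ) (A : Mat) (s : ℕ) (μ : ℕ → ℕ) (P Q : ℕ → ℕ → ℤ)
    (ρ : ℕ → ℤ) : Prop :=
  ∃ P' Q' : ℕ → ℕ → ℤ,
    Kappa0Rel m n A s μ P' Q' ρ ∧
    (∀ t < s, ∀ x < μ t, P x t = P' x t ∧ Q x t = Q' x t) ∧
    PadZeroT s μ P ∧ PadZeroT s μ Q ∧ (∀ t : ℕ, s ≤ t → μ t = 0) ∧
      ∀ t : ℕ, s ≤ t → ρ t = 0

/-- Membership in `Ω_dom`. -/
def InOmegaDom (m n s : ℕ) (μ : ℕ → ℕ) (P Q : ℕ → ℕ → ℤ) (ρ : ℕ → ℤ) : Prop :=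
  ShapeOK m n s μ ∧ PadZeroT s μ P ∧ PadZeroT s μ Q ∧ (∀ t : ℕ, s ≤ t → ρ t = 0) ∧
  (∀ t < s, ∀ x : ℕ, x + 1 < μ t → P x t < P (x + 1) t) ∧
  (∀ t < s, ∀ x < μ t, 1 ≤ P x t ∧ P x t ≤ (m : ℤ)) ∧
  (∀ t < s, ∀ x : ℕ, x + 1 < μ t → Q x t < Q (x + 1) t) ∧
  (∀ t < s, ∀ x < μ t, 1 ≤ Q x t ∧ Q x t ≤ (n : ℤ)) ∧
    Dominant m n s μ P Q ρ

/-- `A` has width `l`: some proper numbering has period `l`. -/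
def HasWidth (m n : ℕ) (A : Mat) (l : ℕ) : Prop :=
  ∃ d : Cell → ℤ, IsProper A d ∧ ∀ c ∈ supp A, d (tauC m n c) = d c + (l : ℤ)

/-! ### Crystal operators on matrices -/

/-- The first `+` of column `j` (row `i`) survives the signature reduction of
the sequence `σ` attached to rows `i, i+1`. -/
def SurvPlus (A : Mat) (i j : ℤ) : Prop :=
  0 < A i j ∧ ∀ j' : ℤ, j < j' →
    (∑ t ∈ Finset.Ioc j j', A (i + 1) t) ≤ (A i j - 1) + ∑ t ∈ Finset.Ioo j j', A i t

/-- The last `-` of column `j` (row `i+1`) survives the reduction. -/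
def SurvMinus (A : Mat) (i j : ℤ) : Prop :=
  0 < A (i + 1) j ∧ ∀ j' : ℤ, j' < j →
    (∑ t ∈ Finset.Ico j' j, A i t) ≤ (A (i + 1) j - 1) + ∑ t ∈ Finset.Ioo j' j, A (i + 1) t

/-- `A - Ê_{i₁ j} + Ê_{i₂ j}`. -/
noncomputable def subAddAt (m n : ℕ) (i₁ i₂ j : ℤ) (A : Mat) : Mat :=
  fun x y =>
    if ∃ k : ℤ, x = i₁ + k * m ∧ y = j + k * n then A x y - 1
    else if ∃ k : ℤ, x = i₂ + k * m ∧ y = j + k * n then A x y + 1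
    else A x y

/-- `f̃_i` on `M̂_{m×n}`, `0`-valued results encoded by `none`. -/
noncomputable def fMat (m n : ℕ) (i : ℤ) (A : Mat) : Option Mat :=
  if h : ∃ j : ℤ, SurvPlus A i j ∧ ∀ j' : ℤ, SurvPlus A i j' → j ≤ j' then
    some (subAddAt m n i (i + 1) h.choose A)
  else none

/-- `ẽ_i` on `M̂_{m×n}`. -/
noncomputable def eMat (m n : ℕ) (i : ℤ) (A : Mat) : Option Mat :=
  if h : ∃ j : ℤ, SurvMinus A i j ∧ ∀ j' : ℤ, SurvMinus A i j' → j' ≤ j then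
    some (subAddAt m n (i + 1) i h.choose A)
  else none

def transM (A : Mat) : Mat := fun i j => A j i

/-- `f̃^t_j A = (f̃_j (Aᵗ))ᵗ`. -/
noncomputable def fMatT (m n : ℕ) (j : ℤ) (A : Mat) : Option Mat :=
  (fMat n m j (transM A)).map transM

/-- `ẽ^t_j A = (ẽ_j (Aᵗ))ᵗ`. -/
noncomputable def eMatT (m n : ℕ) (j : ℤ) (A : Mat) : Option Mat :=
  (eMat n m j (transM A)).map transM

/-- Row operator (`f̃_i` if `x = true`, `ẽ_i` if `x = false`) on `M̂ ∪ {0}`. -/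
noncomputable def rowOp (m n : ℕ) (x : Bool) (i : ℤ) (o : Option Mat) : Option Mat :=
  o.bind (if x then fMat m n i else eMat m n i)

/-- Column operator (`f̃^t_j` or `ẽ^t_j`) on `M̂ ∪ {0}`. -/
noncomputable def colOp (m n : ℕ) (y : Bool) (j : ℤ) (o : Option Mat) : Option Mat :=
  o.bind (if y then fMatT m n j else eMatT m n j)

/-- The `+` of row `u`, column `j` survives the signature reduction of the
sequence attached to columns `j, j+1` (read along rows, top to bottom). -/
def ColSurvPlus (A : Mat) (j u : ℤ) : Prop :=
  0 < A u j ∧ ∀ u' : ℤ, u < u' →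
    (∑ i ∈ Finset.Ioc u u', A i (j + 1)) ≤ (A u j - 1) + ∑ i ∈ Finset.Ioo u u', A i j

/-- `A - Ê_{u j} + Ê_{u, j+1}`, the result of `f̃^t_j` acting at row `u`. -/
noncomputable def ftApply (m n : ℕ) (u j : ℤ) (A : Mat) : Mat :=
  fun x y =>
    if ∃ k : ℤ, x = u + k * m ∧ y = j + k * n then A x y - 1
    else if ∃ k : ℤ, x = u + k * m ∧ y = j + 1 + k * n then A x y + 1
    else A x y

/-! ### Crystal operators on tableaux -/

/-- Column `t` of `P` contributes a `+` for the letter `i`. -/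
def PhasPlus (μ : ℕ → ℕ) (P : ℕ → ℕ → ℤ) (i : ℤ) (t : ℕ) : Prop :=
  (∃ x < μ t, P x t = i) ∧ ∀ x < μ t, P x t ≠ i + 1

/-- Column `t` of `P` contributes a `-` for the letter `i`. -/
def PhasMinus (μ : ℕ → ℕ) (P : ℕ → ℕ → ℤ) (i : ℤ) (t : ℕ) : Prop :=
  (∃ x < μ t, P x t = i + 1) ∧ ∀ x < μ t, P x t ≠ i

/-- The `+` of column `t` survives the tensor-product signature reduction
(factors are the columns read from right to left). -/
def PSurvPlus (μ : ℕ → ℕ) (P : ℕ → ℕ → ℤ) (i : ℤ) (t : ℕ) : Prop :=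
  PhasPlus μ P i t ∧ ∀ t' < t,
    ((Finset.Ico t' t).filter (fun u => PhasMinus μ P i u)).card ≤
      ((Finset.Ioo t' t).filter (fun u => PhasPlus μ P i u)).card

def PSurvMinus (μ : ℕ → ℕ) (P : ℕ → ℕ → ℤ) (i : ℤ) (t : ℕ) : Prop :=
  PhasMinus μ P i t ∧ ∀ t'' : ℕ, t < t'' →
    ((Finset.Ioc t t'').filter (fun u => PhasPlus μ P i u)).card ≤
      ((Finset.Ioo t t'').filter (fun u => PhasMinus μ P i u)).card

/-- `f̃_i` on `P` acting on column `t₀` (replace the letter `i` by `i + 1`). -/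
noncomputable def applyPF (μ : ℕ → ℕ) (P : ℕ → ℕ → ℤ) (i : ℤ) (t₀ : ℕ) :
    ℕ → ℕ → ℤ :=
  fun x t => if t = t₀ ∧ x < μ t ∧ P x t = i then i + 1 else P x t

/-- `ẽ_i` on `P` acting on column `t₀`. -/
noncomputable def applyPE (μ : ℕ → ℕ) (P : ℕ → ℕ → ℤ) (i : ℤ) (t₀ : ℕ) :
    ℕ → ℕ → ℤ :=
  fun x t => if t = t₀ ∧ x < μ t ∧ P x t = i + 1 then i else P x t

/-- The entry at position `k` of a column `c` of height `b` can be increased. -/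
def QmovUp (n b : ℕ) (c : ℕ → ℤ) (k : ℕ) : Prop :=
  (k + 1 < b ∧ c k + 1 < c (k + 1)) ∨ (k + 1 = b ∧ c (b - 1) < c 0 + (n : ℤ) - 1)

/-- The entry at position `k` of a column `c` of height `b` can be decreased. -/
def QmovDown (n b : ℕ) (c : ℕ → ℤ) (k : ℕ) : Prop :=
  (0 < k ∧ c (k - 1) < c k - 1) ∨ (k = 0 ∧ c (b - 1) < c 0 + (n : ℤ) - 1)

def QhasPlus (n : ℕ) (μ : ℕ → ℕ) (Q : ℕ → ℕ → ℤ) (j : ℤ) (t : ℕ) : Prop :=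
  ∃ k < μ t, Int.emod (Q k t) (n : ℤ) = j ∧ QmovUp n (μ t) (fun y => Q y t) k

def QhasMinus (n : ℕ) (μ : ℕ → ℕ) (Q : ℕ → ℕ → ℤ) (j : ℤ) (t : ℕ) : Prop :=
  ∃ k < μ t, Int.emod (Q k t) (n : ℤ) = Int.emod (j + 1) (n : ℤ) ∧
    QmovDown n (μ t) (fun y => Q y t) k

def QSurvPlus (n : ℕ) (μ : ℕ → ℕ) (Q : ℕ → ℕ → ℤ) (j : ℤ) (t : ℕ) : Prop :=
  QhasPlus n μ Q j t ∧ ∀ t' < t,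
    ((Finset.Ico t' t).filter (fun u => QhasMinus n μ Q j u)).card ≤
      ((Finset.Ioo t' t).filter (fun u => QhasPlus n μ Q j u)).card

def QSurvMinus (n : ℕ) (μ : ℕ → ℕ) (Q : ℕ → ℕ → ℤ) (j : ℤ) (t : ℕ) : Prop :=
  QhasMinus n μ Q j t ∧ ∀ t'' : ℕ, t < t'' →
    ((Finset.Ioc t t'').filter (fun u => QhasPlus n μ Q j u)).card ≤
      ((Finset.Ioo t t'').filter (fun u => QhasMinus n μ Q j u)).card

/-- `f̃^t_j` on `Q` acting on column `t₀`. -/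
noncomputable def applyQF (n : ℕ) (μ : ℕ → ℕ) (Q : ℕ → ℕ → ℤ) (j : ℤ) (t₀ : ℕ) :
    ℕ → ℕ → ℤ :=
  fun x t =>
    if t = t₀ ∧ x < μ t ∧ Int.emod (Q x t) (n : ℤ) = j ∧
        QmovUp n (μ t) (fun y => Q y t) x
    then Q x t + 1 else Q x t

/-- `ẽ^t_j` on `Q` acting on column `t₀`. -/
noncomputable def applyQE (n : ℕ) (μ : ℕ → ℕ) (Q : ℕ → ℕ → ℤ) (j : ℤ) (t₀ : ℕ) :
    ℕ → ℕ → ℤ :=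
  fun x t =>
    if t = t₀ ∧ x < μ t ∧ Int.emod (Q x t) (n : ℤ) = Int.emod (j + 1) (n : ℤ) ∧
        QmovDown n (μ t) (fun y => Q y t) x
    then Q x t - 1 else Q x t

/-! ### Standardization -/

noncomputable def rowSumA (A : Mat) (i : ℤ) : ℕ := ∑ᶠ j : ℤ, A i j

noncomputable def colSumA (A : Mat) (j : ℤ) : ℕ := ∑ᶠ i : ℤ, A i j

/-- `A ∈ M̂_{m×n}(α, β)`. -/
def InMhatAB (m n : ℕ) (α β : ℕ → ℕ) (A : Mat) : Prop :=
  IsGAP m n A ∧ (∀ i : ℕ, 1 ≤ i → i ≤ m → rowSumA A i = α i) ∧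
    ∀ j : ℕ, 1 ≤ j → j ≤ n → colSumA A j = β j

/-- Extended affine permutations `W̃_K`. -/
def IsEAP (K : ℕ) (B : Mat) : Prop :=
  IsGAP K K B ∧ (∀ i j : ℤ, B i j ≤ 1) ∧ (∀ i : ℤ, ∃! j : ℤ, B i j ≠ 0) ∧
    ∀ j : ℤ, ∃! i : ℤ, B i j ≠ 0

/-- `i` is a descent of the matrix `B`. -/
def IsDescentM (B : Mat) (i : ℤ) : Prop :=
  ∃ j j' : ℤ, B i j ≠ 0 ∧ B (i + 1) j' ≠ 0 ∧ j' < j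

/-- Partial sums `α₁ + ⋯ + α_i`. -/
def psum (α : ℕ → ℕ) (i : ℕ) : ℕ := ∑ u ∈ Finset.Icc 1 i, α u

/-- `B` is `α`-descending. -/
def AlphaDescending (m : ℕ) (α : ℕ → ℕ) (B : Mat) : Prop :=
  ∀ k : ℕ, 1 ≤ k → k ≤ m → ∀ i : ℤ,
    (psum α (k - 1) : ℤ) < i → i < (psum α k : ℤ) → IsDescentM B i

/-- `B` is `(α, β)`-descending. -/
def IsABDescending (m n : ℕ) (α β : ℕ → ℕ) (B : Mat) : Prop :=
  AlphaDescending m α B ∧ AlphaDescending n β (transM B)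

/-- `B` standardizes `A`: blockwise entry sums of `B` over `𝓘_i × 𝓙_j`
equal the entries of `A`. -/
def PermOf (m n K : ℕ) (α β : ℕ → ℕ) (A B : Mat) : Prop :=
  ∀ (i₀ j₀ : ℕ) (q r : ℤ), 1 ≤ i₀ → i₀ ≤ m → 1 ≤ j₀ → j₀ ≤ n →
    A ((i₀ : ℤ) + q * m) ((j₀ : ℤ) + r * n) =
      ∑ k ∈ Finset.Icc ((psum α (i₀ - 1) : ℤ) + q * K + 1) ((psum α i₀ : ℤ) + q * K),
        ∑ l ∈ Finset.Icc ((psum β (j₀ - 1) : ℤ) + r * K + 1) ((psum β j₀ : ℤ) + r * K),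
          B k l

/-- Standardization of a column-semistandard tableau: for each value `v`, its
occurrences, from left to right, are replaced by consecutive integers starting
after the number of strictly smaller entries. -/
noncomputable def stdT (s : ℕ) (μ : ℕ → ℕ) (T : ℕ → ℕ → ℤ) : ℕ → ℕ → ℤ :=
  fun x t =>
    ((∑ t' ∈ Finset.range s,
        ((Finset.range (μ t')).filter (fun x' => T x' t' < T x t)).card : ℕ) : ℤ) +
      (((Finset.range t).filter (fun t' => ∃ x' < μ t', T x' t' = T x t)).card : ℤ) + 1

/-- `i` is a (column) descent of the tableau `T`: the letter `i + 1` occurs in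
a column strictly to the right of the column containing `i`. -/
def IsDescentT (s : ℕ) (μ : ℕ → ℕ) (T : ℕ → ℕ → ℤ) (i : ℤ) : Prop :=
  ∃ t < s, ∃ t' < s, ∃ x < μ t, ∃ x' < μ t', T x t = i ∧ T x' t' = i + 1 ∧ t < t'

/-! ### Rectangles, `B_n(R)` and `B_n(R)₀` (columns indexed from the right) -/

/-- `T ∈ B_n(R)` for the rectangle `R = (a^b)`; `T j x` is the entry at row `x`
of the `(j+1)`-st column from the right, normalized to `0` outside the shape. -/
def InBnR (n a b : ℕ) (T : ℕ → ℕ → ℤ) : Prop :=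
  (∀ j : ℕ, j + 1 < a → ∀ x < b, T (j + 1) x ≤ T j x) ∧
  (∀ j < a, ∀ x : ℕ, x + 1 < b → T j x < T j (x + 1)) ∧
  (∀ j < a, T j (b - 1) - T j 0 < (n : ℤ)) ∧
    ∀ j x : ℕ, a ≤ j ∨ b ≤ x → T j x = 0

/-- `T ∈ B_n(R)₀`: `(T^{j+1}, τ_n^{-1}(T^j))` is not semistandard for any `j`. -/
def InBnR0 (n a b : ℕ) (T : ℕ → ℕ → ℤ) : Prop :=
  InBnR n a b T ∧
    ∀ j : ℕ, j + 1 < a → ¬ ∀ x < b, T (j + 1) x ≤ tauPow n b (-1) (fun y => T j y) x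

/-- `ν ∈ 𝒫_{a-1}`: a partition `ν₁ ≥ ⋯ ≥ ν_{a-1} ≥ 0`, normalized. -/
def IsPartLen (a : ℕ) (ν : ℕ → ℕ) : Prop :=
  ν 0 = 0 ∧ (∀ j : ℕ, 1 ≤ j → j + 2 ≤ a → ν (j + 1) ≤ ν j) ∧ ∀ j : ℕ, a ≤ j → ν j = 0

/-- `(T, ν) ↦ τ_n^{ν_rev}(T)`: the column `j` (from the right, 0-based) is
shifted by `τ_n^{ν_{j+1}}`. -/
noncomputable def PhiMap (n a b : ℕ) (T : ℕ → ℕ → ℤ) (ν : ℕ → ℕ) : ℕ → ℕ → ℤ :=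
  fun j x => if j < a ∧ x < b then tauPow n b ((ν (j + 1) : ℤ)) (fun y => T j y) x else 0

/-- The offset `r_j` of `T` (columns from the right, paper indexing `j ≥ 1`). -/
noncomputable def rOffR (n b : ℕ) (T : ℕ → ℕ → ℤ) (j : ℕ) : ℕ :=
  sInf {r : ℕ | ∀ x < b, T j x ≤ tauPow n b ((r : ℤ)) (fun y => T (j - 1) y) x}

/-- The symmetrized offset `η_j = r_j + ⋯ + r_{a-1}`. -/
noncomputable def etaR (n a b : ℕ) (T : ℕ → ℕ → ℤ) (j : ℕ) : ℕ :=
  ∑ u ∈ Finset.Icc j (a - 1), rOffR n b T u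

/-! ### The two-column setup -/

/-- Row coordinates of the stream with defining data `(a, ·, ρ)`:
`X(p + ρ + ql) = a(p) + qm` for `1 ≤ p ≤ l`. -/
def streamX (m l : ℕ) (a : ℕ → ℤ) (ρ : ℤ) (idx : ℤ) : ℤ := colExt m l a (idx - ρ - 1)

/-- Column coordinates: `Y(p + ql) = b(p) + qn` for `1 ≤ p ≤ l`. -/
def streamY (n l : ℕ) (b : ℕ → ℤ) (idx : ℤ) : ℤ := colExt n l b (idx - 1)

/-- The matrix built from the interleaved streams `t` and `t'`. -/
noncomputable def twoColMat (m n l : ℕ) (a1 a2 b1 b2 : ℕ → ℤ) (ρ₁ ρ₂ k : ℤ) : Mat :=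
  fun x y =>
    (if ∃ i : ℤ, streamX m l a2 ρ₂ (i + k) = x ∧ streamY n l b1 i = y then 1 else 0) +
      (if ∃ i : ℤ, streamX m l a1 ρ₁ i = x ∧ streamY n l b2 (i + k) = y then 1 else 0)



/-! ### Finiteness -/

theorem IsGAP.perq {m n : ℕ} {A : Mat} (h : IsGAP m n A) (q : ℤ) (i j : ℤ) :
    A (i + q * m) (j + q * n) = A i j := by
  induction q using Int.induction_on with
  | zero => simp
  | succ k ih => rw [← ih, ← h.1 (i + k * m) (j + k * n)]; congr 1 <;> ring
  | pred k ih => rw [← ih, ← h.1 (i + (-k - 1) * m) (j + (-k - 1) * n)]; congr 1 <;> ring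

theorem IsGAP.bd {m n : ℕ} {A : Mat} (h : IsGAP m n A) (hn : 0 < n) :
    ∃ W : ℤ, ∀ x y, A x y ≠ 0 → -W ≤ x * n - y * m ∧ x * n - y * m ≤ W := by
  have hf : (⋃ j ∈ Finset.Ico (0 : ℤ) n, {c : Cell | A c.1 c.2 ≠ 0 ∧ c.2 = j}).Finite := by
    refine Set.Finite.biUnion (Finset.finite_toSet _) fun j _ => ?_
    refine ((h.2 j).image fun i => ((i, j) : Cell)).subset ?_
    rintro ⟨a, b⟩ ⟨h1, rfl⟩
    exact ⟨a, h1, rfl⟩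
  obtain ⟨W, hW⟩ := (hf.image fun c : Cell => |c.1 * n - c.2 * m|).bddAbove
  refine ⟨W, fun x y hxy => ?_⟩
  rw [← abs_le]
  apply hW
  refine ⟨(x + (-(y / n)) * m, y + (-(y / n)) * n), ?_, ?_⟩
  · have hn' : (0 : ℤ) < n := by exact_mod_cast hn
    simp only [Set.mem_iUnion, Set.mem_ofPred_eq, Finset.coe_Ico, Set.mem_Ico]
    refine ⟨_, ?_, by rwa [h.perq], rfl⟩
    have h1 := Int.emod_add_mul_ediv y n
    have h2 := Int.emod_nonneg y hn'.ne'
    have h3 := Int.emod_lt_of_pos y hn'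
    simp only [Finset.mem_Ico]
    constructor <;> nlinarith
  · simp only; congr 1; ring

theorem gap_of_bd {m n : ℕ} {A : Mat} (hn : 0 < n)
    (h1 : ∀ i j : ℤ, A (i + m) (j + n) = A i j) (W : ℤ)
    (hW : ∀ x y, A x y ≠ 0 → -W ≤ x * n - y * m ∧ x * n - y * m ≤ W) : IsGAP m n A := by
  refine ⟨h1, fun j => (Set.finite_Icc (-(|j * m| + |W|)) (|j * m| + |W|)).subset fun i hi => ?_⟩
  have hn' : (1 : ℤ) ≤ n := by exact_mod_cast hn
  have h2 := hW i j hi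
  have h3 := neg_abs_le (j * m); have h4 := le_abs_self (j * m); have h5 := le_abs_self W
  have h6 := abs_nonneg (j * m); have h7 := abs_nonneg W
  constructor <;> nlinarith [le_abs_self i, neg_abs_le i]

theorem IsGAP.trans {m n : ℕ} {A : Mat} (h : IsGAP m n A) (hm : 0 < m) (hn : 0 < n) :
    IsGAP n m (transM A) := by
  obtain ⟨W, hW⟩ := h.bd hn
  exact gap_of_bd hm (fun i j => h.1 j i) W fun x y hxy => by have := hW y x hxy; constructor <;> linarith

/-- cells in rows `≤ x` have bounded column -/
theorem IsGAP.bdY {m n : ℕ} {A : Mat} (h : IsGAP m n A) (hm : 0 < m) (hn : 0 < n) (x : ℤ) :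
    ∃ Y, ∀ x' ≤ x, ∀ y, A x' y ≠ 0 → y ≤ Y := by
  obtain ⟨W, hW⟩ := h.bd hn
  have hn' : (1 : ℤ) ≤ n := by exact_mod_cast hn
  have hm' : (1 : ℤ) ≤ m := by exact_mod_cast hm
  refine ⟨|x * n| + |W|, fun x' hx y hy => ?_⟩
  have h2 := hW x' y hy
  have h4 := le_abs_self (x * n); have h5 := le_abs_self W
  have h6 := abs_nonneg (x * n); have h7 := abs_nonneg W
  by_contra hc
  nlinarith

theorem IsGAP.bdYl {m n : ℕ} {A : Mat} (h : IsGAP m n A) (hm : 0 < m) (hn : 0 < n) (x : ℤ) :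
    ∃ Y, ∀ x' ≥ x, ∀ y, A x' y ≠ 0 → Y ≤ y := by
  obtain ⟨W, hW⟩ := h.bd hn
  have hn' : (1 : ℤ) ≤ n := by exact_mod_cast hn
  have hm' : (1 : ℤ) ≤ m := by exact_mod_cast hm
  refine ⟨-(|x * n| + |W|), fun x' hx y hy => ?_⟩
  have h2 := hW x' y hy
  have h4 := neg_abs_le (x * n); have h5 := le_abs_self W
  have h6 := abs_nonneg (x * n); have h7 := abs_nonneg W
  by_contra hc
  nlinarith

/-! ### Solutions of the growth rule -/

structure Sol (m n : ℕ) (A : Mat) (l : ℕ) (N : ℤ → ℤ → ℤ) : Prop where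
  lpos : 0 < l
  monx : ∀ x y, N (x - 1) y ≤ N x y
  mony : ∀ x y, N x (y - 1) ≤ N x y
  cell : ∀ x y, A x y ≠ 0 → N (x - 1) (y - 1) + 1 ≤ N x y
  att : ∀ x y, ∃ x' ≤ x, ∃ y' ≤ y, A x' y' ≠ 0 ∧ N x y = N (x' - 1) (y' - 1) + 1
  per : ∀ x y, N (x + m) (y + n) = N x y + l

theorem mono_of_pred {f : ℤ → ℤ} (h : ∀ x, f (x - 1) ≤ f x) : Monotone f :=
  monotone_int_of_le_succ fun x => by simpa using h (x + 1)

section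
variable {m n : ℕ} {A : Mat} {l : ℕ} {N : ℤ → ℤ → ℤ}

theorem Sol.trans (S : Sol m n A l N) : Sol n m (transM A) l (fun x y => N y x) where
  lpos := S.lpos
  monx x y := S.mony y x
  mony x y := S.monx y x
  cell x y h := S.cell y x h
  att x y := by
    obtain ⟨a, ha, b, hb, h⟩ := S.att y x
    exact ⟨b, hb, a, ha, h⟩
  per x y := S.per y x

theorem Sol.mono (S : Sol m n A l N) {x x' y y' : ℤ} (hx : x ≤ x') (hy : y ≤ y') :
    N x y ≤ N x' y' :=
  (mono_of_pred (fun t => S.mony x t) hy).trans (mono_of_pred (f := fun t => N t y') (fun t => S.monx t y') hx)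

theorem Sol.le1 (S : Sol m n A l N) (x y : ℤ) : N x y ≤ N (x - 1) (y - 1) + 1 := by
  obtain ⟨a, ha, b, hb, _, h⟩ := S.att x y
  rw [h]
  have := S.mono (x := a - 1) (x' := x - 1) (y := b - 1) (y' := y - 1) (by omega) (by omega)
  omega

theorem Sol.celleq (S : Sol m n A l N) {x y : ℤ} (h : A x y ≠ 0) :
    N x y = N (x - 1) (y - 1) + 1 := le_antisymm (S.le1 x y) (S.cell x y h)

theorem Sol.perq (S : Sol m n A l N) (q x y : ℤ) : N (x + q * m) (y + q * n) = N x y + q * l := by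
  induction q using Int.induction_on with
  | zero => simp
  | succ k ih =>
    have := S.per (x + k * m) (y + k * n)
    rw [ih] at this
    have e1 : x + k * m + m = x + ((k : ℤ) + 1) * m := by ring
    have e2 : y + k * n + n = y + ((k : ℤ) + 1) * n := by ring
    rw [e1, e2] at this
    linarith
  | pred k ih =>
    have := S.per (x + (-k - 1) * m) (y + (-k - 1) * n)
    have e1 : x + (-k - 1) * m + m = x + -k * (m : ℤ) := by ring
    have e2 : y + (-k - 1) * n + n = y + -k * (n : ℤ) := by ring
    rw [e1, e2, ih] at this
    linarith

/-- bounded above along columns -/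
theorem Sol.bdX (S : Sol m n A l N) (hA : IsGAP m n A) (hm : 0 < m) (hn : 0 < n) (y : ℤ) :
    ∃ X, ∀ x, N x y ≤ N X y := by
  obtain ⟨X, hX⟩ := (hA.trans hm hn).bdY hn hm y
  refine ⟨X, fun x => ?_⟩
  obtain ⟨a, ha, b, hb, h0, h⟩ := S.att x y
  rw [h, ← S.celleq h0]
  exact S.mono (hX b hb a h0) hb

theorem Sol.bdY (S : Sol m n A l N) (hA : IsGAP m n A) (hm : 0 < m) (hn : 0 < n) (x : ℤ) :
    ∃ Y, ∀ y, N x y ≤ N x Y := S.trans.bdX (hA.trans hm hn) hn hm x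

/-- tends to `-∞` along rows -/
theorem Sol.lowY (S : Sol m n A l N) (hA : IsGAP m n A) (hm : 0 < m) (hn : 0 < n) (x k : ℤ) :
    ∃ y, N x y < k := by
  obtain ⟨X, hX⟩ := S.bdX hA hm hn 0
  have hl : (1 : ℤ) ≤ l := by exact_mod_cast S.lpos
  let q : ℤ := |N X 0| + |k| + 1
  refine ⟨0 + (-q) * n, ?_⟩
  have h1 := S.perq (-q) (x + q * m) 0
  have h2 := hX (x + q * m)
  have e1 : x + q * m + -q * m = x := by ring
  rw [e1] at h1
  rw [h1]
  have h3 := le_abs_self (N X 0); have h4 := neg_abs_le k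
  have : q ≤ q * l := by
    have : 0 ≤ q := by positivity
    nlinarith
  simp only [q] at *
  linarith

theorem Sol.lowX (S : Sol m n A l N) (hA : IsGAP m n A) (hm : 0 < m) (hn : 0 < n) (y k : ℤ) :
    ∃ x, N x y < k := S.trans.lowY (hA.trans hm hn) hn hm y k

end


/-! ### Rows -/

/-- one row of the growth rule -/
structure Row (X : ℤ → ℕ) (N N' : ℤ → ℤ) : Prop where
  r : ∀ y, (N' y = N y ∨ N' y = N y + 1) ∧ (N y = N (y - 1) ∨ N y = N (y - 1) + 1) ∧
    (N' y = N y + 1 ↔ N y = N (y - 1) ∧ (N' (y - 1) = N (y - 1) + 1 ∨ X y ≠ 0))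
  low : ∃ Y, ∀ y ≤ Y, N' y = N y

theorem int_up {P : ℤ → Prop} {a : ℤ} (h0 : P a) (hs : ∀ y, a < y → P (y - 1) → P y) :
    ∀ y, a ≤ y → P y := fun y hy =>
  Int.leInduction (motive := fun t _ => P t) h0
    (fun k hk h => hs (k + 1) (by omega) (by simpa using h)) y hy

theorem int_low {P : ℤ → Prop} (h0 : ∃ Y, ∀ y ≤ Y, P y) (hs : ∀ y, P (y - 1) → P y) (y : ℤ) : P y := by
  obtain ⟨Y, hY⟩ := h0
  rcases le_total y Y with h | h
  · exact hY y h
  · exact int_up (hY Y le_rfl) (fun y _ => hs y) y h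

theorem Row.uniq {X : ℤ → ℕ} {N N1 N2 : ℤ → ℤ} (h1 : Row X N N1) (h2 : Row X N N2) : N1 = N2 := by
  funext y
  obtain ⟨Y1, hY1⟩ := h1.low
  obtain ⟨Y2, hY2⟩ := h2.low
  refine int_low (P := fun y => N1 y = N2 y) ⟨min Y1 Y2, fun y hy => ?_⟩ (fun y hy => ?_) y
  · rw [hY1 y (by omega), hY2 y (by omega)]
  · have := h1.r y; have := h2.r y; omega

theorem Row.shift {X : ℤ → ℕ} {N N' : ℤ → ℤ} (h : Row X N N') (a b : ℤ) :
    Row (fun y => X (y - a)) (fun y => N (y - a) + b) (fun y => N' (y - a) + b) where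
  r y := by
    have := h.r (y - a)
    have e : y - 1 - a = y - a - 1 := by ring
    simp only [e]
    omega
  low := by
    obtain ⟨Y, hY⟩ := h.low
    exact ⟨Y + a, fun y hy => by rw [hY _ (by omega)]⟩

theorem Row.cl {X : ℤ → ℕ} {N N' : ℤ → ℤ} (h : Row X N N') {y : ℤ} (hy : N' y = N y + 1) :
    ∃ y' ≤ y, X y' ≠ 0 ∧ N (y' - 1) = N y := by
  obtain ⟨Y, hY⟩ := h.low
  refine int_low (P := fun y => N' y = N y + 1 → ∃ y' ≤ y, X y' ≠ 0 ∧ N (y' - 1) = N y)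
    ⟨Y, fun y hy h => by have := hY y hy; omega⟩ (fun y ih hy => ?_) y hy
  have h2 := ((h.r y).2.2).1 hy
  by_cases hx : X y = 0
  · obtain ⟨y', h3, h4, h5⟩ := ih (by tauto)
    exact ⟨y', by omega, h4, by omega⟩
  · exact ⟨y, le_rfl, hx, h2.1.symm⟩

theorem Row.ex (X : ℤ → ℕ) (N : ℤ → ℤ) (hX : ∃ Y, ∀ y ≤ Y, X y = 0)
    (hN : ∀ y, N y = N (y - 1) ∨ N y = N (y - 1) + 1) : ∃ N', Row X N N' := by
  have hm : Monotone N := mono_of_pred fun y => by have := hN y; omega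
  refine ⟨fun y => if ∃ y' ≤ y, X y' ≠ 0 ∧ N (y' - 1) = N y then N y + 1 else N y, ⟨fun y => ⟨?_, hN y, ?_⟩, ?_⟩⟩
  · split_ifs <;> simp
  · have key : (∃ y' ≤ y, X y' ≠ 0 ∧ N (y' - 1) = N y) ↔ N y = N (y - 1) ∧
        ((∃ y' ≤ y - 1, X y' ≠ 0 ∧ N (y' - 1) = N (y - 1)) ∨ X y ≠ 0) := by
      constructor
      · rintro ⟨y', h1, h2, h3⟩
        have h4 : N (y' - 1) ≤ N (y - 1) := hm (by omega)
        have h5 := hN y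
        refine ⟨by omega, ?_⟩
        rcases eq_or_ne y' y with rfl | h
        · exact Or.inr h2
        · exact Or.inl ⟨y', by omega, h2, by omega⟩
      · rintro ⟨h1, ⟨y', h2, h3, h4⟩ | h2⟩
        · exact ⟨y', by omega, h3, by omega⟩
        · exact ⟨y, le_rfl, h2, h1.symm⟩
    by_cases c1 : ∃ y' ≤ y, X y' ≠ 0 ∧ N (y' - 1) = N y <;>
    by_cases c2 : ∃ y' ≤ y - 1, X y' ≠ 0 ∧ N (y' - 1) = N (y - 1) <;>
    simp only [if_pos, if_neg, c1, c2, true_iff, false_iff, true_or, false_or, and_true, not_false_eq_true] at key ⊢ <;> omega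
  · obtain ⟨Y, hY⟩ := hX
    refine ⟨Y, fun y hy => if_neg ?_⟩
    rintro ⟨y', h1, h2, _⟩
    exact h2 (hY y' (by omega))

/-- signature height function -/
def IsD (X1 X2 : ℤ → ℕ) (D : ℤ → ℤ) : Prop :=
  (∀ y, D y = D (y - 1) + X2 y - X1 (y - 1)) ∧ ∃ Y, ∀ y ≤ Y, D y = 0

/-- last maximum -/
def Ftop (D : ℤ → ℤ) (j : ℤ) : Prop := (∀ y, j < y → D y < D j) ∧ ∀ y, D y ≤ D j

theorem IsD.uniq {X1 X2 : ℤ → ℕ} {D D' : ℤ → ℤ} (h1 : IsD X1 X2 D) (h2 : IsD X1 X2 D') : D = D' := by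
  funext y
  obtain ⟨Y1, hY1⟩ := h1.2
  obtain ⟨Y2, hY2⟩ := h2.2
  refine int_low (P := fun y => D y = D' y) ⟨min Y1 Y2, fun y hy => ?_⟩ (fun y hy => ?_) y
  · rw [hY1 y (by omega), hY2 y (by omega)]
  · have := h1.1 y; have := h2.1 y; omega

section
variable {X1 X2 B1 B2 : ℤ → ℕ} {N0 N1 N2 D : ℤ → ℤ}

/-- the flattened row -/
def FlatRow (X B : ℤ → ℕ) (N N' : ℤ → ℤ) : Prop :=
  ∀ y, (B y : ℤ) + N' y + N (y - 1) = X y + N y + N' (y - 1)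

theorem isD_flat (r1 : Row X1 N0 N1) (r2 : Row X2 N1 N2) (hD : IsD X1 X2 D)
    (f1 : FlatRow X1 B1 N0 N1) (f2 : FlatRow X2 B2 N1 N2) :
    IsD B1 B2 (fun y => D y + (N1 (y - 1) - N0 (y - 1)) - (N2 y - N1 y)) := by
  refine ⟨fun y => ?_, ?_⟩
  · have h1 := hD.1 y; have h2 := f1 (y - 1); have h3 := f2 y
    simp only; omega
  · obtain ⟨Y1, hY1⟩ := r1.low
    obtain ⟨Y2, hY2⟩ := r2.low
    obtain ⟨Y, hY⟩ := hD.2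
    refine ⟨min (min Y1 Y2) Y, fun y hy => ?_⟩
    have := hY1 (y - 1) (by omega); have := hY2 y (by omega); have := hY y (by omega)
    simp only; omega

/-- propagation step for the bound -/
theorem inv_step (r1 : Row X1 N0 N1) (r2 : Row X2 N1 N2) (hD : IsD X1 X2 D) {T y : ℤ}
    (hT : D y ≤ T)
    (ih : N1 (y - 1) = N0 (y - 1) + 1 ∧ N2 (y - 1) = N1 (y - 1) → D (y - 1) - X1 (y - 1) ≤ T - 1) :
    (D y + (N1 (y - 1) - N0 (y - 1)) - (N2 y - N1 y) ≤ T) ∧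
      (N1 y = N0 y + 1 ∧ N2 y = N1 y → D y - X1 y ≤ T - 1) := by
  have h1 := r1.r y; have h2 := r2.r y; have h3 := hD.1 y
  have h4 := r1.r (y - 1); have h5 := r2.r (y - 1)
  omega

theorem inv_all (r1 : Row X1 N0 N1) (r2 : Row X2 N1 N2) (hD : IsD X1 X2 D) {T : ℤ}
    (hT : ∀ y, D y ≤ T) (y : ℤ) :
    N1 y = N0 y + 1 ∧ N2 y = N1 y → D y - X1 y ≤ T - 1 := by
  obtain ⟨Y, hY⟩ := r1.low
  exact int_low (P := fun y => N1 y = N0 y + 1 ∧ N2 y = N1 y → D y - X1 y ≤ T - 1)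
    ⟨Y, fun y hy h => by have := hY y hy; omega⟩ (fun y ih => (inv_step r1 r2 hD (hT y) ih).2) y

theorem flat_le (r1 : Row X1 N0 N1) (r2 : Row X2 N1 N2) (hD : IsD X1 X2 D) {T : ℤ}
    (hT : ∀ y, D y ≤ T) (y : ℤ) : D y + (N1 (y - 1) - N0 (y - 1)) - (N2 y - N1 y) ≤ T :=
  (inv_step r1 r2 hD (hT y) (inv_all r1 r2 hD hT (y - 1))).1

/-- result of the local lemma; `U` is the set of columns at which the middle row drops -/
structure Loc (X1 X2 : ℤ → ℕ) (N0 N1 N2 D : ℤ → ℤ) (j : ℤ) (N1' : ℤ → ℤ) : Prop where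
  r1 : Row (fun y => if y = j then X1 y - 1 else X1 y) N0 N1'
  r2 : Row (fun y => if y = j then X2 y + 1 else X2 y) N1' N2
  alt : (∃ u, j ≤ u ∧ (∀ y, N1' y = if j ≤ y ∧ y < u then N1 y - 1 else N1 y) ∧
      Ftop (fun y => D y + (N1 (y - 1) - N0 (y - 1)) - (N2 y - N1 y)) u ∧
      D u + (N1 (u - 1) - N0 (u - 1)) - (N2 u - N1 u) = D j) ∨
    ((∀ y, N1' y = if j ≤ y then N1 y - 1 else N1 y) ∧
      ∀ y, j ≤ y → N1 y = N0 y + 1 ∧ N2 y = N1 y ∧ N0 y = N0 (y - 1) ∧ N1 j = N1 (j-1) + 1 ∧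
        D y + (N1 (y - 1) - N0 (y - 1)) - (N2 y - N1 y) = D j)

theorem ftop_of (r1 : Row X1 N0 N1) (r2 : Row X2 N1 N2) (hD : IsD X1 X2 D) {j u : ℤ}
    (hj : Ftop D j) (hu : j ≤ u)
    (h0 : D u + (N1 (u - 1) - N0 (u - 1)) - (N2 u - N1 u) = D j)
    (h1 : N1 u = N0 u + 1 ∧ N2 u = N1 u → D u - X1 u ≤ D j - 2) :
    Ftop (fun y => D y + (N1 (y - 1) - N0 (y - 1)) - (N2 y - N1 y)) u := by
  have key := int_up (P := fun y => N1 y = N0 y + 1 ∧ N2 y = N1 y → D y - X1 y ≤ (D j - 1) - 1)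
    (a := u) (by intro h; have := h1 h; omega)
    (fun y hy ih => (inv_step r1 r2 hD (by have := hj.1 y (by omega); omega) ih).2)
  refine ⟨fun y hy => ?_, fun y => ?_⟩
  · simp only [h0]
    have := (inv_step r1 r2 hD (T := D j - 1) (y := y) (by have := hj.1 y (by omega); omega)
      (key (y - 1) (by omega))).1
    omega
  · simp only [h0]
    exact flat_le r1 r2 hD hj.2 y

theorem loc_rows (r1 : Row X1 N0 N1) (r2 : Row X2 N1 N2) {j : ℤ} {f : ℤ → ℤ} {S : ℤ → Prop}
    (hX : X1 j = 1) (hp : N1 (j - 1) = N0 (j - 1)) (h0 : N0 j = N0 (j - 1)) (hS0 : S j)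
    (hS : ∀ y, S y → j ≤ y)
    (h1 : ∀ y, S y → f y = N0 y ∧ N1 y = N0 y + 1 ∧ N2 y = f y + 1) (h2 : ∀ y, ¬ S y → f y = N1 y)
    (h3 : ∀ y, S y → y ≠ j → S (y - 1) ∧ N0 y = N0 (y - 1) ∧ X1 y = 0)
    (h4 : ∀ y, ¬ S y → S (y - 1) → (N0 y = N0 (y - 1) → X1 y ≠ 0) ∧ N2 y = N1 y) :
    Row (fun y => if y = j then X1 y - 1 else X1 y) N0 f ∧
      Row (fun y => if y = j then X2 y + 1 else X2 y) f N2 := by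
  obtain ⟨Y1, hY1⟩ := r1.low
  obtain ⟨Y2, hY2⟩ := r2.low
  have hj : ¬ S (j - 1) := fun h => by have := hS _ h; omega
  have hf : ∀ y ≤ j - 1, f y = N1 y := fun y hy => h2 y fun h => by have := hS _ h; omega
  refine ⟨⟨fun y => ?_, ⟨min Y1 (j - 1), fun y hy => by rw [hf y (by omega), hY1 y (by omega)]⟩⟩,
    ⟨fun y => ?_, ⟨min Y2 (j - 1), fun y hy => by rw [hf y (by omega), hY2 y (by omega)]⟩⟩⟩
  · have d := r1.r y
    by_cases hy : S y
    · have e1 := h1 y hy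
      rcases eq_or_ne y j with rfl | h
      · have := h2 _ hj
        simp only [if_true]; omega
      · have e2 := h3 y hy h
        have := h1 _ e2.1
        simp only [h, if_false]; omega
    · have hyj : y ≠ j := fun h => hy (h ▸ hS0)
      have := h2 y hy
      simp only [hyj, if_false]
      by_cases hy' : S (y - 1)
      · have e3 := h1 _ hy'; have e := h4 y hy hy'
        refine ⟨by omega, d.2.1, ?_⟩
        rw [this, d.2.2]
        exact ⟨fun h => ⟨h.1, Or.inr (e.1 h.1)⟩, fun h => ⟨h.1, Or.inl (by omega)⟩⟩
      · rw [this, h2 _ hy']; exact d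
  · have d := r2.r y; have d' := r1.r y
    by_cases hy : S y
    · have e1 := h1 y hy
      rcases eq_or_ne y j with rfl | h
      · have := h2 _ hj
        simp only [if_true]; omega
      · have e2 := h3 y hy h
        have := h1 _ e2.1
        simp only [h, if_false]; omega
    · have hyj : y ≠ j := fun h => hy (h ▸ hS0)
      have := h2 y hy
      simp only [hyj, if_false]
      by_cases hy' : S (y - 1)
      · have e3 := h1 _ hy'; have e := h4 y hy hy'
        have : N1 y = N0 (y - 1) + 1 := by
          rcases d'.2.1 with h | h
          · have := d'.2.2.2 ⟨h, Or.inr (e.1 h)⟩; omega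
          · have : N1 y ≠ N0 y + 1 := fun h' => by have := (d'.2.2.1 h').1; omega
            omega
        omega
      · rw [this, h2 _ hy']; exact d

set_option maxHeartbeats 1000000 in
theorem local_lemma (r1 : Row X1 N0 N1) (r2 : Row X2 N1 N2) (hD : IsD X1 X2 D) {j : ℤ}
    (hj : Ftop D j) : ∃ N1', Loc X1 X2 N0 N1 N2 D j N1' := by
  have hX : X1 j ≠ 0 := by
    have := hj.1 (j + 1) (by omega); have h2 := hD.1 (j + 1)
    simp only [add_sub_cancel_right] at h2; omega
  have a1 := r1.r j; have a2 := r2.r j; have a3 := hD.1 j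
  have a4 := r1.r (j - 1); have a5 := r2.r (j - 1)
  have a6 := inv_all r1 r2 hD hj.2 (j - 1)
  obtain ⟨Y1, hY1⟩ := r1.low
  obtain ⟨Y2, hY2⟩ := r2.low
  by_cases hs : N0 j = N0 (j - 1) ∧ N1 (j - 1) = N0 (j - 1) ∧ X1 j = 1
  swap
  · have k1 : N0 j = N0 (j - 1) → N1 j = N0 j + 1 := fun h => a1.2.2.2 ⟨h, Or.inr hX⟩
    have k2 : N0 j ≠ N0 (j - 1) → N1 j = N0 j := fun h => by
      rcases a1.1 with h' | h'
      · exact h'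
      · exact absurd (a1.2.2.1 h').1 h
    have hq : N1 j = N1 (j - 1) → N2 (j - 1) = N1 (j - 1) + 1 ∨ X2 j ≠ 0 := by
      intro h
      have hp : N1 (j - 1) = N0 (j - 1) + 1 := by
        clear a2 a3 a5 a6; by_cases h0 : N0 j = N0 (j - 1)
        · have := k1 h0; omega
        · have := k2 h0; omega
      by_contra hc
      push Not at hc
      have := a6 ⟨hp, by clear a2 a1; omega⟩
      clear a2 a1; omega
    have hq1 : N1 j = N1 (j - 1) → N2 j = N1 j + 1 := fun h => a2.2.2.2 ⟨h, hq h⟩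
    have hq2 : N1 j ≠ N1 (j - 1) → N2 j = N1 j := fun h => by
      rcases a2.1 with h' | h'
      · exact h'
      · exact absurd (a2.2.2.1 h').1 h
    have hp : N1 j = N1 (j - 1) ↔ N1 (j - 1) = N0 (j - 1) + 1 := by
      clear a2 a3 a5 a6 hq1 hq2 hq hs
      by_cases h0 : N0 j = N0 (j - 1)
      · have := k1 h0; omega
      · have := k2 h0; omega
    have hB : D j + (N1 (j - 1) - N0 (j - 1)) - (N2 j - N1 j) = D j := by
      by_cases h0 : N1 j = N1 (j - 1)
      · have := hq1 h0; have := hp.1 h0; omega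
      · have := hq2 h0; clear a2 a3 a5 a6 a1; omega
    refine ⟨N1, ⟨fun y => ?_, r1.low⟩, ⟨fun y => ?_, r2.low⟩, Or.inl ⟨j, le_rfl, fun y => ?_, ?_, hB⟩⟩
    · have := r1.r y
      rcases eq_or_ne y j with rfl | h
      · refine ⟨this.1, this.2.1, ?_⟩
        rw [this.2.2]
        clear a2 a3 a5 a6 this a1 k1 k2 hq hq1 hq2 hp hB
        simp only [if_true]; omega
      · simp only [h, if_false]; exact this
    · have := r2.r y
      rcases eq_or_ne y j with rfl | h
      · refine ⟨this.1, this.2.1, ?_⟩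
        rw [this.2.2]
        simp only [if_true]
        exact ⟨fun h => ⟨h.1, Or.inr (by omega)⟩, fun h => ⟨h.1, hq h.1⟩⟩
      · simp only [h, if_false]; exact this
    · rw [if_neg (by omega)]
    · refine ftop_of r1 r2 hD hj le_rfl hB fun h => ?_
      have h1 : N0 j = N0 (j - 1) := (a1.2.2.1 h.1).1
      have h2 : N1 (j - 1) ≠ N0 (j - 1) + 1 := fun h' => by have := hq1 (hp.2 h'); omega
      clear a2 a3 a5 a6 hq1 hq2 hq hp a1; omega
  -- the moving case
  have b0 : N1 j = N0 j + 1 ∧ N2 j = N1 j := by omega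
  clear a1 a2 a3 a4 a5 a6
  have inv : ∀ u, j < u → (∀ y, j < y → y < u → N0 y = N0 (y - 1) ∧ X1 y = 0) →
      ∀ y, j ≤ y → y < u → N1 y = N0 y + 1 ∧ N2 y = N1 y ∧ D y - X1 y = D j - 1 := by
    intro u hu hc
    refine int_up (P := fun y => y < u → N1 y = N0 y + 1 ∧ N2 y = N1 y ∧ D y - X1 y = D j - 1) (fun _ => by omega) ?_
    intro y hy ih hyu
    have e1 := hc y hy hyu; have e2 := r1.r y; have e3 := r2.r y; have e4 := hD.1 y
    have e5 := ih (by omega); have e6 := hj.1 y hy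
    have e7 : N1 y = N0 y + 1 := e2.2.2.2 ⟨e1.1, Or.inl e5.1⟩
    have e8 : X2 y = 0 := by clear e2 e3; omega
    refine ⟨e7, ?_, by clear e2 e3; omega⟩
    rcases e3.1 with h | h
    · exact h
    · have := (e3.2.2.1 h).2; clear e3 e2; omega
  by_cases hu : ∃ u, j < u ∧ (N0 u ≠ N0 (u - 1) ∨ X1 u ≠ 0)
  · obtain ⟨u, ⟨hu1, hu2⟩, hu3⟩ : ∃ u, (j < u ∧ (N0 u ≠ N0 (u - 1) ∨ X1 u ≠ 0)) ∧
        ∀ y, (j < y ∧ (N0 y ≠ N0 (y - 1) ∨ X1 y ≠ 0)) → u ≤ y :=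
      Int.exists_least_of_bdd ⟨j, fun z hz => hz.1.le⟩ hu
    have hc : ∀ y, j < y → y < u → N0 y = N0 (y - 1) ∧ X1 y = 0 := by
      intro y h1 h2; by_contra hcc
      have := hu3 y ⟨h1, by tauto⟩; omega
    have iv := inv u hu1 hc
    have i1 := iv (u - 1) (by omega) (by omega)
    have c1 := r1.r u; have c2 := r2.r u; have c3 := hD.1 u; have c4 := hj.1 u hu1
    have c5 : N2 u = N1 u := by clear c1; omega
    obtain ⟨l1, l2⟩ := loc_rows (f := fun y => if j ≤ y ∧ y < u then N1 y - 1 else N1 y)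
      (S := fun y => j ≤ y ∧ y < u) r1 r2 hs.2.2 hs.2.1 hs.1 (by simp [hu1]) (fun y h => h.1) (fun y h => by
        have := iv y h.1 h.2; simp only [h, and_self, if_true]; omega) (fun y h => by simp only [h, if_false])
      (fun y h h' => ⟨by omega, hc y (by omega) (by omega)⟩)
      (fun y h h' => by
        obtain rfl : y = u := by omega
        exact ⟨by omega, c5⟩)
    have c6 : D u + (N1 (u - 1) - N0 (u - 1)) - (N2 u - N1 u) = D j := by clear c1 c2; omega
    exact ⟨_, l1, l2, Or.inl ⟨u, hu1.le, fun y => rfl, ftop_of r1 r2 hD hj hu1.le c6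
      (fun h => by have := (c1.2.2.1 h.1).1; clear c1 c2; omega), c6⟩⟩
  · have hc : ∀ y, j < y → N0 y = N0 (y - 1) ∧ X1 y = 0 := by
      intro y h1; by_contra hcc
      exact hu ⟨y, h1, by tauto⟩
    have iv : ∀ y, j ≤ y → N1 y = N0 y + 1 ∧ N2 y = N1 y ∧ D y - X1 y = D j - 1 :=
      fun y hy => inv (y + 1) (by omega) (fun t h1 _ => hc t h1) y hy (by omega)
    obtain ⟨l1, l2⟩ := loc_rows (f := fun y => if j ≤ y then N1 y - 1 else N1 y)
      (S := fun y => j ≤ y) r1 r2 hs.2.2 hs.2.1 hs.1 le_rfl (fun y h => h) (fun y h => by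
        have := iv y h; simp only [h, if_true]; omega) (fun y h => by simp only [h, if_false])
      (fun y h h' => ⟨by omega, hc y (by omega)⟩)
      (fun y h h' => by omega)
    refine ⟨_, l1, l2, Or.inr ⟨fun y => rfl, fun y hy => ?_⟩⟩
    have d2 := iv y hy; have d3 := iv (y - 1); have d4 := hc y; have d5 := hD.1 y
    have d0 := r2.r y
    rcases eq_or_ne y j with rfl | h
    · exact ⟨d2.1, d2.2.1, by omega, by omega, by omega⟩
    · have := d4 (by omega); have := d3 (by omega)
      exact ⟨d2.1, d2.2.1, by omega, by omega, by omega⟩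

end


/-! ### Coupling -/

section
variable {m n : ℕ} {A A' B B' : Mat} {l : ℕ} {N N' : ℤ → ℤ → ℤ} {i j : ℤ} {D : ℤ → ℤ}

theorem Sol.row (S : Sol m n A l N) (hA : IsGAP m n A) (hm : 0 < m) (hn : 0 < n) (x : ℤ) :
    Row (A x) (N (x - 1)) (N x) := by
  refine ⟨fun y => ?_, ?_⟩
  · have h1 := S.monx x y; have h2 := S.le1 x y; have h3 := S.mony (x - 1) y; have h4 := S.mony x y
    have h5 := S.monx x (y - 1); have h6 := S.le1 (x - 1) y; have h7 := S.monx (x - 1) (y - 1)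
    refine ⟨by omega, by omega, fun h => ⟨by omega, ?_⟩, fun ⟨h, h'⟩ => ?_⟩
    · by_contra hc
      push Not at hc
      obtain ⟨a, ha, b, hb, h0, h8⟩ := S.att x y
      rw [← S.celleq h0] at h8
      rcases eq_or_ne a x with rfl | hax
      · rcases eq_or_ne b y with rfl | hby
        · exact h0 hc.2
        · have := S.mono (x := a) le_rfl (show b ≤ y - 1 by omega)
          omega
      · have := S.mono (show a ≤ x - 1 by omega) hb
        omega
    · rcases h' with h' | h'
      · omega
      · have := S.cell x y h'; omega
  · obtain ⟨Y, hY⟩ := hA.bdYl hm hn x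
    refine ⟨Y - 1, fun y hy => ?_⟩
    obtain ⟨a, ha, b, hb, h0, h8⟩ := S.att x y
    rw [← S.celleq h0] at h8
    have h1 := S.monx x y
    rcases eq_or_ne a x with rfl | hax
    · have := hY a le_rfl b h0; omega
    · have := S.mono (show a ≤ x - 1 by omega) hb
      omega

theorem sol_of_rows (lpos : 0 < l) (per : ∀ x y, N (x + m) (y + n) = N x y + l)
    (row : ∀ x, Row (A x) (N (x - 1)) (N x)) (low : ∀ y k, ∃ x, N x y < k) : Sol m n A l N := by
  have monx : ∀ x y, N (x - 1) y ≤ N x y := fun x y => by have := ((row x).r y).1; omega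
  have mono : ∀ y, Monotone fun x => N x y := fun y => mono_of_pred fun x => monx x y
  refine ⟨lpos, monx, fun x y => ?_, fun x y h => ?_, fun x y => ?_, per⟩
  · have := ((row (x + 1)).r y).2.1; simp only [add_sub_cancel_right] at this; omega
  · have := (row x).r y
    by_cases h0 : N (x - 1) y = N (x - 1) (y - 1)
    · have := this.2.2.2 ⟨h0, Or.inr h⟩; omega
    · omega
  · obtain ⟨x0, h0⟩ := low y (N x y)
    have hx : x0 ≤ x := by
      by_contra hc
      have := mono y (show x ≤ x0 by omega); simp only at this; omega
    refine int_up (P := fun t => N x0 y < N t y → ∃ x' ≤ t, ∃ y' ≤ y, A x' y' ≠ 0 ∧ N t y = N (x' - 1) (y' - 1) + 1)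
      (a := x0) (fun h => by omega) (fun t ht ih h => ?_) x hx h0
    rcases ((row t).r y).1 with h1 | h1
    · obtain ⟨a, ha, b, hb, h3, h4⟩ := ih (by omega)
      exact ⟨a, by omega, b, hb, h3, by omega⟩
    · obtain ⟨y', h2, h3, h4⟩ := (row t).cl h1
      exact ⟨t, le_rfl, y', h2, h3, by omega⟩

theorem Sol.perk (S : Sol m n A l N) (k x y : ℤ) : N (x + k * m) y = N x (y - k * n) + k * l := by
  have := S.perq k x (y - k * n); rwa [sub_add_cancel] at this

theorem IsGAP.perk (h : IsGAP m n A) (k x y : ℤ) : A (x + k * m) y = A x (y - k * n) := by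
  have := h.perq k x (y - k * n); rwa [sub_add_cancel] at this

theorem ne1 (hm : 2 ≤ m) (i k k' : ℤ) : i + k * m ≠ i + 1 + k' * m := by
  intro h
  have h1 : (k - k') * m = 1 := by linarith
  have h2 : (m : ℤ) ∣ 1 := ⟨k - k', by linarith⟩
  have := Int.le_of_dvd one_pos h2
  omega

theorem keq (hm : 2 ≤ m) {i k k' : ℤ} (h : i + k * m = i + k' * m) : k = k' := by
  have : (m : ℤ) ≠ 0 := by positivity
  exact mul_right_cancel₀ this (by linarith)

/-- replace the row `i` (periodically) -/
noncomputable def chRow (m n : ℕ) (i : ℤ) (l : ℕ) (N : ℤ → ℤ → ℤ) (N1 : ℤ → ℤ) : ℤ → ℤ → ℤ :=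
  fun x y => if (m : ℤ) ∣ (x - i) then N1 (y - (x - i) / m * n) + (x - i) / m * l else N x y

theorem chRow_at (hm : 2 ≤ m) (N1 : ℤ → ℤ) (k y : ℤ) :
    chRow m n i l N N1 (i + k * m) y = N1 (y - k * n) + k * l := by
  have h0 : (m : ℤ) ≠ 0 := by positivity
  have h1 : i + k * m - i = k * m := by ring
  rw [chRow, if_pos (by rw [h1]; exact dvd_mul_left _ _), h1, Int.mul_ediv_cancel _ h0]

theorem chRow_ne (N1 : ℤ → ℤ) {x : ℤ} (h : ∀ k : ℤ, x ≠ i + k * m) : chRow m n i l N N1 x = N x := by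
  funext y
  rw [chRow, if_neg]
  rintro ⟨k, hk⟩
  exact h k (by linarith)

theorem chRow_i (hm : 2 ≤ m) (N1 : ℤ → ℤ) : chRow m n i l N N1 i = N1 := by
  funext y
  have := chRow_at (n := n) (i := i) (l := l) (N := N) hm N1 0 y
  simpa using this

theorem sol_chRow (S : Sol m n A l N) (hA : IsGAP m n A) (hm : 2 ≤ m) (hn : 0 < n)
    (hA' : IsGAP m n A') {N1 : ℤ → ℤ} (r1 : Row (A' i) (N (i - 1)) N1)
    (r2 : Row (A' (i + 1)) N1 (N (i + 1)))
    (ho : ∀ x, (∀ k : ℤ, x ≠ i + k * m) → (∀ k : ℤ, x ≠ i + 1 + k * m) → A' x = A x) :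
    Sol m n A' l (chRow m n i l N N1) := by
  have sh1 : ∀ k : ℤ, Row (A' (i + k * m)) (N (i + k * m - 1)) (fun y => N1 (y - k * n) + k * l) := by
    intro k
    convert r1.shift (k * n) (k * l) using 1
    · funext y; rw [hA'.perk]
    · funext y; rw [← S.perk]; congr 1; ring
  have sh2 : ∀ k : ℤ, Row (A' (i + 1 + k * m)) (fun y => N1 (y - k * n) + k * l) (N (i + 1 + k * m)) := by
    intro k
    convert r2.shift (k * n) (k * l) using 1
    · funext y; rw [hA'.perk]
    · funext y; rw [← S.perk]
  have at' : ∀ k : ℤ, chRow m n i l N N1 (i + k * m) = fun y => N1 (y - k * n) + k * l :=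
    fun k => funext fun y => chRow_at hm N1 k y
  refine sol_of_rows S.lpos (fun x y => ?_) (fun x => ?_) (fun y k => ?_)
  · by_cases h : ∃ k : ℤ, x = i + k * m
    · obtain ⟨k, rfl⟩ := h
      have e : i + k * m + m = i + (k + 1) * m := by ring
      rw [e, chRow_at hm, chRow_at hm]
      have e2 : y + n - (k + 1) * n = y - k * (n : ℤ) := by ring
      rw [e2]; ring
    · rw [chRow_ne N1 (fun k hk => h ⟨k, hk⟩), chRow_ne N1 (fun k hk => h ⟨k - 1, by linarith⟩), S.per]
  · by_cases h : ∃ k : ℤ, x = i + k * m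
    · obtain ⟨k, rfl⟩ := h
      rw [at', chRow_ne N1]
      · exact sh1 k
      · intro k' hk'
        exact ne1 hm i k k' (by linarith)
    · rw [chRow_ne N1 (fun k hk => h ⟨k, hk⟩)]
      by_cases h1 : ∃ k : ℤ, x = i + 1 + k * m
      · obtain ⟨k, rfl⟩ := h1
        have e : i + 1 + k * m - 1 = i + k * m := by ring
        rw [e, at']; exact sh2 k
      · rw [chRow_ne N1 (fun k hk => h1 ⟨k, by linarith⟩), ho x (fun k hk => h ⟨k, hk⟩) (fun k hk => h1 ⟨k, hk⟩)]
        exact S.row hA (by omega) hn x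
  · obtain ⟨x, hx⟩ := S.lowX hA (by omega) hn y k
    refine ⟨x - 1, lt_of_le_of_lt ?_ hx⟩
    by_cases h : ∃ k : ℤ, x - 1 = i + k * m
    · obtain ⟨k, hk⟩ := h
      obtain rfl : x = i + 1 + k * m := by linarith
      have := ((sh2 k).r y).1
      rw [hk, at']; simp only at this ⊢; omega
    · rw [chRow_ne N1 (fun k hk => h ⟨k, hk⟩)]; exact S.monx x y

/-! ### The crystal relation on matrices -/

structure FRel (m n : ℕ) (i j : ℤ) (D : ℤ → ℤ) (A A' : Mat) : Prop where
  isD : IsD (A i) (A (i + 1)) D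
  top : Ftop D j
  eq : A' = subAddAt m n i (i + 1) j A

theorem sa_i (hm : 2 ≤ m) : subAddAt m n i (i + 1) j A i = fun y => if y = j then A i y - 1 else A i y := by
  funext y
  have h1 : (∃ k : ℤ, i = i + k * m ∧ y = j + k * n) ↔ y = j := by
    refine ⟨fun ⟨k, h, h'⟩ => ?_, fun h => ⟨0, by simp, by simpa using h⟩⟩
    have : k = 0 := keq hm (i := i) (by linarith)
    simp [h', this]
  have h2 : ¬ ∃ k : ℤ, i = i + 1 + k * m ∧ y = j + k * n := by
    rintro ⟨k, h, _⟩; exact ne1 hm i 0 k (by linarith)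
  simp only [subAddAt, h1, if_neg h2]

theorem sa_i1 (hm : 2 ≤ m) :
    subAddAt m n i (i + 1) j A (i + 1) = fun y => if y = j then A (i + 1) y + 1 else A (i + 1) y := by
  funext y
  have h1 : (∃ k : ℤ, i + 1 = i + 1 + k * m ∧ y = j + k * n) ↔ y = j := by
    refine ⟨fun ⟨k, h, h'⟩ => ?_, fun h => ⟨0, by simp, by simpa using h⟩⟩
    have : k = 0 := keq hm (i := i) (by linarith)
    simp [h', this]
  have h2 : ¬ ∃ k : ℤ, i + 1 = i + k * m ∧ y = j + k * n := by
    rintro ⟨k, h, _⟩; exact ne1 hm i k 0 (by linarith)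
  simp only [subAddAt, h1, if_neg h2]

theorem sa_o {i1 i2 x : ℤ} (h1 : ∀ k : ℤ, x ≠ i1 + k * m) (h2 : ∀ k : ℤ, x ≠ i2 + k * m) :
    subAddAt m n i1 i2 j A x = A x := by
  funext y
  rw [subAddAt, if_neg (fun ⟨k, h, _⟩ => h1 k h), if_neg (fun ⟨k, h, _⟩ => h2 k h)]

theorem shift_iff (x y a b : ℤ) : (∃ k : ℤ, x + m = a + k * m ∧ y + n = b + k * n) ↔
    ∃ k : ℤ, x = a + k * m ∧ y = b + k * n :=
  ⟨fun ⟨k, h, h'⟩ => ⟨k - 1, by linarith, by linarith⟩, fun ⟨k, h, h'⟩ => ⟨k + 1, by linarith, by linarith⟩⟩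

theorem sa_per {i1 i2 : ℤ} (h : ∀ x y : ℤ, A (x + m) (y + n) = A x y) (x y : ℤ) :
    subAddAt m n i1 i2 j A (x + m) (y + n) = subAddAt m n i1 i2 j A x y := by
  simp only [subAddAt, shift_iff, h]

theorem sa_gap {i1 i2 : ℤ} (hn : 0 < n) (h : IsGAP m n A) : IsGAP m n (subAddAt m n i1 i2 j A) := by
  obtain ⟨W, hW⟩ := h.bd hn
  refine gap_of_bd hn (sa_per h.1) (|W| + |i1 * n - j * m| + |i2 * n - j * m|) fun x y hxy => ?_
  have a1 := abs_nonneg W; have a2 := abs_nonneg (i1 * n - j * m); have a3 := abs_nonneg (i2 * n - j * m)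
  have b1 := le_abs_self W; have b2 := le_abs_self (i1 * n - j * m); have b3 := le_abs_self (i2 * n - j * m)
  have c2 := neg_abs_le (i1 * n - j * m); have c3 := neg_abs_le (i2 * n - j * m)
  by_cases h1 : ∃ k : ℤ, x = i1 + k * m ∧ y = j + k * n
  · obtain ⟨k, rfl, rfl⟩ := h1
    constructor <;> linarith
  by_cases h2 : ∃ k : ℤ, x = i2 + k * m ∧ y = j + k * n
  · obtain ⟨k, rfl, rfl⟩ := h2
    constructor <;> linarith
  · rw [subAddAt, if_neg h1, if_neg h2] at hxy
    have := hW x y hxy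
    constructor <;> linarith

theorem per_ext {B C : Mat} (hB : ∀ x y : ℤ, B (x + m) (y + n) = B x y)
    (hC : ∀ x y : ℤ, C (x + m) (y + n) = C x y) (h1 : B i = C i) (h2 : B (i + 1) = C (i + 1))
    (h3 : ∀ x, (∀ k : ℤ, x ≠ i + k * m) → (∀ k : ℤ, x ≠ i + 1 + k * m) → B x = C x) : B = C := by
  have key : ∀ (C : Mat), (∀ x y : ℤ, C (x + m) (y + n) = C x y) → ∀ k x y : ℤ, C (x + k * m) y = C x (y - k * n) := by
    intro C h k x y
    have : ∀ i j : ℤ, C (i + k * m) (j + k * n) = C i j := by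
      intro i j
      induction k using Int.induction_on with
      | zero => simp
      | succ k ih => rw [← ih, ← h (i + k * m) (j + k * n)]; congr 1 <;> ring
      | pred k ih => rw [← ih, ← h (i + (-k - 1) * m) (j + (-k - 1) * n)]; congr 1 <;> ring
    have := this x (y - k * n); rwa [sub_add_cancel] at this
  funext x y
  by_cases c1 : ∃ k : ℤ, x = i + k * m
  · obtain ⟨k, rfl⟩ := c1
    rw [key B hB, key C hC, h1]
  by_cases c2 : ∃ k : ℤ, x = i + 1 + k * m
  · obtain ⟨k, rfl⟩ := c2
    rw [key B hB, key C hC, h2]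
  · rw [h3 x (fun k h => c1 ⟨k, h⟩) fun k h => c2 ⟨k, h⟩]

/-- coupled solutions -/
structure Cpl (m n : ℕ) (i j : ℤ) (l : ℕ) (D : ℤ → ℤ) (A A' : Mat) (N N' : ℤ → ℤ → ℤ) : Prop where
  s : Sol m n A l N
  s' : Sol m n A' l N'
  loc : ∃ N1', Loc (A i) (A (i + 1)) (N (i - 1)) (N i) (N (i + 1)) D j N1' ∧ N' = chRow m n i l N N1'

theorem Sol.rows2 (S : Sol m n A l N) (hA : IsGAP m n A) (hm : 0 < m) (hn : 0 < n) (i : ℤ) :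
    Row (A i) (N (i - 1)) (N i) ∧ Row (A (i + 1)) (N i) (N (i + 1)) := by
  refine ⟨S.row hA hm hn i, ?_⟩
  have := S.row hA hm hn (i + 1)
  rwa [add_sub_cancel_right] at this

theorem FRel.ho (h : FRel m n i j D A A') (x : ℤ) (h1 : ∀ k : ℤ, x ≠ i + k * m)
    (h2 : ∀ k : ℤ, x ≠ i + 1 + k * m) : A' x = A x := by rw [h.eq, sa_o h1 h2]

theorem FRel.gap' (h : FRel m n i j D A A') (hA : IsGAP m n A) (hn : 0 < n) : IsGAP m n A' := by
  rw [h.eq]; exact sa_gap hn hA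

theorem couple1 (h : FRel m n i j D A A') (hA : IsGAP m n A) (hm : 2 ≤ m) (hn : 0 < n)
    (S : Sol m n A l N) : ∃ N', Cpl m n i j l D A A' N N' := by
  obtain ⟨q1, q2⟩ := S.rows2 hA (by omega) hn i
  obtain ⟨N1', L⟩ := local_lemma q1 q2 h.isD h.top
  refine ⟨_, S, sol_chRow S hA hm hn (h.gap' hA hn) (N1 := N1') ?_ ?_ h.ho, _, L, rfl⟩
  · rw [h.eq, sa_i hm]; exact L.r1
  · rw [h.eq, sa_i1 hm]; exact L.r2

theorem couple2 (h : FRel m n i j D A A') (hA : IsGAP m n A) (hm : 2 ≤ m) (hn : 0 < n)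
    (S : Sol m n A' l N') : ∃ N, Cpl m n i j l D A A' N N' := by
  have hA' := h.gap' hA hn
  obtain ⟨q1, q2⟩ := S.rows2 hA' (by omega) hn i
  have hlow : ∀ x, ∃ Y, ∀ y ≤ Y, A x y = 0 := by
    intro x
    obtain ⟨Y, hY⟩ := hA.bdYl (by omega) hn x
    refine ⟨Y - 1, fun y hy => ?_⟩
    by_contra hc
    have := hY x le_rfl y hc
    omega
  obtain ⟨N1, r1⟩ := Row.ex (A i) (N' (i - 1)) (hlow i) (fun y => (q1.r y).2.1)
  have hd : ∀ y, N1 y = N1 (y - 1) ∨ N1 y = N1 (y - 1) + 1 := by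
    intro y
    have a := r1.r y; have b := r1.r (y - 1); omega
  obtain ⟨N2, r2⟩ := Row.ex (A (i + 1)) N1 (hlow (i + 1)) hd
  obtain ⟨N1', L⟩ := local_lemma r1 r2 h.isD h.top
  have e1 := L.r1; have e2 := L.r2
  rw [h.eq, sa_i hm] at q1
  rw [h.eq, sa_i1 hm] at q2
  obtain rfl := e1.uniq q1
  obtain rfl := e2.uniq q2
  have hne : ∀ k : ℤ, i + 1 ≠ i + k * m := fun k hk => ne1 hm i k 0 (by linarith)
  have hne' : ∀ k : ℤ, i - 1 ≠ i + k * m := fun k hk => ne1 hm i 0 k (by linarith)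
  refine ⟨chRow m n i l N' N1, sol_chRow S hA' hm hn hA r1 r2 (fun x h1 h2 => (h.ho x h1 h2).symm), S,
    N' i, ?_, ?_⟩
  · rw [chRow_i hm, chRow_ne _ hne, chRow_ne _ hne']; exact L
  · funext x y
    by_cases c1 : ∃ k : ℤ, x = i + k * m
    · obtain ⟨k, rfl⟩ := c1
      rw [chRow_at hm, S.perk]
    · rw [chRow_ne _ (fun k hk => c1 ⟨k, hk⟩), chRow_ne _ (fun k hk => c1 ⟨k, hk⟩)]

theorem Cpl.eqo (c : Cpl m n i j l D A A' N N') {x : ℤ} (h : ∀ k : ℤ, x ≠ i + k * m) : N' x = N x := by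
  obtain ⟨_, _, rfl⟩ := c.loc
  exact chRow_ne _ h

/-- order is determined by the rows different from `i` -/
theorem sol_le {N2 : ℤ → ℤ → ℤ} (hm : 2 ≤ m) (S : Sol m n A l N) (S2 : Sol m n A l N2)
    (h : ∀ x, (∀ k : ℤ, x ≠ i + k * m) → ∀ y, N x y ≤ N2 x y) (x y : ℤ) : N x y ≤ N2 x y := by
  obtain ⟨a, ha, b, hb, h0, h1⟩ := S.att x y
  have key : N a b ≤ N2 a b := by
    by_cases c : ∃ k : ℤ, a = i + k * m
    · obtain ⟨k, hk⟩ := c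
      have h2 := h (a - 1) (fun k' hk' => ne1 hm i k k' (by linarith)) (b - 1)
      have := S2.cell a b h0; have := S.celleq h0
      omega
    · exact h a (fun k hk => c ⟨k, hk⟩) b
  rw [h1, ← S.celleq h0]
  exact key.trans (S2.mono ha hb)

end


/-! ### One step of the matrix-ball construction -/

def FlatEq (A B : Mat) (N : ℤ → ℤ → ℤ) : Prop :=
  ∀ x y, (B x y : ℤ) + N x y + N (x - 1) (y - 1) = A x y + N (x - 1) y + N x (y - 1)

/-- some entry in row `x` has height at least `k` -/
def Rg (N : ℤ → ℤ → ℤ) (k x : ℤ) : Prop := ∃ y, k ≤ N x y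

def HasR (N : ℤ → ℤ → ℤ) (x : ℤ) : Prop := ∃ k, Rg N k x ∧ ¬ Rg N k (x - 1)

def Lim (D : ℤ → ℤ) (E : ℤ) : Prop := ∃ Y, ∀ y ≥ Y, D y = E

theorem Lim.uniq {D : ℤ → ℤ} {E E' : ℤ} (h : Lim D E) (h' : Lim D E') : E = E' := by
  obtain ⟨Y, hY⟩ := h
  obtain ⟨Y', hY'⟩ := h'
  rw [← hY (max Y Y') (le_max_left _ _), hY' (max Y Y') (le_max_right _ _)]

section
variable {m n : ℕ} {A A' B B' : Mat} {l : ℕ} {N N' : ℤ → ℤ → ℤ} {i j : ℤ} {D : ℤ → ℤ}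

theorem FlatEq.trans (h : FlatEq A B N) : FlatEq (transM A) (transM B) (fun x y => N y x) := by
  intro x y; have := h y x; simp only [transM]; omega

theorem flat_per (hA : IsGAP m n A) (S : Sol m n A l N) (f : FlatEq A B N) (x y : ℤ) :
    B (x + m) (y + n) = B x y := by
  have h1 := f (x + m) (y + n); have h2 := f x y
  have e1 : x + m - 1 = x - 1 + m := by ring
  have e2 : y + n - 1 = y - 1 + n := by ring
  rw [e1, e2, S.per, S.per, S.per, S.per, hA.1] at h1
  omega

theorem Sol.far (S : Sol m n A l N) {W : ℤ} (hn : 0 < n)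
    (hW : ∀ x y, A x y ≠ 0 → -W ≤ x * n - y * m ∧ x * n - y * m ≤ W) {x y : ℤ} (h : W < x * n - y * m) :
    N x y = N (x - 1) y := by
  obtain ⟨a, ha, b, hb, h0, h1⟩ := S.att x y
  have h2 := S.monx x y
  rw [← S.celleq h0] at h1
  have h3 := (hW a b h0).2
  have hn' : (0 : ℤ) < n := by exact_mod_cast hn
  have hm' : (0 : ℤ) ≤ m := by positivity
  have : a ≤ x - 1 := by by_contra hc; nlinarith
  have := S.mono this hb
  omega

theorem flat_gap (hA : IsGAP m n A) (S : Sol m n A l N) (f : FlatEq A B N) (hm : 0 < m) (hn : 0 < n) :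
    IsGAP m n B := by
  obtain ⟨W, hW⟩ := hA.bd hn
  refine gap_of_bd hn (flat_per hA S f) W fun x y h => ?_
  have hn' : (0 : ℤ) < n := by exact_mod_cast hn
  have hm' : (0 : ℤ) < m := by exact_mod_cast hm
  have h2 := f x y
  by_contra hc
  have hA0 : A x y = 0 := by by_contra h0; exact hc (hW x y h0)
  rw [not_and_or, not_le, not_le] at hc
  have hW' : ∀ x y, transM A x y ≠ 0 → -W ≤ x * m - y * n ∧ x * m - y * n ≤ W := fun x y h => by
    have := hW y x h; constructor <;> linarith
  rcases hc with hc | hc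
  · have h3 := S.trans.far hm hW' (x := y) (y := x) (by linarith)
    have h4 := S.trans.far hm hW' (x := y) (y := x - 1) (by linarith)
    omega
  · have h3 := S.far hn hW (x := x) (y := y) (by linarith)
    have h4 := S.far hn hW (x := x) (y := y - 1) (by linarith)
    omega

/-- the height function after flattening -/
def flD (i : ℤ) (N : ℤ → ℤ → ℤ) (D : ℤ → ℤ) : ℤ → ℤ :=
  fun y => D y + (N i (y - 1) - N (i - 1) (y - 1)) - (N (i + 1) y - N i y)

theorem Sol.evc (S : Sol m n A l N) (hA : IsGAP m n A) (hm : 0 < m) (hn : 0 < n) (x : ℤ) :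
    ∃ K, Lim (N x) K ∧ ∀ k, Rg N k x ↔ k ≤ K := by
  obtain ⟨Y, hY⟩ := S.bdY hA hm hn x
  exact ⟨N x Y, ⟨Y, fun y hy => le_antisymm (hY y) (S.mono le_rfl hy)⟩, fun k =>
    ⟨fun ⟨y, hy⟩ => hy.trans (hY y), fun h => ⟨Y, h⟩⟩⟩

theorem Sol.dif (S : Sol m n A l N) (hA : IsGAP m n A) (hm : 0 < m) (hn : 0 < n) (x : ℤ) :
    Lim (fun y => N x y - N (x - 1) y) (if HasR N x then 1 else 0) := by
  obtain ⟨K, ⟨Y, hY⟩, h2⟩ := S.evc hA hm hn x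
  obtain ⟨K', ⟨Y', hY'⟩, h2'⟩ := S.evc hA hm hn (x - 1)
  refine ⟨max Y Y', fun y hy => ?_⟩
  have h3 := hY y (by omega); have h4 := hY' y (by omega)
  have h5 := ((S.row hA hm hn x).r y).1
  show N x y - N (x - 1) y = _
  split_ifs with h
  · obtain ⟨k, hk, hk'⟩ := h
    rw [h2] at hk; rw [h2'] at hk'
    omega
  · by_contra hc
    exact h ⟨K, (h2 K).2 le_rfl, fun h => by have := (h2' K).1 h; omega⟩

theorem lim_flat (S : Sol m n A l N) (hA : IsGAP m n A) (hm : 0 < m) (hn : 0 < n) {E : ℤ} (h : Lim D E) :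
    Lim (flD i N D) (E + (if HasR N i then 1 else 0) - (if HasR N (i + 1) then 1 else 0)) := by
  obtain ⟨Y, hY⟩ := h
  obtain ⟨Y1, h1⟩ := S.dif hA hm hn i
  obtain ⟨Y2, h2⟩ := S.dif hA hm hn (i + 1)
  refine ⟨max Y (max Y1 Y2) + 1, fun y hy => ?_⟩
  have a1 := hY y (by omega); have a2 := h1 (y - 1) (by omega); have a3 := h2 y (by omega)
  simp only [add_sub_cancel_right] at a2 a3
  simp only [flD]; rw [a1, a2, a3]

theorem flD_isD (S : Sol m n A l N) (hA : IsGAP m n A) (hm : 0 < m) (hn : 0 < n)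
    (hD : IsD (A i) (A (i + 1)) D) (f : FlatEq A B N) : IsD (B i) (B (i + 1)) (flD i N D) := by
  obtain ⟨q1, q2⟩ := S.rows2 hA hm hn i
  exact isD_flat q1 q2 hD (f i) (fun y => by have := f (i + 1) y; rwa [add_sub_cancel_right] at this)

theorem flD_le (S : Sol m n A l N) (hA : IsGAP m n A) (hm : 0 < m) (hn : 0 < n)
    (hD : IsD (A i) (A (i + 1)) D) {T : ℤ} (hT : ∀ y, D y ≤ T) (y : ℤ) : flD i N D y ≤ T := by
  obtain ⟨q1, q2⟩ := S.rows2 hA hm hn i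
  exact flat_le q1 q2 hD hT y

theorem Sol.rgper (S : Sol m n A l N) (q k x : ℤ) : Rg N k (x + q * m) ↔ Rg N (k - q * l) x := by
  constructor
  · rintro ⟨y, hy⟩
    rw [S.perk] at hy
    exact ⟨_, by linarith⟩
  · rintro ⟨y, hy⟩
    refine ⟨y + q * n, ?_⟩
    rw [S.perk, add_sub_cancel_right]
    linarith

/-- columns do not see the operator -/
theorem Cpl.colg (c : Cpl m n i j l D A A' N N') (hm : 2 ≤ m) (k y : ℤ) :
    (∃ x, k ≤ N' x y) ↔ ∃ x, k ≤ N x y := by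
  constructor
  all_goals
    rintro ⟨x, hx⟩
    by_cases h : ∃ q : ℤ, x = i + q * m
    · obtain ⟨q, rfl⟩ := h
      refine ⟨i + q * m + 1, hx.trans ?_⟩
      have e : ∀ k : ℤ, i + q * m + 1 ≠ i + k * m := fun k hk => ne1 hm i k q (by linarith)
      have a1 := c.s.monx (i + q * m + 1) y
      have a2 := c.s'.monx (i + q * m + 1) y
      have a3 := congrFun (c.eqo e) y
      rw [add_sub_cancel_right] at a1 a2
      omega
    · refine ⟨x, hx.trans (le_of_eq ?_)⟩
      rw [c.eqo fun k hk => h ⟨k, hk⟩]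

theorem one_step (h : FRel m n i j D A A') (hA : IsGAP m n A) (hm : 2 ≤ m) (hn : 0 < n)
    (c : Cpl m n i j l D A A' N N') (f : FlatEq A B N) (f' : FlatEq A' B' N') :
    (∃ u, FRel m n i u (flD i N D) B B' ∧ flD i N D u = D j ∧ ∀ k x, Rg N' k x ↔ Rg N k x) ∨
    (B' = B ∧ Lim (flD i N D) (D j) ∧ ∃ K, Rg N K i ∧ ¬ Rg N K (i - 1) ∧
      (∀ k, Rg N k (i + 1) → Rg N k i) ∧
      ∀ k x, Rg N' k x ↔ Rg N k x ∧ ¬ ∃ q : ℤ, x = i + q * m ∧ k = K + q * l) := by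
  have hA' := h.gap' hA hn
  have hm0 : 0 < m := by omega
  have hD := flD_isD c.s hA hm0 hn h.isD f
  have ⟨N1, L, e⟩ := c.loc
  have pB := flat_per hA c.s f
  have pB' := flat_per hA' c.s' f'
  have eqo := fun {x} h => c.eqo (x := x) h
  have n1 : ∀ k : ℤ, i + 1 ≠ i + k * m := fun k hk => ne1 hm i k 0 (by linarith)
  have n2 : ∀ k : ℤ, i - 1 ≠ i + k * m := fun k hk => ne1 hm i 0 k (by linarith)
  have ei : N' i = N1 := by rw [e, chRow_i hm]
  have g1 : ∀ y, (B' i y : ℤ) + N1 y + N (i - 1) (y - 1) =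
      (if y = j then A i y - 1 else A i y : ℕ) + N (i - 1) y + N1 (y - 1) := by
    intro y; have := f' i y
    rw [ei, eqo n2, h.eq, sa_i hm] at this; exact this
  have g2 : ∀ y, (B' (i + 1) y : ℤ) + N (i + 1) y + N1 (y - 1) =
      (if y = j then A (i + 1) y + 1 else A (i + 1) y : ℕ) + N1 y + N (i + 1) (y - 1) := by
    intro y; have := f' (i + 1) y
    rw [add_sub_cancel_right, ei, eqo n1, h.eq, sa_i1 hm] at this; exact this
  have g3 : ∀ y, (B (i + 1) y : ℤ) + N (i + 1) y + N i (y - 1) =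
      A (i + 1) y + N i y + N (i + 1) (y - 1) := by
    intro y; have := f (i + 1) y; rwa [add_sub_cancel_right] at this
  have go : ∀ x, (∀ k : ℤ, x ≠ i + k * m) → (∀ k : ℤ, x ≠ i + 1 + k * m) → B' x = B x := by
    intro x h1 h2
    funext y
    have a1 := f x y; have a2 := f' x y
    rw [eqo h1, eqo (x := x - 1) (fun k hk => h2 k (by linarith)), h.ho x h1 h2] at a2
    omega
  have hX : A i j ≠ 0 := by
    have h1 := h.top.1 (j + 1) (by omega); have h2 := h.isD.1 (j + 1)
    simp only [add_sub_cancel_right] at h2; omega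
  have hX' : ∀ y, y = j → A i y ≠ 0 := by rintro y rfl; exact hX
  rcases L.alt with ⟨u, hju, hu, hF, hM⟩ | ⟨hI, hI2⟩
  · left
    refine ⟨u, ⟨hD, hF, ?_⟩, hM, ?_⟩
    · apply per_ext (i := i) pB' (sa_per pB)
      · rw [sa_i hm]; funext y
        have a1 := g1 y; have a2 := f i y; have a3 := hX' y
        rw [hu y, hu (y - 1)] at a1
        split_ifs at a1 ⊢ <;> omega
      · rw [sa_i1 hm]; funext y
        have a1 := g2 y; have a2 := g3 y
        rw [hu y, hu (y - 1)] at a1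
        split_ifs at a1 ⊢ <;> omega
      · intro x h1 h2
        rw [sa_o h1 h2, go x h1 h2]
    · intro k x
      by_cases hx : ∃ q : ℤ, x = i + q * m
      · obtain ⟨q, rfl⟩ := hx
        rw [c.s.rgper, c.s'.rgper]
        constructor
        · rintro ⟨y, hy⟩
          refine ⟨y, hy.trans ?_⟩
          rw [ei, hu]; split_ifs <;> omega
        · rintro ⟨y, hy⟩
          refine ⟨max y u, hy.trans ?_⟩
          rw [ei, hu, if_neg (by omega)]
          exact c.s.mono le_rfl (le_max_left _ _)
      · simp only [Rg, c.eqo fun k hk => hx ⟨k, hk⟩]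
  · right
    have hc : ∀ y, j ≤ y → N i y = N i j := by
      refine int_up rfl fun y hy ih => ?_
      have a1 := hI2 y hy.le; have a2 := hI2 (y - 1) (by omega)
      omega
    have hle : ∀ y, N i y ≤ N i j := fun y => by
      rw [← hc (max y j) (le_max_right _ _)]; exact c.s.mono le_rfl (le_max_left _ _)
    refine ⟨?_, ⟨j, fun y hy => (hI2 y hy).2.2.2.2⟩, N i j, ⟨j, le_rfl⟩, ?_, ?_, ?_⟩
    · apply per_ext (i := i) pB' pB
      · funext y
        have a1 := g1 y; have a2 := f i y; have a3 := hX' y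
        rw [hI y, hI (y - 1)] at a1
        split_ifs at a1 <;> omega
      · funext y
        have a1 := g2 y; have a2 := g3 y
        rw [hI y, hI (y - 1)] at a1
        split_ifs at a1 <;> omega
      · exact go
    · rintro ⟨y, hy⟩
      have a1 := (hI2 (max y j) (le_max_right _ _)).1
      have a2 := hc (max y j) (le_max_right _ _)
      have a3 := c.s.mono (x := i - 1) le_rfl (le_max_left y j)
      omega
    · rintro k ⟨y, hy⟩
      refine ⟨max y j, ?_⟩
      have a1 := (hI2 (max y j) (le_max_right _ _)).2.1
      have a3 := c.s.mono (x := i + 1) le_rfl (le_max_left y j)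
      omega
    · intro k x
      by_cases hx : ∃ q : ℤ, x = i + q * m
      · obtain ⟨q, rfl⟩ := hx
        have e2 : (∃ q' : ℤ, i + q * m = i + q' * m ∧ k = N i j + q' * l) ↔ k = N i j + q * l :=
          ⟨fun ⟨q', h1, h2⟩ => by rw [keq hm h1]; exact h2, fun h => ⟨q, rfl, h⟩⟩
        rw [c.s.rgper, c.s'.rgper, e2]
        constructor
        · rintro ⟨y, hy⟩
          rw [ei, hI] at hy
          have a0 := hle y
          split_ifs at hy with h1
          · exact ⟨⟨y, by omega⟩, fun h => by omega⟩
          · refine ⟨⟨y, hy⟩, fun h => ?_⟩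
            have a1 := (hI2 j le_rfl).2.2.2.1
            have a2 := c.s.mono (x := i) le_rfl (show y ≤ j - 1 by omega)
            omega
        · rintro ⟨⟨y, hy⟩, h2⟩
          refine ⟨j, ?_⟩
          rw [ei, hI, if_pos le_rfl]
          have a0 := hle y
          omega
      · have : ¬ ∃ q : ℤ, x = i + q * m ∧ k = N i j + q * l := fun ⟨q, h, _⟩ => hx ⟨q, h⟩
        simp only [Rg, c.eqo fun k hk => hx ⟨k, hk⟩, this, not_false_eq_true, and_true]

end


/-! ### Southwest channels -/

def tauZ (m n : ℕ) (q : ℤ) (c : Cell) : Cell := (c.1 + q * m, c.2 + q * n)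

section
variable {m n : ℕ} {A : Mat} {l : ℕ} {N N2 : ℤ → ℤ → ℤ}

theorem incr_seq {f : ℤ → ℤ} (h : ∀ i, f i + 1 ≤ f (i + 1)) {a b : ℤ} (hab : a ≤ b) :
    f a + (b - a) ≤ f b := by
  refine int_up (P := fun b => f a + (b - a) ≤ f b) (by simp) (fun y hy ih => ?_) b hab
  have := h (y - 1); rw [sub_add_cancel] at this
  linarith

theorem incr_eq {f : ℤ → ℤ} (h : ∀ i, f i + 1 ≤ f (i + 1)) {l : ℕ} (hl : 0 < l)
    (hp : ∀ i, f (i + l) = f i + l) (i : ℤ) : f i = f 0 + i := by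
  have h1 : ∀ i, f (i + 1) = f i + 1 := by
    intro i
    have a := incr_seq h (show i + 1 ≤ i + l by omega); have b := h i; have c := hp i
    omega
  induction i using Int.induction_on with
  | zero => simp
  | succ k ih => rw [h1, ih]; ring
  | pred k ih => have := h1 (-k - 1); rw [sub_add_cancel] at this; linarith

theorem IsStreamEnum.tq {e : ℤ → Cell} (h : IsStreamEnum m n e l) (q i : ℤ) :
    e (i + q * l) = tauZ m n q (e i) := by
  induction q using Int.induction_on with
  | zero => simp [tauZ]
  | succ k ih =>
    have : i + (k + 1) * l = i + k * l + l := by ring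
    rw [this, ← h.2.2, ih]; ext <;> simp [tauC, tauZ] <;> ring
  | pred k ih =>
    have a := h.2.2 (i + (-k - 1) * l)
    have : i + (-k - 1) * l + l = i + (-k) * l := by ring
    rw [this, ih] at a
    have a1 := congrArg Prod.fst a; have a2 := congrArg Prod.snd a
    simp only [tauC, tauZ] at a1 a2 ⊢
    ext <;> simp only <;> linarith

theorem NW_trans {a b c : Cell} (h : NW a b) (h' : NW b c) : NW a c :=
  ⟨h.1.trans h'.1, h.2.trans h'.2⟩

theorem IsStreamEnum.lt {e : ℤ → Cell} (h : IsStreamEnum m n e l) {i k : ℤ} (hik : i < k) :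
    NW (e i) (e k) := by
  refine int_up (a := i + 1) (P := fun b => NW (e i) (e b)) (h.2.1 i) (fun y hy ih => ?_) k (by omega)
  have := h.2.1 (y - 1); rw [sub_add_cancel] at this
  exact NW_trans ih this

theorem IsGAP.supp_tau (hA : IsGAP m n A) (q : ℤ) {c : Cell} : tauZ m n q c ∈ supp A ↔ c ∈ supp A := by
  simp only [supp, tauZ, Set.mem_ofPred_eq, hA.perq]

theorem Sol.L_tau (S : Sol m n A l N) (q : ℤ) (c : Cell) :
    N (tauZ m n q c).1 (tauZ m n q c).2 = N c.1 c.2 + q * l := S.perq q c.1 c.2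

theorem Sol.nw (S : Sol m n A l N) {c c' : Cell} (h' : c' ∈ supp A) (h : NW c c') :
    N c.1 c.2 + 1 ≤ N c'.1 c'.2 := by
  have h1 := S.cell c'.1 c'.2 h'
  have h2 := S.mono (show c.1 ≤ c'.1 - 1 by have := h.1; omega) (show c.2 ≤ c'.2 - 1 by have := h.2; omega)
  omega

theorem Sol.same (S : Sol m n A l N) {c c' : Cell} (h : c ∈ supp A) (h' : c' ∈ supp A)
    (e : N c.1 c.2 = N c'.1 c'.2) : neLe c c' ∨ neLe c' c := by
  have h1 := fun hh => S.nw h' (c := c) hh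
  have h2 := fun hh => S.nw h (c := c') hh
  simp only [NW, neLe] at *; omega

theorem neLe_anti {c c' : Cell} (h : neLe c c') (h' : neLe c' c) : c = c' := by
  simp only [neLe] at *; ext <;> omega

theorem Sol.stream (S : Sol m n A l N) {e : ℤ → Cell} (h : IsStreamEnum m n e l) (he : ∀ i, e i ∈ supp A)
    (i : ℤ) : N (e i).1 (e i).2 = N (e 0).1 (e 0).2 + i := by
  refine incr_eq (f := fun i => N (e i).1 (e i).2) (fun i => S.nw (he _) (h.2.1 i)) h.1 (fun i => ?_) i
  rw [← h.2.2]; exact S.per _ _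

theorem flow_le {f : ℤ → ℤ} (h : ∀ i, f i + 1 ≤ f (i + 1)) {l l' : ℕ}
    (hp : f (0 + l') = f 0 + l) : l' ≤ l := by
  have := incr_seq h (show (0 : ℤ) ≤ 0 + l' by omega); omega

theorem Sol.stream_le (S : Sol m n A l N) {e : ℤ → Cell} {l' : ℕ} (h : IsStreamEnum m n e l')
    (he : ∀ i, e i ∈ supp A) : l' ≤ l := by
  refine flow_le (f := fun i => N (e i).1 (e i).2) (fun i => S.nw (he _) (h.2.1 i)) ?_
  rw [← h.2.2]; exact S.per _ _

theorem Sol.fin (S : Sol m n A l N) (hA : IsGAP m n A) (hn : 0 < n) (k : ℤ) :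
    {c : Cell | c ∈ supp A ∧ N c.1 c.2 = k}.Finite := by
  have hf : (⋃ j ∈ Finset.Ico (0 : ℤ) n, {c : Cell | A c.1 c.2 ≠ 0 ∧ c.2 = j}).Finite := by
    refine Set.Finite.biUnion (Finset.finite_toSet _) fun j _ => ?_
    refine ((hA.2 j).image fun i => (i, j)).subset ?_
    rintro ⟨a, b⟩ ⟨h1, rfl⟩
    exact ⟨a, h1, rfl⟩
  refine (hf.image fun c => tauZ m n ((k - N c.1 c.2) / l) c).subset ?_
  rintro c ⟨hc, hk⟩
  have hn' : (0 : ℤ) < n := by exact_mod_cast hn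
  have hl : (l : ℤ) ≠ 0 := by exact_mod_cast S.lpos.ne'
  refine ⟨tauZ m n (-(c.2 / n)) c, ?_, ?_⟩
  · simp only [Set.mem_iUnion]
    refine ⟨_, ?_, (hA.supp_tau _).2 hc, rfl⟩
    have h1 := Int.emod_nonneg c.2 hn'.ne'; have h2 := Int.emod_lt_of_pos c.2 hn'
    have h3 := Int.emod_add_mul_ediv c.2 n
    simp only [tauZ, Finset.mem_Ico]; constructor <;> linarith
  · have : k - N (tauZ m n (-(c.2 / n)) c).1 (tauZ m n (-(c.2 / n)) c).2 = c.2 / n * l := by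
      rw [S.L_tau, hk]; ring
    simp only [this, Int.mul_ediv_cancel _ hl]
    simp [tauZ]

/-- cells having an infinite chain of consecutive levels to the southeast -/
def Ext (A : Mat) (N : ℤ → ℤ → ℤ) (c : Cell) : Prop :=
  ∃ S : Set Cell, c ∈ S ∧ ∀ c ∈ S, c ∈ supp A ∧ ∃ c' ∈ S, NW c c' ∧ N c'.1 c'.2 = N c.1 c.2 + 1

theorem Ext.mem {c : Cell} (h : Ext A N c) : c ∈ supp A := let ⟨_, h1, h2⟩ := h; (h2 c h1).1

theorem Ext.succ {c : Cell} (h : Ext A N c) : ∃ c', Ext A N c' ∧ NW c c' ∧ N c'.1 c'.2 = N c.1 c.2 + 1 :=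
  let ⟨S, h1, h2⟩ := h; let ⟨c', h3, h4⟩ := (h2 c h1).2; ⟨c', ⟨S, h3, h2⟩, h4⟩

theorem Ext.pred {c c' : Cell} (h : Ext A N c) (hc : c' ∈ supp A) (h1 : NW c' c)
    (h2 : N c.1 c.2 = N c'.1 c'.2 + 1) : Ext A N c' := by
  refine ⟨{c | Ext A N c} ∪ {c'}, Or.inr rfl, ?_⟩
  rintro d (hd | rfl)
  · obtain ⟨d', hd', h⟩ := hd.succ
    exact ⟨hd.mem, d', Or.inl hd', h⟩
  · exact ⟨hc, c, Or.inl h, h1, h2⟩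

theorem Ext.tau (S : Sol m n A l N) (hA : IsGAP m n A) (q : ℤ) {c : Cell} (h : Ext A N c) :
    Ext A N (tauZ m n q c) := by
  refine ⟨tauZ m n q '' {c | Ext A N c}, ⟨c, h, rfl⟩, ?_⟩
  rintro _ ⟨d, hd, rfl⟩
  obtain ⟨d', hd', h1, h2⟩ := hd.succ
  refine ⟨(hA.supp_tau q).2 hd.mem, _, ⟨d', hd', rfl⟩, ?_, ?_⟩
  · exact ⟨by have := h1.1; simp only [tauZ]; omega, by have := h1.2; simp only [tauZ]; omega⟩
  · rw [S.L_tau, S.L_tau, h2]; ring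

theorem Sol.pred (S : Sol m n A l N) {c : Cell} (h : c ∈ supp A) :
    ∃ c' ∈ supp A, NW c' c ∧ N c'.1 c'.2 = N c.1 c.2 - 1 := by
  obtain ⟨a, ha, b, hb, h0, h1⟩ := S.att (c.1 - 1) (c.2 - 1)
  refine ⟨(a, b), h0, ⟨by show a < c.1; omega, by show b < c.2; omega⟩, ?_⟩
  have := S.celleq h; have := S.celleq h0
  simp only; omega

theorem Sol.ext_desc (S : Sol m n A l N) (hA : IsGAP m n A) (hn : 0 < n) {c : ℕ → Cell}
    (hc : ∀ r, c r ∈ supp A) (h1 : ∀ r, NW (c (r + 1)) (c r))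
    (h2 : ∀ r, N (c (r + 1)).1 (c (r + 1)).2 = N (c r).1 (c r).2 - 1) : ∃ r, Ext A N (c r) := by
  have hL : ∀ r : ℕ, N (c r).1 (c r).2 = N (c 0).1 (c 0).2 - r := by
    intro r
    induction r with
    | zero => simp
    | succ k ih => rw [h2, ih]; push_cast; ring
  have key : ∃ r r' : ℕ, r < r' ∧ tauZ m n r (c (r * l)) = tauZ m n r' (c (r' * l)) := by
    by_contra hcon
    push Not at hcon
    have hinj : Function.Injective fun r : ℕ => tauZ m n r (c (r * l)) := by
      intro r r' h
      rcases lt_trichotomy r r' with h' | h' | h'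
      · exact absurd h (hcon _ _ h')
      · exact h'
      · exact absurd h.symm (hcon _ _ h')
    refine Set.infinite_range_of_injective hinj ((S.fin hA hn (N (c 0).1 (c 0).2)).subset ?_)
    rintro _ ⟨r, rfl⟩
    refine ⟨(hA.supp_tau _).2 (hc _), ?_⟩
    rw [S.L_tau, hL (r * l)]; push_cast; ring
  obtain ⟨r, r', hr, he⟩ := key
  have hlt : r * l < r' * l := Nat.mul_lt_mul_of_pos_right hr S.lpos
  have he' : tauZ m n (r' - r) (c (r' * l)) = c (r * l) := by
    have a1 := congrArg Prod.fst he; have a2 := congrArg Prod.snd he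
    simp only [tauZ] at a1 a2 ⊢
    ext <;> simp only <;> linarith
  refine ⟨r' * l, {d | ∃ (q : ℤ) (t : ℕ), r * l < t ∧ t ≤ r' * l ∧ d = tauZ m n q (c t)},
    ⟨0, r' * l, hlt, le_rfl, by simp [tauZ]⟩, ?_⟩
  rintro _ ⟨q, t, ht, ht', rfl⟩
  refine ⟨(hA.supp_tau _).2 (hc _), tauZ m n q (c (t - 1)), ?_, ?_, ?_⟩
  · by_cases h : r * l < t - 1
    · exact ⟨q, t - 1, h, by omega, rfl⟩
    · refine ⟨q + (r' - r), r' * l, hlt, le_rfl, ?_⟩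
      rw [show t - 1 = r * l by omega, ← he']
      ext <;> simp only [tauZ] <;> ring
  · have := h1 (t - 1); rw [Nat.sub_add_cancel (by omega)] at this
    exact ⟨by have := this.1; simp only [tauZ]; omega, by have := this.2; simp only [tauZ]; omega⟩
  · rw [S.L_tau, S.L_tau, hL (t - 1), hL t, Nat.cast_sub (by omega)]; push_cast; ring

theorem least_of (T : Set Cell) (hf : T.Finite) (hne : T.Nonempty)
    (tot : ∀ c ∈ T, ∀ c' ∈ T, neLe c c' ∨ neLe c' c) : ∃ c ∈ T, ∀ c' ∈ T, neLe c c' := by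
  obtain ⟨c, hc, h⟩ := Set.exists_min_image T (fun c => c.2 - c.1) hf hne
  refine ⟨c, hc, fun c' hc' => ?_⟩
  have h1 := h c' hc'
  have := tot c hc c' hc'
  simp only [neLe] at *; omega

/-- levels without a cell cannot occur -/
theorem Sol.lev (S : Sol m n A l N) (k x y : ℤ) (h : k ≤ N x y) :
    ∃ c ∈ supp A, c.1 ≤ x ∧ c.2 ≤ y ∧ N c.1 c.2 = k := by
  obtain ⟨a, ha, b, hb, h0, h1⟩ := S.att x y
  have h1 : N a b = N x y := by have := S.celleq h0; omega
  have : ∀ j, ∀ r : ℕ, k + r = j → ∀ c ∈ supp A, c.1 ≤ x → c.2 ≤ y → N c.1 c.2 = j →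
      ∃ c ∈ supp A, c.1 ≤ x ∧ c.2 ≤ y ∧ N c.1 c.2 = k := by
    intro j r
    induction r generalizing j with
    | zero => intro h c hc hx hy he; exact ⟨c, hc, hx, hy, by simp at h; omega⟩
    | succ r ih =>
      intro h c hc hx hy he
      obtain ⟨c', hc', hnw, he'⟩ := S.pred hc
      refine ih (j - 1) (by push_cast at h; omega) c' hc' ?_ ?_ (by omega)
      · have := hnw.1; omega
      · have := hnw.2; omega
  exact this (N x y) (N x y - k).toNat (by omega) (a, b) h0 ha hb h1

/-- The canonical (southwest) channel of a solution. -/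
structure Canon (m n : ℕ) (A : Mat) (l : ℕ) (N : ℤ → ℤ → ℤ) (e : ℤ → Cell) : Prop where
  ext : ∀ k, Ext A N (e k)
  lev : ∀ k, N (e k).1 (e k).2 = k
  least : ∀ c, Ext A N c → neLe (e (N c.1 c.2)) c
  str : IsStreamEnum m n e l

theorem Sol.canon (S : Sol m n A l N) (hA : IsGAP m n A) (hn : 0 < n) : ∃ e, Canon m n A l N e := by
  have h0 : ∃ c, Ext A N c := by
    obtain ⟨a, ha, b, hb, h0, h1⟩ := S.att 0 0
    choose! p hp using fun c (h : c ∈ supp A) => S.pred h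
    have hs : ∀ r : ℕ, p^[r] (a, b) ∈ supp A := by
      intro r
      induction r with
      | zero => exact h0
      | succ k ih => rw [Function.iterate_succ_apply']; exact (hp _ ih).1
    obtain ⟨r, hr⟩ := S.ext_desc hA hn hs
      (fun r => by rw [Function.iterate_succ_apply']; exact (hp _ (hs r)).2.1)
      (fun r => by rw [Function.iterate_succ_apply']; exact (hp _ (hs r)).2.2)
    exact ⟨_, hr⟩
  obtain ⟨c0, hc0⟩ := h0
  have hpred : ∀ c, Ext A N c → ∃ c', Ext A N c' ∧ NW c' c ∧ N c'.1 c'.2 = N c.1 c.2 - 1 := fun c hc =>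
    let ⟨c', h1, h2, h3⟩ := S.pred hc.mem; ⟨c', hc.pred h1 h2 (by omega), h2, h3⟩
  have hall : ∀ k, ∃ c, Ext A N c ∧ N c.1 c.2 = N c0.1 c0.2 + k := by
    intro k
    induction k using Int.induction_on with
    | zero => exact ⟨c0, hc0, by simp⟩
    | succ k ih => obtain ⟨c, hc, h⟩ := ih; obtain ⟨c', hc', _, h'⟩ := hc.succ; exact ⟨c', hc', by omega⟩
    | pred k ih => obtain ⟨c, hc, h⟩ := ih; obtain ⟨c', hc', _, h'⟩ := hpred c hc; exact ⟨c', hc', by omega⟩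
  have hl : ∀ k, ∃ c ∈ {c | Ext A N c ∧ N c.1 c.2 = k}, ∀ c' ∈ {c | Ext A N c ∧ N c.1 c.2 = k}, neLe c c' := by
    intro k
    refine least_of _ ((S.fin hA hn k).subset fun c hc => ⟨hc.1.mem, hc.2⟩) ?_ ?_
    · obtain ⟨c, hc, h⟩ := hall (k - N c0.1 c0.2); exact ⟨c, hc, by omega⟩
    · exact fun c hc c' hc' => S.same hc.1.mem hc'.1.mem (hc.2.trans hc'.2.symm)
  choose e he hle using hl
  refine ⟨e, fun k => (he k).1, fun k => (he k).2, fun c hc => hle _ c ⟨hc, rfl⟩, S.lpos, fun k => ?_, fun k => ?_⟩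
  · obtain ⟨c1, h1, h2, h3⟩ := (he k).1.succ
    obtain ⟨c2, g1, g2, g3⟩ := hpred _ (he (k + 1)).1
    have a1 := hle (k + 1) c1 ⟨h1, by rw [h3, (he k).2]⟩
    have a2 := hle k c2 ⟨g1, by rw [g3, (he (k + 1)).2]; ring⟩
    simp only [neLe, NW] at *; omega
  · have e1 : tauC m n (e k) = tauZ m n 1 (e k) := by simp [tauC, tauZ]
    rw [e1]
    refine neLe_anti ?_ (hle _ _ ⟨(he k).1.tau S hA 1, by rw [S.L_tau, (he k).2]; ring⟩)
    have := hle k (tauZ m n (-1) (e (k + l))) ⟨(he (k + l)).1.tau S hA _, by rw [S.L_tau, (he _).2]; ring⟩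
    simp only [neLe, tauZ] at *; omega

/-- consecutive chain from `c` to `e (k - r)` -/
theorem Canon.rigid {e : ℤ → Cell} (C : Canon m n A l N e) (S : Sol m n A l N) (hA : IsGAP m n A) (hn : 0 < n)
    {c : Cell} (hc : c ∈ supp A) (h : neLe c (e (N c.1 c.2))) : N c.1 c.2 ∈ chainSet A e c := by
  by_contra hcon
  let G : Cell → Prop := fun c => c ∈ supp A ∧ neLe c (e (N c.1 c.2)) ∧ N c.1 c.2 ∉ chainSet A e c
  have chS : ∀ c c', c ∈ supp A → NW c' c → N c'.1 c'.2 = N c.1 c.2 - 1 → N c'.1 c'.2 ∈ chainSet A e c' →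
      N c.1 c.2 ∈ chainSet A e c := by
    rintro c c' hc h1 h2 ⟨k, ch, e1, e2, e3, idx, e4, e5⟩
    refine ⟨k + 1, fun r => Nat.casesOn r c ch, rfl, ?_, ?_, idx, e4, by push_cast; omega⟩
    · rintro (_ | r) hr
      · exact hc
      · exact e2 r (by omega)
    · rintro (_ | r) hr
      · show NW (ch 0) c; rw [e1]; exact h1
      · exact e3 r (by omega)
  have selfe : ∀ k, N (e k).1 (e k).2 ∈ chainSet A e (e k) := fun k =>
    ⟨0, fun _ => e k, rfl, fun _ _ => (C.ext k).mem, fun _ h => absurd h (by omega), k, rfl, by rw [C.lev]; simp⟩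
  have step : ∀ c, G c → ∃ c', G c' ∧ NW c' c ∧ N c'.1 c'.2 = N c.1 c.2 - 1 := by
    rintro c ⟨hc, h1, h2⟩
    obtain ⟨p, hp, g1, g2⟩ := S.pred hc
    refine ⟨p, ⟨hp, ?_, fun h => h2 (chS c p hc g1 g2 h)⟩, g1, g2⟩
    rcases S.same hp (C.ext (N p.1 p.2)).mem (by rw [C.lev]) with h | h
    · exact h
    · exfalso
      refine h2 (chS c _ hc ?_ (by rw [C.lev]; exact g2) (selfe (N p.1 p.2)))
      have := C.str.2.1 (N p.1 p.2)
      rw [g2, sub_add_cancel, ← g2] at this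
      simp only [neLe, NW] at *; omega
  choose! p hp using step
  have hs : ∀ r : ℕ, G (p^[r] c) := by
    intro r
    induction r with
    | zero => exact ⟨hc, h, hcon⟩
    | succ k ih => rw [Function.iterate_succ_apply']; exact (hp _ ih).1
  obtain ⟨r, hr⟩ := S.ext_desc hA hn (c := fun r => p^[r] c) (fun r => (hs r).1)
    (fun r => by simp only [Function.iterate_succ_apply']; exact (hp _ (hs r)).2.1)
    (fun r => by simp only [Function.iterate_succ_apply']; exact (hp _ (hs r)).2.2)
  have := neLe_anti (hs r).2.1 (C.least _ hr)
  apply (hs r).2.2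
  have h3 := selfe (N (p^[r] c).1 (p^[r] c).2)
  rwa [← this] at h3

theorem Sol.stream_ext (S : Sol m n A l N) {e : ℤ → Cell} (h : IsStreamEnum m n e l) (he : ∀ i, e i ∈ supp A)
    (i : ℤ) : Ext A N (e i) := by
  refine ⟨Set.range e, ⟨i, rfl⟩, ?_⟩
  rintro _ ⟨k, rfl⟩
  refine ⟨he k, _, ⟨k + 1, rfl⟩, h.2.1 k, ?_⟩
  rw [S.stream h he k, S.stream h he (k + 1)]; ring

theorem Canon.below {e : ℤ → Cell} (C : Canon m n A l N e) (S : Sol m n A l N) {k : ℤ} {c : Cell}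
    (hc : c ∈ supp A) (h : neLe c (e k)) : neLe c (e (N c.1 c.2)) := by
  rcases S.same hc (C.ext (N c.1 c.2)).mem (by rw [C.lev]) with h1 | h1
  · exact h1
  have h2 := fun h => S.nw hc (c := e (N c.1 c.2)) h
  have h3 := fun h => S.nw (C.ext (N c.1 c.2)).mem (c := c) h
  rw [C.lev] at h2 h3
  rcases lt_trichotomy k (N c.1 c.2) with g | g | g
  · have := C.str.lt g; simp only [neLe, NW] at *; omega
  · rwa [← g]
  · have := C.str.lt g; simp only [neLe, NW] at *; omega

theorem Canon.sw {e : ℤ → Cell} (C : Canon m n A l N e) (S : Sol m n A l N) : IsSWChannelEnum m n A e := by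
  have hmax : ∀ (T : Set Cell) (l' : ℕ), IsStream m n T l' → T ⊆ supp A → l' ≤ l := by
    rintro _ l' ⟨e', h, rfl⟩ h2
    exact S.stream_le h fun i => h2 ⟨i, rfl⟩
  have hsub : Set.range e ⊆ supp A := by rintro _ ⟨i, rfl⟩; exact (C.ext i).mem
  refine ⟨⟨l, C.str⟩, ⟨l, ⟨e, C.str, rfl⟩, hsub, hmax⟩, ?_⟩
  rintro T ⟨l', ⟨e', h, rfl⟩, h2, h3⟩
  obtain rfl : l' = l := le_antisymm (hmax _ _ ⟨e', h, rfl⟩ h2) (h3 _ _ ⟨e, C.str, rfl⟩ hsub)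
  rintro _ ⟨k, rfl⟩
  have hs : ∀ i, e' i ∈ supp A := fun i => h2 ⟨i, rfl⟩
  have h4 := S.stream h hs (k - N (e' 0).1 (e' 0).2)
  rw [add_sub_cancel] at h4
  have h5 := C.least _ (S.stream_ext h hs (k - N (e' 0).1 (e' 0).2))
  rw [h4] at h5
  exact ⟨(C.ext k).mem, _, ⟨_, rfl⟩, h5⟩

/-- any southwest channel is the canonical one -/
theorem Canon.uniq {e e0 : ℤ → Cell} (C : Canon m n A l N e) (S : Sol m n A l N)
    (h : IsSWChannelEnum m n A e0) (h0 : IsStreamEnum m n e0 l) (i : ℤ) : e0 i = e (N (e0 i).1 (e0 i).2) := by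
  have hs : ∀ i, e0 i ∈ supp A := fun i => by obtain ⟨_, _, h2, _⟩ := h.2.1; exact h2 ⟨i, rfl⟩
  obtain ⟨_, c', ⟨k, rfl⟩, h1⟩ := h.2.2 _ (C.sw S).2.1 ⟨i, rfl⟩
  exact neLe_anti (C.below S (hs i) h1) (C.least _ (S.stream_ext h0 hs i))

end


/-! ### Southwest numberings as minimal solutions -/

structure MinSol (G : (ℤ → ℤ → ℤ) → ℤ → Prop) (m n : ℕ) (A : Mat) (l : ℕ) (N : ℤ → ℤ → ℤ) : Prop where
  s : Sol m n A l N
  le : ∀ N2, Sol m n A l N2 → (∀ k, G N2 k ↔ G N k) → ∀ x y, N x y ≤ N2 x y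

/-- height profile of a column -/
def Gc (y0 : ℤ) (N : ℤ → ℤ → ℤ) (k : ℤ) : Prop := ∃ x, k ≤ N x y0

section
variable {m n : ℕ} {A : Mat} {l : ℕ} {N N2 : ℤ → ℤ → ℤ} {e : ℤ → Cell} {d : Cell → ℤ}

theorem far_nw (hm : 0 < m) (hn : 0 < n) (c c' : Cell) : ∃ q : ℤ, NW (tauZ m n (-q) c) c' := by
  refine ⟨|c.1 - c'.1| + |c.2 - c'.2| + 1, ?_⟩
  have a1 := abs_nonneg (c.1 - c'.1); have a2 := abs_nonneg (c.2 - c'.2)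
  have b1 := le_abs_self (c.1 - c'.1); have b2 := le_abs_self (c.2 - c'.2)
  have hm' : (1 : ℤ) ≤ m := by exact_mod_cast hm
  have hn' : (1 : ℤ) ≤ n := by exact_mod_cast hn
  constructor <;> simp only [tauZ] <;> nlinarith

theorem Sol.chain (S : Sol m n A l N) (k : ℕ) (ch : ℕ → Cell) (h1 : ∀ i ≤ k, ch i ∈ supp A)
    (h2 : ∀ i < k, NW (ch (i + 1)) (ch i)) : N (ch k).1 (ch k).2 + k ≤ N (ch 0).1 (ch 0).2 := by
  induction k with
  | zero => simp
  | succ k ih =>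
    have a := ih (fun i hi => h1 i (by omega)) (fun i hi => h2 i (by omega))
    have b := S.nw (h1 k (by omega)) (h2 k (by omega))
    push_cast; omega

theorem chain_cons {c c' : Cell} {v : ℤ} (hc : c ∈ supp A) (h1 : NW c' c) (h : v ∈ chainSet A e c') :
    v + 1 ∈ chainSet A e c := by
  obtain ⟨k, ch, e1, e2, e3, idx, e4, e5⟩ := h
  refine ⟨k + 1, fun r => Nat.casesOn r c ch, rfl, ?_, ?_, idx, e4, by push_cast; omega⟩
  · rintro (_ | r) hr
    · exact hc
    · exact e2 r (by omega)
  · rintro (_ | r) hr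
    · show NW (ch 0) c; rw [e1]; exact h1
    · exact e3 r (by omega)

theorem chain_self (he : ∀ i, e i ∈ supp A) (k : ℤ) : k ∈ chainSet A e (e k) :=
  ⟨0, fun _ => e k, rfl, fun _ _ => he k, fun _ h => absurd h (by omega), k, rfl, by simp⟩

theorem chain_tau (hA : IsGAP m n A) (h : IsStreamEnum m n e l) (q : ℤ) {c : Cell} {v : ℤ}
    (hv : v ∈ chainSet A e c) : v + q * l ∈ chainSet A e (tauZ m n q c) := by
  obtain ⟨k, ch, e1, e2, e3, idx, e4, e5⟩ := hv
  refine ⟨k, fun r => tauZ m n q (ch r), by simp only [e1], fun i hi => (hA.supp_tau q).2 (e2 i hi), fun i hi => ?_,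
    idx + q * l, by rw [h.tq, e4], by rw [e5]; ring⟩
  have := e3 i hi
  exact ⟨by have := this.1; simp only [tauZ]; omega, by have := this.2; simp only [tauZ]; omega⟩

theorem chain_ge (S : Sol m n A l N) (h : IsStreamEnum m n e l) (he : ∀ i, e i ∈ supp A) {c : Cell} {v : ℤ}
    (hv : v ∈ chainSet A e c) : v + N (e 0).1 (e 0).2 ≤ N c.1 c.2 := by
  obtain ⟨k, ch, e1, e2, e3, idx, e4, e5⟩ := hv
  have h1 := S.chain k ch e2 e3
  rw [← e4, S.stream h he, e1] at h1
  omega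

theorem sol_of_num (hA : IsGAP m n A) (hm : 0 < m) (hn : 0 < n) (h : IsStreamEnum m n e l)
    (he : ∀ i, e i ∈ supp A) (hd : IsChannelNumbering A e d) :
    ∃ N, Sol m n A l N ∧ ∀ c ∈ supp A, N c.1 c.2 = d c := by
  have dnw : ∀ c ∈ supp A, ∀ c' ∈ supp A, NW c' c → d c' + 1 ≤ d c := fun c hc c' hc' hh =>
    (hd c hc).2 (chain_cons hc hh (hd c' hc').1)
  have dtau : ∀ q : ℤ, ∀ c ∈ supp A, d (tauZ m n q c) = d c + q * l := by
    have key : ∀ q : ℤ, ∀ c ∈ supp A, d c + q * l ≤ d (tauZ m n q c) := fun q c hc =>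
      (hd _ ((hA.supp_tau q).2 hc)).2 (chain_tau hA h q (hd c hc).1)
    intro q c hc
    have a := key (-q) _ ((hA.supp_tau q).2 hc); have b := key q c hc
    have : tauZ m n (-q) (tauZ m n q c) = c := by ext <;> simp [tauZ]
    rw [this] at a
    linarith
  have dpred : ∀ c ∈ supp A, ∃ c' ∈ supp A, NW c' c ∧ d c' = d c - 1 := by
    intro c hc
    obtain ⟨k, ch, e1, e2, e3, idx, e4, e5⟩ := (hd c hc).1
    rcases k with _ | k
    · have hc' : e idx = c := by rw [e4, e1]
      have hnw : NW (e (idx - 1)) c := by rw [← hc']; exact h.lt (by omega)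
      refine ⟨e (idx - 1), he _, hnw, ?_⟩
      have a := (hd _ (he (idx - 1))).2 (chain_self he (idx - 1)); have b := dnw c hc _ (he _) hnw
      simp at e5; omega
    · have hnw : NW (ch 1) c := by rw [← e1]; exact e3 0 (by omega)
      have hs := e2 1 (by omega)
      refine ⟨ch 1, hs, hnw, ?_⟩
      have b := dnw c hc _ hs hnw
      have a := (hd _ hs).2 (show d c - 1 ∈ chainSet A e (ch 1) from ⟨k, fun r => ch (r + 1), rfl,
        fun i hi => e2 _ (by omega), fun i hi => e3 _ (by omega), idx, e4, by push_cast at e5; omega⟩)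
      omega
  have hex : ∀ x y : ℤ, ∃ k, (∃ c ∈ supp A, c.1 ≤ x ∧ c.2 ≤ y ∧ d c = k) ∧
      ∀ c ∈ supp A, c.1 ≤ x → c.2 ≤ y → d c ≤ k := by
    intro x y
    have q1 : ∃ b, ∀ k, (∃ c ∈ supp A, c.1 ≤ x ∧ c.2 ≤ y ∧ d c = k) → k ≤ b := by
      obtain ⟨q, hq⟩ := far_nw hm hn (x, y) (e 0)
      refine ⟨d (e 0) + q * l, ?_⟩
      rintro _ ⟨c, hc, hx, hy, rfl⟩
      rw [← dtau q _ (he 0)]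
      have := dnw _ ((hA.supp_tau q).2 (he 0)) c hc ⟨by have := hq.1; simp only [tauZ] at *; linarith,
        by have := hq.2; simp only [tauZ] at *; linarith⟩
      omega
    obtain ⟨k, h1, h2⟩ := Int.exists_greatest_of_bdd q1 (by
      obtain ⟨q, hq⟩ := far_nw hm hn (e 0) (x, y)
      exact ⟨_, _, (hA.supp_tau (-q)).2 (he 0), hq.1.le, hq.2.le, rfl⟩)
    exact ⟨k, h1, fun c hc hx hy => h2 _ ⟨c, hc, hx, hy, rfl⟩⟩
  choose N hN1 hN2 using hex
  have hNd : ∀ c ∈ supp A, N c.1 c.2 = d c ∧ N (c.1 - 1) (c.2 - 1) = d c - 1 := by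
    intro c hc
    have a1 := hN2 c.1 c.2 c hc le_rfl le_rfl
    obtain ⟨c1, hc1, hnw, b1⟩ := dpred c hc
    have b2 := hN2 (c.1 - 1) (c.2 - 1) c1 hc1 (by have := hnw.1; omega) (by have := hnw.2; omega)
    obtain ⟨c2, hc2, x2, y2, b3⟩ := hN1 (c.1 - 1) (c.2 - 1)
    have b4 := dnw c hc c2 hc2 ⟨by omega, by omega⟩
    obtain ⟨c3, hc3, x3, y3, b5⟩ := hN1 c.1 c.2
    obtain ⟨c4, hc4, hnw4, b6⟩ := dpred c3 hc3
    have b7 := dnw c hc c4 hc4 ⟨by have := hnw4.1; omega, by have := hnw4.2; omega⟩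
    omega
  refine ⟨N, ⟨h.1, fun x y => ?_, fun x y => ?_, fun x y hc => ?_, fun x y => ?_, fun x y => ?_⟩, fun c hc => (hNd c hc).1⟩
  · obtain ⟨c, hc, hx, hy, h1⟩ := hN1 (x - 1) y
    rw [← h1]; exact hN2 _ _ c hc (by omega) hy
  · obtain ⟨c, hc, hx, hy, h1⟩ := hN1 x (y - 1)
    rw [← h1]; exact hN2 _ _ c hc hx (by omega)
  · have := hNd (x, y) hc; simp only at this; omega
  · obtain ⟨c, hc, hx, hy, h1⟩ := hN1 x y
    exact ⟨c.1, hx, c.2, hy, hc, by rw [(hNd c hc).2, h1]; ring⟩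
  · apply le_antisymm
    · obtain ⟨c, hc, hx, hy, h1⟩ := hN1 (x + m) (y + n)
      have := hN2 x y (tauZ m n (-1) c) ((hA.supp_tau _).2 hc) (by simp only [tauZ]; linarith) (by simp only [tauZ]; linarith)
      rw [dtau _ c hc] at this; linarith
    · obtain ⟨c, hc, hx, hy, h1⟩ := hN1 x y
      have := hN2 (x + m) (y + n) (tauZ m n 1 c) ((hA.supp_tau _).2 hc) (by simp only [tauZ]; linarith) (by simp only [tauZ]; linarith)
      rw [dtau _ c hc] at this; linarith

theorem sol_le_of_supp (S : Sol m n A l N) (S2 : Sol m n A l N2) {s : ℤ}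
    (h : ∀ c ∈ supp A, N c.1 c.2 + s ≤ N2 c.1 c.2) (x y : ℤ) : N x y + s ≤ N2 x y := by
  obtain ⟨a, ha, b, hb, h0, h1⟩ := S.att x y
  have h2 := h (a, b) h0
  have h3 := S2.mono ha hb
  have h4 := S.celleq h0
  simp only at h2; omega

/-- the profile of a column is seen by chains to the canonical channel -/
theorem Canon.top (C : Canon m n A l N e) (S : Sol m n A l N) (hA : IsGAP m n A) (hn : 0 < n) {k x y : ℤ}
    (h : k ≤ N x y) : ∃ c ∈ supp A, c.2 ≤ y ∧ k ∈ chainSet A e c := by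
  obtain ⟨c, hc, hx, hy, hk⟩ := S.lev k x y h
  obtain ⟨c', ⟨h1, h2⟩, h3⟩ := least_of {c : Cell | c ∈ supp A ∧ N c.1 c.2 = k} (S.fin hA hn k) ⟨c, hc, hk⟩
    fun c hc c' hc' => S.same hc.1 hc'.1 (hc.2.trans hc'.2.symm)
  refine ⟨c', h1, (h3 c ⟨hc, hk⟩).2.trans hy, ?_⟩
  rw [← h2]
  exact C.rigid S hA hn h1 (by rw [h2]; exact h3 _ ⟨(C.ext k).mem, C.lev k⟩)

theorem minSol_of_sw (hA : IsGAP m n A) (hm : 0 < m) (hn : 0 < n) (h : IsSWNumbering m n A d) :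
    ∃ l N, (∀ c ∈ supp A, N c.1 c.2 = d c) ∧ ∀ y0, MinSol (Gc y0) m n A l N := by
  obtain ⟨e, hsw, hd⟩ := h
  obtain ⟨⟨l, hst⟩, ⟨l1, _, hsub, _⟩, _⟩ := id hsw
  have he : ∀ i, e i ∈ supp A := fun i => hsub ⟨i, rfl⟩
  obtain ⟨N, S, hN⟩ := sol_of_num hA hm hn hst he hd
  refine ⟨l, N, hN, fun y0 => ⟨S, fun N2 S2 hG => ?_⟩⟩
  have hle : ∀ x y, N x y + N2 (e 0).1 (e 0).2 ≤ N2 x y := sol_le_of_supp S S2 fun c hc => by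
    rw [hN c hc]; exact chain_ge S2 hst he (hd c hc).1
  suffices h0 : 0 ≤ N2 (e 0).1 (e 0).2 from fun x y => by have := hle x y; omega
  obtain ⟨e2, C⟩ := S2.canon hA hn
  have heq : ∀ i, e i = e2 (N2 (e 0).1 (e 0).2 + i) := fun i => by
    rw [← S2.stream hst he i]; exact C.uniq S2 hsw hst i
  obtain ⟨X, hX⟩ := S2.bdX hA hm hn y0
  obtain ⟨c, hc, hy, k, ch, e1, g2, g3, idx, e4, e5⟩ := C.top S2 hA hn (le_refl (N2 X y0))
  have h1 : N2 X y0 - N2 (e 0).1 (e 0).2 ≤ N c.1 c.2 := by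
    rw [hN c hc]
    refine (hd c hc).2 ⟨k, ch, e1, g2, g3, idx - N2 (e 0).1 (e 0).2, ?_, by omega⟩
    rw [heq, ← e4]; congr 1; ring
  obtain ⟨x, hx⟩ := (hG (N2 X y0 - N2 (e 0).1 (e 0).2)).2 ⟨c.1, h1.trans (S.mono le_rfl hy)⟩
  have := hX x
  omega

theorem sw_of_minSol (hA : IsGAP m n A) (hm : 0 < m) (hn : 0 < n) {y0 : ℤ} (h : MinSol (Gc y0) m n A l N) :
    IsSWNumbering m n A fun c => N c.1 c.2 := by
  have S := h.s
  obtain ⟨e, C⟩ := S.canon hA hn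
  have he := fun i => (C.ext i).mem
  have hb : ∀ c, ∀ v ∈ chainSet A e c, v ≤ N c.1 c.2 := fun c v hv => by
    have := chain_ge S C.str he hv; rw [C.lev] at this; omega
  have hex : ∀ c, c ∈ supp A → ∃ v, IsGreatest (chainSet A e c) v := by
    intro c hc
    obtain ⟨v, h1, h2⟩ := Int.exists_greatest_of_bdd (P := fun v => v ∈ chainSet A e c) ⟨_, hb c⟩ (by
      obtain ⟨q, hq⟩ := far_nw hm hn (e 0) c
      rw [← C.str.tq] at hq
      exact ⟨_, chain_cons hc hq (chain_self he _)⟩)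
    exact ⟨v, h1, h2⟩
  choose! d2 hd2 using hex
  obtain ⟨N2, S2, hN2⟩ := sol_of_num hA hm hn C.str he hd2
  have hle : ∀ x y, N2 x y + 0 ≤ N x y := sol_le_of_supp S2 S fun c hc => by
    rw [hN2 c hc, add_zero]; exact hb c _ (hd2 c hc).1
  have hge := h.le N2 S2 fun k => ⟨fun ⟨x, hx⟩ => ⟨x, hx.trans (by simpa using hle x y0)⟩, fun ⟨x, hx⟩ => by
    obtain ⟨c, hc, hy, hk⟩ := C.top S hA hn hx
    exact ⟨c.1, ((hd2 c hc).2 hk).trans (by rw [← hN2 c hc]; exact S2.mono le_rfl hy)⟩⟩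
  refine ⟨e, C.sw S, fun c hc => ?_⟩
  have : N c.1 c.2 = d2 c := by rw [← hN2 c hc]; have := hle c.1 c.2; have := hge c.1 c.2; omega
  simp only [this]; exact hd2 c hc

theorem sw_flow {l2 : ℕ} (hA : IsGAP m n A) (hn : 0 < n) (S : Sol m n A l N) (S2 : Sol m n A l2 N2) : l = l2 := by
  obtain ⟨e, C⟩ := S.canon hA hn
  obtain ⟨e2, C2⟩ := S2.canon hA hn
  exact le_antisymm (S2.stream_le C.str fun i => (C.ext i).mem) (S.stream_le C2.str fun i => (C2.ext i).mem)

theorem Sol.shift (S : Sol m n A l N) (s : ℤ) : Sol m n A l fun x y => N x y + s where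
  lpos := S.lpos
  monx x y := by have := S.monx x y; omega
  mony x y := by have := S.mony x y; omega
  cell x y h := by have := S.cell x y h; omega
  att x y := let ⟨a, ha, b, hb, h0, h1⟩ := S.att x y; ⟨a, ha, b, hb, h0, by omega⟩
  per x y := by have := S.per x y; omega

theorem sw_shift (hA : IsGAP m n A) (hm : 0 < m) (hn : 0 < n)
    (h : MinSol (Gc 0) m n A l N) (h2 : MinSol (Gc 0) m n A l N2) : ∃ s, ∀ x y, N2 x y = N x y + s := by
  obtain ⟨X, hX⟩ := h.s.bdX hA hm hn 0
  obtain ⟨X2, hX2⟩ := h2.s.bdX hA hm hn 0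
  have a1 := h2.le _ (h.s.shift (N2 X2 0 - N X 0)) fun k => ⟨fun ⟨x, hx⟩ => ⟨X2, by have := hX x; simp only at hx; omega⟩,
    fun ⟨x, hx⟩ => ⟨X, by have := hX2 x; simp only; omega⟩⟩
  have a2 := h.le _ (h2.s.shift (N X 0 - N2 X2 0)) fun k => ⟨fun ⟨x, hx⟩ => ⟨X, by have := hX2 x; simp only at hx; omega⟩,
    fun ⟨x, hx⟩ => ⟨X2, by have := hX x; simp only; omega⟩⟩
  exact ⟨N2 X2 0 - N X 0, fun x y => by have := a1 x y; have := a2 x y; omega⟩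

theorem minSol_trans {y0 : ℤ} : MinSol (Gc y0) m n A l N ↔
    MinSol (fun N k => Rg N k y0) n m (transM A) l (fun x y => N y x) := by
  constructor
  · intro h
    exact ⟨h.s.trans, fun N2 S2 hG x y => h.le (fun x y => N2 y x) S2.trans hG y x⟩
  · intro h
    exact ⟨h.s.trans, fun N2 S2 hG x y => h.le (fun x y => N2 y x) S2.trans hG y x⟩

end

section
variable {m n : ℕ} {A A' : Mat} {l : ℕ} {N N' : ℤ → ℤ → ℤ} {i j : ℤ} {D : ℤ → ℤ} {G : (ℤ → ℤ → ℤ) → ℤ → Prop}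

/-- `G` is not changed by the row operator `i` -/
def GInv (m n : ℕ) (i : ℤ) (G : (ℤ → ℤ → ℤ) → ℤ → Prop) : Prop :=
  ∀ (j : ℤ) (l : ℕ) (D : ℤ → ℤ) (A A' : Mat) (N N' : ℤ → ℤ → ℤ), Cpl m n i j l D A A' N N' → ∀ k, G N' k ↔ G N k

theorem gInv_c (hm : 2 ≤ m) (i y0 : ℤ) : GInv m n i (Gc y0) := fun _ _ _ _ _ _ _ c k => c.colg hm k y0

theorem gInv_r (hm : 2 ≤ m) (i : ℤ) : GInv m n i (fun N k => Rg N k (i + 1)) := fun _ _ _ _ _ _ _ c k => by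
  simp only [Rg, c.eqo (x := i + 1) fun k hk => ne1 hm i k 0 (by linarith)]

theorem min_transfer (hG : GInv m n i G) (h : FRel m n i j D A A') (hA : IsGAP m n A) (hm : 2 ≤ m) (hn : 0 < n)
    (c : Cpl m n i j l D A A' N N') (W : MinSol G m n A l N) : MinSol G m n A' l N' := by
  refine ⟨c.s', fun N2' S2 hg => sol_le (i := i) hm c.s' S2 fun x hx y => ?_⟩
  obtain ⟨N2, c2⟩ := couple2 h hA hm hn S2
  rw [c.eqo hx, c2.eqo hx]
  exact W.le N2 c2.s (fun k => by rw [← hG _ _ _ _ _ _ _ c2, hg, hG _ _ _ _ _ _ _ c]) x y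

theorem min_transfer' (hG : GInv m n i G) (h : FRel m n i j D A A') (hA : IsGAP m n A) (hm : 2 ≤ m) (hn : 0 < n)
    (c : Cpl m n i j l D A A' N N') (W : MinSol G m n A' l N') : MinSol G m n A l N := by
  refine ⟨c.s, fun N2 S2 hg => sol_le (i := i) hm c.s S2 fun x hx y => ?_⟩
  obtain ⟨N2', c2⟩ := couple1 h hA hm hn S2
  rw [← c.eqo hx, ← c2.eqo hx]
  exact W.le N2' c2.s' (fun k => by rw [hG _ _ _ _ _ _ _ c2, hg, hG _ _ _ _ _ _ _ c]) x y

end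


/-! ### Zig-zags -/

def Crn (N : ℤ → ℤ → ℤ) (k : ℤ) (c : Cell) : Prop :=
  k ≤ N c.1 c.2 ∧ N (c.1 - 1) c.2 < k ∧ N c.1 (c.2 - 1) < k

def Ocn (N : ℤ → ℤ → ℤ) (k : ℤ) (c : Cell) : Prop :=
  k ≤ N (c.1 - 1) c.2 ∧ k ≤ N c.1 (c.2 - 1) ∧ N (c.1 - 1) (c.2 - 1) < k

def Zc (N : ℤ → ℤ → ℤ) (k : ℤ) (c : Cell) : Prop := k ≤ N c.1 c.2 ∧ N (c.1 - 1) (c.2 - 1) < k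

/-- back-post corner of level `k` -/
def BP (N : ℤ → ℤ → ℤ) (k : ℤ) (c : Cell) : Prop :=
  (Rg N k c.1 ∧ ¬ Rg N k (c.1 - 1)) ∧ Gc c.2 N k ∧ ¬ Gc (c.2 - 1) N k

theorem least_int {P : ℤ → Prop} (h : ∃ x, P x) (hb : ∃ b, ∀ x, P x → b ≤ x) :
    ∃ x, P x ∧ ∀ y, P y → x ≤ y := by
  obtain ⟨b, hb⟩ := hb
  obtain ⟨x, h1, h2⟩ := Int.exists_least_of_bdd (P := P) ⟨b, hb⟩ h
  exact ⟨x, h1, h2⟩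

section
variable {m n : ℕ} {A B : Mat} {l : ℕ} {N N2 : ℤ → ℤ → ℤ} {e : ℤ → Cell} {d : Cell → ℤ}

theorem Sol.crn_ex (S : Sol m n A l N) (hA : IsGAP m n A) (hm : 0 < m) (hn : 0 < n) {k x y : ℤ}
    (h : k ≤ N x y) : ∃ c, Crn N k c ∧ c.1 ≤ x ∧ c.2 ≤ y := by
  obtain ⟨X, hX⟩ := S.lowX hA hm hn y k
  obtain ⟨x', h1, h2⟩ := least_int (P := fun x => k ≤ N x y) ⟨x, h⟩ ⟨X, fun t ht => by
    by_contra hc; have := S.mono (show t ≤ X by omega) (le_refl y); omega⟩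
  obtain ⟨Y, hY⟩ := S.lowY hA hm hn x' k
  obtain ⟨y', h3, h4⟩ := least_int (P := fun y => k ≤ N x' y) ⟨y, h1⟩ ⟨Y, fun t ht => by
    by_contra hc; have := S.mono (le_refl x') (show t ≤ Y by omega); omega⟩
  have h5 : y' ≤ y := h4 y h1
  refine ⟨(x', y'), ⟨h3, ?_, ?_⟩, h2 x h, h5⟩
  · by_contra hc
    have := S.mono (le_refl (x' - 1)) h5
    have := h2 (x' - 1) (by simp only at hc ⊢; omega)
    omega
  · by_contra hc
    have := h4 (y' - 1) (by simp only at hc ⊢; omega)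
    omega

theorem Sol.crn_iff (S : Sol m n A l N) (hd : ∀ c ∈ supp A, N c.1 c.2 = d c) (k : ℤ) (c : Cell) :
    c ∈ nwMaximal (levelSet A d k) ↔ Crn N k c := by
  constructor
  · rintro ⟨⟨h1, h2⟩, h3⟩
    rw [← hd c h1] at h2
    have key : ∀ x y, x ≤ c.1 → y ≤ c.2 → k ≤ N x y → c.1 ≤ x ∧ c.2 ≤ y := by
      intro x y hx hy hk
      obtain ⟨c', h4, h5, h6, h7⟩ := S.lev k x y hk
      have := h3 c' ⟨h4, by rw [← hd c' h4]; exact h7⟩ ⟨by omega, by omega⟩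
      subst this; exact ⟨h5, h6⟩
    refine ⟨by omega, ?_, ?_⟩
    · by_contra hc; have := key (c.1 - 1) c.2 (by omega) le_rfl (by omega); omega
    · by_contra hc; have := key c.1 (c.2 - 1) le_rfl (by omega) (by omega); omega
  · rintro ⟨h1, h2, h3⟩
    have key : ∀ x y, x ≤ c.1 → y ≤ c.2 → k ≤ N x y → x = c.1 ∧ y = c.2 := by
      intro x y hx hy hk
      constructor
      · by_contra hc; have := S.mono (show x ≤ c.1 - 1 by omega) hy; omega
      · by_contra hc; have := S.mono hx (show y ≤ c.2 - 1 by omega); omega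
    obtain ⟨c', h4, h5, h6, h7⟩ := S.lev k c.1 c.2 h1
    have h8 := key c'.1 c'.2 h5 h6 h7.ge
    have : c' = c := Prod.ext h8.1 h8.2
    subst this
    refine ⟨⟨h4, by rw [← hd c' h4]; exact h7⟩, ?_⟩
    rintro c ⟨g1, g2⟩ g3
    have h8 := key c.1 c.2 g3.1 g3.2 (by rw [hd c g1]; exact g2.ge)
    exact Prod.ext h8.1 h8.2

theorem Sol.bp_ex (S : Sol m n A l N) (hA : IsGAP m n A) (hm : 0 < m) (hn : 0 < n) (k : ℤ) :
    ∃ x, Rg N k x ∧ ¬ Rg N k (x - 1) := by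
  have hl : (1 : ℤ) ≤ l := by exact_mod_cast S.lpos
  have hm' : (1 : ℤ) ≤ m := by exact_mod_cast hm
  have b1 : ∃ x, Rg N k x := by
    let q : ℤ := |N 0 0| + |k|
    refine ⟨0 + q * m, 0 + q * n, ?_⟩
    rw [S.perq]
    have h3 := neg_abs_le (N 0 0); have h4 := le_abs_self k
    have : q ≤ q * l := by
      have : 0 ≤ q := by positivity
      nlinarith
    simp only [q] at *; linarith
  have b2 : ∃ b, ∀ x, Rg N k x → b ≤ x := by
    obtain ⟨Y, hY⟩ := S.bdY hA hm hn 0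
    let q : ℤ := |N 0 Y| + |k| + 1
    refine ⟨0 + (-q) * m, ?_⟩
    rintro x ⟨y, hy⟩
    by_contra hc
    have h1 := S.mono (show x ≤ 0 + (-q) * m by omega) (show y ≤ (y + q * n) + (-q) * n by linarith)
    rw [S.perq] at h1
    have h2 := hY (y + q * n)
    have h3 := le_abs_self (N 0 Y); have h4 := neg_abs_le k
    have : q ≤ q * l := by
      have : 0 ≤ q := by positivity
      nlinarith
    simp only [q] at *; linarith
  obtain ⟨x, h1, h2⟩ := least_int b1 b2
  exact ⟨x, h1, fun h => by have := h2 _ h; omega⟩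

theorem gc_rg (k y : ℤ) : Gc y N k ↔ Rg (fun x y => N y x) k y := Iff.rfl

theorem Sol.bp (S : Sol m n A l N) (hA : IsGAP m n A) (hm : 0 < m) (hn : 0 < n) (k : ℤ) :
    ∃ c, BP N k c := by
  obtain ⟨x, hx⟩ := S.bp_ex hA hm hn k
  obtain ⟨y, hy⟩ := S.trans.bp_ex (hA.trans hm hn) hn hm k
  exact ⟨(x, y), hx, hy⟩

theorem Sol.rg_mono (S : Sol m n A l N) {k x x' : ℤ} (h : Rg N k x) (hx : x ≤ x') : Rg N k x' :=
  let ⟨y, hy⟩ := h; ⟨y, hy.trans (S.mono hx le_rfl)⟩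

theorem Sol.rg_pred (S : Sol m n A l N) {k x : ℤ} (h : Rg N (k + 1) x) : Rg N k (x - 1) :=
  let ⟨y, hy⟩ := h; ⟨y - 1, by have := S.le1 x y; omega⟩

/-- first row reaching level `k` -/
theorem Sol.r1 (S : Sol m n A l N) {k x x' : ℤ} (h : Rg N k x ∧ ¬ Rg N k (x - 1)) :
    Rg N k x' ↔ x ≤ x' := by
  constructor
  · intro h'; by_contra hc; exact h.2 (S.rg_mono h' (by omega))
  · exact fun hx => S.rg_mono h.1 hx

theorem Sol.bp_uniq (S : Sol m n A l N) {k : ℤ} {c c' : Cell} (h : BP N k c) (h' : BP N k c') : c = c' := by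
  have a := (S.r1 h.1).1 h'.1.1
  have b := (S.r1 h'.1).1 h.1.1
  have a2 := (S.trans.r1 h.2).1 h'.2.1
  have b2 := (S.trans.r1 h'.2).1 h.2.1
  exact Prod.ext (by omega) (by omega)

theorem Sol.bp_nw (S : Sol m n A l N) {k : ℤ} {c c' : Cell} (h : BP N k c) (h' : BP N (k + 1) c') : NW c c' := by
  have a := (S.r1 h.1).1 (S.rg_pred h'.1.1)
  have a2 := (S.trans.r1 h.2).1 (S.trans.rg_pred h'.2.1)
  exact ⟨by omega, by omega⟩

theorem Sol.bp_tau (S : Sol m n A l N) {k : ℤ} {c : Cell} (h : BP N k c) : BP N (k + l) (tauC m n c) := by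
  have e := S.rgper 1 (k + l)
  have e2 := S.trans.rgper 1 (k + l)
  simp only [one_mul, add_sub_cancel_right] at e e2
  have hh := h
  simp only [BP, tauC, gc_rg] at hh ⊢
  rw [add_sub_right_comm, add_sub_right_comm, e, e, e2, e2]; exact hh

theorem Sol.bp_enum (S : Sol m n A l N) {e : ℤ → Cell} (he : ∀ k, BP N k (e k)) : IsStreamEnum m n e l :=
  ⟨S.lpos, fun i => S.bp_nw (he i) (he (i + 1)), fun i => S.bp_uniq (S.bp_tau (he i)) (he _)⟩

/-! canonical zig-zag -/

theorem Sol.zz (S : Sol m n A l N) (hA : IsGAP m n A) (hm : 0 < m) (hn : 0 < n) (k : ℤ) :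
    ∃ z : ℤ → Cell, IsZigZag z ∧ (∀ i, Zc N k (z i)) ∧ ∀ c, Zc N k c → z (c.2 - c.1) = c := by
  obtain ⟨c0, h0⟩ := S.bp hA hm hn k
  obtain ⟨⟨⟨y0, hy0⟩, h1⟩, ⟨x0, hx0⟩, h2⟩ := h0
  have hl : (1 : ℤ) ≤ l := by exact_mod_cast S.lpos
  have hm' : (1 : ℤ) ≤ m := by exact_mod_cast hm
  have hn' : (1 : ℤ) ≤ n := by exact_mod_cast hn
  have low : ∀ x y, k ≤ N x y → c0.1 ≤ x ∧ c0.2 ≤ y := fun x y h =>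
    ⟨by by_contra hc; exact h1 ⟨y, h.trans (S.mono (by omega) le_rfl)⟩,
     by by_contra hc; exact h2 ⟨x, h.trans (S.mono le_rfl (by omega))⟩⟩
  have ex : ∀ i, ∃ x, Zc N k (x, x + i) := by
    intro i
    obtain ⟨x, h3, h4⟩ := least_int (P := fun x => k ≤ N x (x + i))
      ⟨max c0.1 (y0 - i), hy0.trans (S.mono (le_max_left _ _) (by have := le_max_right c0.1 (y0 - i); omega))⟩
      ⟨c0.1, fun x hx => (low _ _ hx).1⟩
    refine ⟨x, h3, ?_⟩
    by_contra hc
    have := h4 (x - 1) (by simp only at hc; rw [show x - 1 + i = x + i - 1 by ring]; omega)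
    omega
  choose x hx using ex
  have un : ∀ c, Zc N k c → (x (c.2 - c.1), x (c.2 - c.1) + (c.2 - c.1)) = c := by
    intro c hc
    have h3 := hx (c.2 - c.1)
    have : x (c.2 - c.1) = c.1 := by
      rcases lt_trichotomy (x (c.2 - c.1)) c.1 with h | h | h
      · have := S.mono (show x (c.2 - c.1) ≤ c.1 - 1 by omega) (show x (c.2 - c.1) + (c.2 - c.1) ≤ c.2 - 1 by omega)
        have := hc.2; have := h3.1; simp only at *; omega
      · exact h
      · have := S.mono (show c.1 ≤ x (c.2 - c.1) - 1 by omega) (show c.2 ≤ x (c.2 - c.1) + (c.2 - c.1) - 1 by omega)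
        have := hc.1; have := h3.2; simp only at *; omega
    exact Prod.ext this (by simp only; omega)
  have st : ∀ i, (x (i + 1), x (i + 1) + (i + 1)) =
      if k ≤ N (x i - 1) (x i + i) then (x i - 1, x i + i) else (x i, x i + i + 1) := by
    intro i
    have h3 := hx i
    split_ifs with h
    · have := un (x i - 1, x i + i) ⟨h, lt_of_le_of_lt (S.mono (by simp) le_rfl) h3.2⟩
      simp only at this
      rw [show x i + i - (x i - 1) = i + 1 by ring] at this; exact this
    · have := un (x i, x i + i + 1) ⟨h3.1.trans (S.mono le_rfl (by simp)), by
        simp only [add_sub_cancel_right]; omega⟩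
      simp only at this
      rw [show x i + i + 1 - x i = i + 1 by ring] at this; exact this
  refine ⟨fun i => (x i, x i + i), ⟨fun i => ?_, ⟨y0 - c0.1, fun i hi => ?_⟩, ⟨c0.2 - x0 - 1, fun i hi => ?_⟩⟩, hx, un⟩
  · simp only [st i]
    split_ifs
    · exact Or.inr rfl
    · exact Or.inl rfl
  · have : x i = c0.1 := by
      have := un (c0.1, c0.1 + i) ⟨hy0.trans (S.mono le_rfl (by simp only; omega)), by
        by_contra hc; have := (low (c0.1 - 1) (c0.1 + i - 1) (by simp only at hc; omega)).1; omega⟩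
      simp only [add_sub_cancel_left] at this
      exact congrArg Prod.fst this
    simp only [st i]
    rw [if_neg]
    intro h
    have := (low _ _ h).1; omega
  · have : x i + i = c0.2 := by
      have := un (c0.2 - i, c0.2) ⟨hx0.trans (S.mono (by simp only; omega) le_rfl), by
        by_contra hc; have := (low (c0.2 - i - 1) (c0.2 - 1) (by simp only at hc; omega)).2; omega⟩
      simp only [sub_sub_cancel] at this
      exact congrArg Prod.snd this
    simp only [st i]
    rw [if_pos]
    exact hx0.trans (S.mono (by omega) (by omega))

theorem Sol.zz_at (S : Sol m n A l N) (hA : IsGAP m n A) (hm : 0 < m) (hn : 0 < n)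
    (hd : ∀ c ∈ supp A, N c.1 c.2 = d c) (k : ℤ) :
    ∃ z : ℤ → Cell, ZigZagAt A d k z ∧ ∀ c, Ocn N k c → c ∈ outerCorners z := by
  obtain ⟨z, h1, h2, h3⟩ := S.zz hA hm hn k
  refine ⟨z, ⟨h1, ?_⟩, ?_⟩
  · ext c
    rw [S.crn_iff hd]
    constructor
    · rintro ⟨i, rfl, h4, h5⟩
      have a := h2 (i - 1)
      have b := h2 (i + 1)
      have e1 : (z (i - 1)).1 - 1 = (z i).1 := by rw [h4]
      have e2 : (z (i - 1)).2 = (z i).2 := by rw [h4]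
      refine ⟨(h2 i).1, ?_, ?_⟩
      · have := b.2; rw [h5] at this; simpa using this
      · have := a.2; rw [e1, e2] at this; exact this
    · rintro ⟨h4, h5, h6⟩
      have a := h3 c ⟨h4, lt_of_le_of_lt (S.mono le_rfl (by simp)) h5⟩
      have b := h3 (c.1 + 1, c.2) ⟨h4.trans (S.mono (by simp) le_rfl), by simpa using h6⟩
      have b2 := h3 (c.1, c.2 + 1) ⟨h4.trans (S.mono le_rfl (by simp)), by simpa using h5⟩
      simp only at b b2
      rw [show c.2 - (c.1 + 1) = c.2 - c.1 - 1 by ring] at b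
      rw [show c.2 + 1 - c.1 = c.2 - c.1 + 1 by ring] at b2
      exact ⟨c.2 - c.1, a, by rw [a, b]; simp, by rw [a, b2]⟩
  · rintro c ⟨h4, h5, h6⟩
    have a := h3 c ⟨h4.trans (S.mono (by simp) le_rfl), h6⟩
    have b := h3 (c.1, c.2 - 1) ⟨h5, lt_of_le_of_lt (S.mono le_rfl (by simp)) h6⟩
    have b2 := h3 (c.1 - 1, c.2) ⟨h4, lt_of_le_of_lt (S.mono (by simp) le_rfl) h6⟩
    simp only at b b2
    rw [show c.2 - 1 - c.1 = c.2 - c.1 - 1 by ring] at b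
    rw [show c.2 - (c.1 - 1) = c.2 - c.1 + 1 by ring] at b2
    exact ⟨c.2 - c.1, a, by rw [a, b]; simp, by rw [a, b2]⟩

theorem IsZigZag.left {z : ℤ → Cell} (h : IsZigZag z) (t : ℤ)
    (ht : z t = ((z (t - 1)).1, (z (t - 1)).2 + 1)) :
    ∃ c ∈ innerCorners z, c.1 = (z t).1 ∧ c.2 < (z t).2 := by
  obtain ⟨h1, -, X, hX⟩ := h
  revert ht
  refine int_low (P := fun t => z t = ((z (t - 1)).1, (z (t - 1)).2 + 1) →
    ∃ c ∈ innerCorners z, c.1 = (z t).1 ∧ c.2 < (z t).2) ⟨X + 1, fun y hy hz => ?_⟩ (fun y ih hz => ?_) t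
  · have := hX (y - 1) (by omega)
    rw [sub_add_cancel] at this
    rw [hz] at this
    have := congrArg Prod.fst this
    simp only at this; omega
  · have h2 := h1 (y - 1 - 1)
    rw [sub_add_cancel] at h2
    rcases h2 with h2 | h2
    · obtain ⟨c, hc, h3, h4⟩ := ih h2
      refine ⟨c, hc, ?_, ?_⟩ <;> rw [hz] <;> simp only <;> omega
    · refine ⟨z (y - 1), ⟨y - 1, rfl, h2, by rwa [sub_add_cancel]⟩, ?_, ?_⟩ <;> rw [hz]
      simp

theorem IsZigZag.right {z : ℤ → Cell} (h : IsZigZag z) (t : ℤ)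
    (ht : z (t + 1) = ((z t).1 - 1, (z t).2)) :
    ∃ c ∈ innerCorners z, c.2 = (z t).2 ∧ c.1 < (z t).1 := by
  obtain ⟨h1, ⟨X, hX⟩, -⟩ := h
  have := int_low (P := fun t => z (-t + 1) = ((z (-t)).1 - 1, (z (-t)).2) →
    ∃ c ∈ innerCorners z, c.2 = (z (-t)).2 ∧ c.1 < (z (-t)).1) ⟨-X, fun y hy hz => ?_⟩ (fun y ih hz => ?_) (-t)
  · rw [neg_neg] at this; exact this ht
  · have := hX (-y) (by omega)
    rw [hz] at this
    have := congrArg Prod.fst this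
    simp at this
  · rw [show -(y - 1) = -y + 1 by ring] at ih
    rcases h1 (-y + 1) with h2 | h2
    · refine ⟨z (-y + 1), ⟨-y + 1, rfl, by rwa [add_sub_cancel_right], h2⟩, ?_, ?_⟩ <;> rw [hz]
      simp
    · obtain ⟨c, hc, h3, h4⟩ := ih h2
      rw [hz] at h3 h4
      exact ⟨c, hc, h3, by simp only at h4; omega⟩

theorem IsZigZag.no {z : ℤ → Cell} (h : IsZigZag z) (t s : ℤ) : (z t).1 ≤ (z s).1 ∨ (z t).2 ≤ (z s).2 := by
  obtain ⟨h1, -, -⟩ := h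
  rcases le_total t s with h | h
  · right
    refine monotone_int_of_le_succ (f := fun t => (z t).2) (fun i => ?_) h
    rcases h1 i with h | h <;> rw [h]
    simp
  · left
    refine antitone_int_of_succ_le (f := fun t => (z t).1) (fun i => ?_) h
    rcases h1 i with h | h <;> rw [h]
    simp

theorem Sol.inner_iff (S : Sol m n A l N) (hA : IsGAP m n A) (hm : 0 < m) (hn : 0 < n)
    (hd : ∀ c ∈ supp A, N c.1 c.2 = d c) (c : Cell) : IsInnerOf A d c ↔ ∃ k, Crn N k c := by
  constructor
  · rintro ⟨k, z, ⟨-, h1⟩, h2⟩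
    rw [h1] at h2
    exact ⟨k, (S.crn_iff hd k c).1 h2⟩
  · rintro ⟨k, hk⟩
    obtain ⟨z, h1, -⟩ := S.zz_at hA hm hn hd k
    exact ⟨k, z, h1, by rw [h1.2]; exact (S.crn_iff hd k c).2 hk⟩

theorem Sol.outer_iff (S : Sol m n A l N) (hA : IsGAP m n A) (hm : 0 < m) (hn : 0 < n)
    (hd : ∀ c ∈ supp A, N c.1 c.2 = d c) (c : Cell) : IsOuterOf A d c ↔ ∃ k, Ocn N k c := by
  constructor
  · rintro ⟨k, z, ⟨hz, h1⟩, ⟨t, rfl, h2, h3⟩⟩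
    have key : ∀ c, c ∈ innerCorners z ↔ Crn N k c := fun c => by rw [h1, S.crn_iff hd]
    obtain ⟨c1, g1, g2, g3⟩ := hz.left t h2
    obtain ⟨c2, f1, f2, f3⟩ := hz.right t h3
    refine ⟨k, ((key c2).1 f1).1.trans (S.mono (by omega) (by omega)),
      ((key c1).1 g1).1.trans (S.mono (by omega) (by omega)), ?_⟩
    by_contra hc
    obtain ⟨c', h5, h6, h7⟩ := S.crn_ex hA hm hn (not_lt.1 hc)
    obtain ⟨s, rfl, -⟩ := (key c').2 h5
    rcases hz.no t s with h | h <;> omega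
  · rintro ⟨k, hk⟩
    obtain ⟨z, h1, h2⟩ := S.zz_at hA hm hn hd k
    exact ⟨k, z, h1, h2 c hk⟩

theorem Sol.flat_iff (S : Sol m n A l N) (hA : IsGAP m n A) (hm : 0 < m) (hn : 0 < n)
    (hd : ∀ c ∈ supp A, N c.1 c.2 = d c) : FlatEntries A B (IsInnerOf A d) (IsOuterOf A d) ↔ FlatEq A B N := by
  have key : ∀ c : Cell, ((IsInnerOf A d c → B c.1 c.2 + 1 = A c.1 c.2) ∧
    (IsOuterOf A d c → B c.1 c.2 = A c.1 c.2 + 1) ∧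
    (¬ IsInnerOf A d c → ¬ IsOuterOf A d c → B c.1 c.2 = A c.1 c.2)) ↔
    (B c.1 c.2 : ℤ) + N c.1 c.2 + N (c.1 - 1) (c.2 - 1) = A c.1 c.2 + N (c.1 - 1) c.2 + N c.1 (c.2 - 1) := by
    intro c
    rw [S.inner_iff hA hm hn hd, S.outer_iff hA hm hn hd]
    have a1 := S.monx c.1 c.2
    have a2 := S.mony c.1 c.2
    have a3 := S.monx c.1 (c.2 - 1)
    have a4 := S.mony (c.1 - 1) c.2
    have a5 := S.le1 c.1 c.2
    have e1 : (∃ k, Crn N k c) ↔ (N (c.1 - 1) c.2 < N c.1 c.2 ∧ N c.1 (c.2 - 1) < N c.1 c.2) :=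
      ⟨fun ⟨k, h1, h2, h3⟩ => by omega, fun h => ⟨N c.1 c.2, le_rfl, h.1, h.2⟩⟩
    have e2 : (∃ k, Ocn N k c) ↔ (N (c.1 - 1) (c.2 - 1) < N (c.1 - 1) c.2 ∧ N (c.1 - 1) (c.2 - 1) < N c.1 (c.2 - 1)) :=
      ⟨fun ⟨k, h1, h2, h3⟩ => by omega, fun h => ⟨N (c.1 - 1) (c.2 - 1) + 1, by omega, by omega, by omega⟩⟩
    rw [e1, e2]
    generalize N c.1 c.2 = p at *
    generalize N (c.1 - 1) c.2 = q at *
    generalize N c.1 (c.2 - 1) = r at *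
    generalize N (c.1 - 1) (c.2 - 1) = t at *
    clear e1 e2
    have : (p = t ∨ p = t + 1) ∧ (q = t ∨ q = t + 1) ∧ (r = t ∨ r = t + 1) := by omega
    obtain ⟨rfl | rfl, rfl | rfl, rfl | rfl⟩ := this <;> simp <;> omega
  exact ⟨fun h x y => (key (x, y)).1 (h (x, y)), fun h c => (key c).2 (h c.1 c.2)⟩

theorem Sol.bp_set (S : Sol m n A l N) (hA : IsGAP m n A) (hm : 0 < m) (hn : 0 < n)
    (hd : ∀ c ∈ supp A, N c.1 c.2 = d c) (c : Cell) : c ∈ backPostSet A d ↔ ∃ k, BP N k c := by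
  constructor
  · rintro ⟨k, z, ⟨-, h1⟩, ⟨cr, h2, cl, h3, h4, h5, rfl⟩⟩
    have key : ∀ c, c ∈ innerCorners z ↔ Crn N k c := fun c => by rw [h1, S.crn_iff hd]
    have r := (key _).1 h2
    have q := (key _).1 h3
    refine ⟨k, ⟨⟨_, r.1⟩, ?_⟩, ⟨_, q.1⟩, ?_⟩
    · rintro ⟨y, hy⟩
      obtain ⟨c', h6, h7, h8⟩ := S.crn_ex hA hm hn hy
      have h9 := h4 c' ((key _).2 h6)
      have := h6.1.trans ((S.mono h7 h9).trans_lt r.2.1).le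
      have := (S.mono h7 h9); have := h6.1; have := r.2.1; simp only at *; omega
    · rintro ⟨y, hy⟩
      obtain ⟨c', h6, h7, h8⟩ := S.crn_ex hA hm hn hy
      have h9 := h5 c' ((key _).2 h6)
      simp only at *; omega
  · rintro ⟨k, ⟨⟨y, hy⟩, hr⟩, ⟨x, hx⟩, hc⟩
    obtain ⟨z, h1, -⟩ := S.zz_at hA hm hn hd k
    have key : ∀ c, c ∈ innerCorners z ↔ Crn N k c := fun c => by rw [h1.2, S.crn_iff hd]
    have low : ∀ c', Crn N k c' → c.1 ≤ c'.1 ∧ c.2 ≤ c'.2 := fun c' h =>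
      ⟨by by_contra hh; exact hr ⟨c'.2, h.1.trans (S.mono (by omega) le_rfl)⟩,
       by by_contra hh; exact hc ⟨c'.1, h.1.trans (S.mono le_rfl (by omega))⟩⟩
    obtain ⟨c1, h2, h3, h4⟩ := S.crn_ex hA hm hn hy
    obtain ⟨c2, h5, h6, h7⟩ := S.crn_ex hA hm hn hx
    refine ⟨k, z, h1, c1, (key _).2 h2, c2, (key _).2 h5, fun c' h' => ?_, fun c' h' => ?_, ?_⟩
    · have h' := (key _).1 h'
      by_contra hh
      have := (low _ h').1; have := (low _ h2).1
      have := S.mono (show c1.1 ≤ c'.1 by omega) (show c1.2 ≤ c'.2 - 1 by omega)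
      have := h2.1; have := h'.2.2; omega
    · have := (low _ ((key _).1 h')).2; omega
    · have := (low _ h2).1; have := (low _ h5).2
      exact Prod.ext (by simp only; omega) (by simp only; omega)

/-- an enumeration of the back-post corners differs from the canonical one by a shift -/
theorem Sol.bp_shift (S : Sol m n A l N) (hA : IsGAP m n A) (hm : 0 < m) (hn : 0 < n)
    {l' : ℕ} (h : IsStreamEnum m n e l') (he : ∀ c, c ∈ Set.range e ↔ ∃ k, BP N k c) :
    l' = l ∧ ∃ s, ∀ k, BP N k (e (k + s)) := by
  choose g hg using fun i => (he (e i)).1 ⟨i, rfl⟩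
  choose f hf using fun k => (he _).2 ⟨k, (S.bp hA hm hn k).choose_spec⟩
  have hf' : ∀ k, BP N k (e (f k)) := fun k => by rw [hf]; exact (S.bp hA hm hn k).choose_spec
  have E := S.bp_enum hf'
  have hgm : ∀ i, g i + 1 ≤ g (i + 1) := by
    intro i
    by_contra hc
    have h1 := h.2.1 i
    have h2 := S.bp_uniq (hg i) (hf' (g i))
    have h3 := S.bp_uniq (hg (i + 1)) (hf' (g (i + 1)))
    rw [h2, h3] at h1
    rcases eq_or_lt_of_le (show g (i + 1) ≤ g i by omega) with h4 | h4
    · rw [h4] at h1; exact absurd h1.1 (lt_irrefl _)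
    · have := (E.lt h4).1; have := h1.1; omega
  have bpk : ∀ k k' c, BP N k c → BP N k' c → k = k' := by
    intro k k' c h1 h2
    have e1 := S.bp_uniq h1 (hf' k)
    have e2 := S.bp_uniq h2 (hf' k')
    by_contra hc
    rcases lt_or_gt_of_ne hc with h4 | h4
    · have := (E.lt h4).1; simp only [← e1, ← e2] at this; omega
    · have := (E.lt h4).1; simp only [← e1, ← e2] at this; omega
  have hs : ∀ i, g (i + l') = g i + l := by
    intro i
    have h1 := S.bp_tau (hg i)
    rw [h.2.2] at h1
    exact bpk _ _ _ (hg _) h1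
  have hsur : ∀ k, ∃ i, g i = k := fun k => ⟨f k, bpk _ _ _ (hg _) (hf' k)⟩
  have h1 : ∀ i, g (i + 1) = g i + 1 := by
    intro i
    obtain ⟨j, hj⟩ := hsur (g i + 1)
    have a := hgm i
    rcases le_or_gt j i with h2 | h2
    · have := incr_seq hgm h2; omega
    · have := incr_seq hgm (show i + 1 ≤ j by omega); omega
  have h2 : ∀ i, g i = g 0 + i := by
    intro i
    induction i using Int.induction_on with
    | zero => simp
    | succ k ih => rw [h1, ih]; ring
    | pred k ih => have := h1 (-k - 1); rw [sub_add_cancel] at this; omega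
  refine ⟨?_, -g 0, fun k => ?_⟩
  · have := hs 0; rw [h2] at this; simp at this; omega
  · have := hg (k + -g 0); rw [h2] at this; simpa using this

theorem minSol_all (hA : IsGAP m n A) (hm : 0 < m) (hn : 0 < n) {y0 : ℤ} (h : MinSol (Gc y0) m n A l N) (y1 : ℤ) :
    MinSol (Gc y1) m n A l N := by
  obtain ⟨l', N', h1, h2⟩ := minSol_of_sw hA hm hn (sw_of_minSol hA hm hn h)
  obtain rfl := sw_flow hA hn h.s (h2 0).s
  have : N' = N := by
    funext x y
    have a := sol_le_of_supp (s := 0) (h2 0).s h.s (fun c hc => by rw [h1 c hc]; simp) x y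
    have b := sol_le_of_supp (s := 0) h.s (h2 0).s (fun c hc => by rw [h1 c hc]; simp) x y
    omega
  rw [← this]; exact h2 y1

end

/-- one layer of the matrix-ball construction -/
structure Lay (m n : ℕ) (A B : Mat) (l : ℕ) (N : ℤ → ℤ → ℤ) : Prop where
  w : ∀ y0, MinSol (Gc y0) m n A l N
  f : FlatEq A B N

def Chain (m n s : ℕ) (A : ℕ → Mat) (μ : ℕ → ℕ) (N : ℕ → ℤ → ℤ → ℤ) : Prop :=
  (∀ t < s, Lay m n (A t) (A (t + 1)) (μ t) (N t)) ∧ A s = 0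

theorem Chain.gap {m n s : ℕ} {A : ℕ → Mat} {μ : ℕ → ℕ} {N : ℕ → ℤ → ℤ → ℤ} (h : Chain m n s A μ N)
    (hA : IsGAP m n (A 0)) (hm : 0 < m) (hn : 0 < n) : ∀ t ≤ s, IsGAP m n (A t) := by
  intro t
  induction t with
  | zero => exact fun _ => hA
  | succ t ih => exact fun ht => flat_gap (ih (by omega)) ((h.1 t (by omega)).w 0).s (h.1 t (by omega)).f hm hn

/-- stream data in normalized form -/
structure SData (m n : ℕ) (N : ℤ → ℤ → ℤ) (e : ℤ → Cell) (l : ℕ) (a b : ℕ → ℤ) (r₁ r₂ : ℤ) : Prop where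
  bp : ∀ k, BP N k (e k)
  a : ∀ p : ℕ, p < l → a p = (e (r₁ + 1 + p)).1 ∧ 1 ≤ a p ∧ a p ≤ (m : ℤ)
  b : ∀ p : ℕ, p < l → b p = (e (r₂ + 1 + p)).2 ∧ 1 ≤ b p ∧ b p ≤ (n : ℤ)

theorem kappa0_iff {m n : ℕ} {A : Mat} (hA : IsGAP m n A) (hm : 0 < m) (hn : 0 < n) {s : ℕ} {μ : ℕ → ℕ}
    {P Q : ℕ → ℕ → ℤ} {ρ : ℕ → ℤ} : Kappa0Rel m n A s μ P Q ρ ↔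
    ∃ Aseq N, Aseq 0 = A ∧ Chain m n s Aseq μ N ∧ ∀ t < s, ∃ e r₁ r₂,
      SData m n (N t) e (μ t) (fun x => P x t) (fun x => Q x t) r₁ r₂ ∧ ρ t = r₁ - r₂ := by
  constructor
  · rintro ⟨As, ⟨h0, -, h1, h2⟩, h3⟩
    subst h0
    have gap : ∀ t ≤ s, IsGAP m n (As t) := by
      intro t
      induction t with
      | zero => exact fun _ => hA
      | succ t ih =>
        intro ht
        obtain ⟨d, g1, g2⟩ := h2 t (by omega)
        obtain ⟨l, N, f1, f2⟩ := minSol_of_sw (ih (by omega)) hm hn g1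
        exact flat_gap (ih (by omega)) (f2 0).s (((f2 0).s.flat_iff (ih (by omega)) hm hn f1).1 g2) hm hn
    have key : ∀ t, ∃ N, t < s → (Lay m n (As t) (As (t + 1)) (μ t) N ∧ ∃ e r₁ r₂,
      SData m n N e (μ t) (fun x => P x t) (fun x => Q x t) r₁ r₂ ∧ ρ t = r₁ - r₂) := by
      intro t
      by_cases ht : t < s
      swap
      · exact ⟨fun _ _ => 0, fun h => absurd h ht⟩
      have hG := gap t ht.le
      obtain ⟨d, e, g1, g2, g3, r₁, r₂, g4, g5, g6⟩ := h3 t ht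
      obtain ⟨d2, k1, k2⟩ := h2 t ht
      obtain ⟨l, N, f1, f2⟩ := minSol_of_sw hG hm hn g1
      obtain ⟨l2, N2, q1, q2⟩ := minSol_of_sw hG hm hn k1
      obtain rfl := sw_flow hG hn (f2 0).s (q2 0).s
      obtain ⟨c, hc⟩ := sw_shift hG hm hn (f2 0) (q2 0)
      have hf := ((q2 0).s.flat_iff hG hm hn q1).1 k2
      obtain ⟨rfl, u, hu⟩ := (f2 0).s.bp_shift hG hm hn g2 (fun c => by rw [g3, (f2 0).s.bp_set hG hm hn f1])
      refine ⟨N, fun _ => ⟨⟨f2, fun x y => ?_⟩, fun k => e (k + u), r₁ - u, r₂ - u, ⟨hu, ?_, ?_⟩, by rw [g6]; ring⟩⟩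
      · have := hf x y; simp only [hc] at this; linarith
      · intro p hp; have := g4 p hp
        rwa [show r₁ - u + 1 + p + u = r₁ + 1 + p by ring]
      · intro p hp; have := g5 p hp
        rwa [show r₂ - u + 1 + p + u = r₂ + 1 + p by ring]
    choose N hN using key
    exact ⟨As, N, rfl, ⟨fun t ht => (hN t ht).1, h1⟩, fun t ht => (hN t ht).2⟩
  · rintro ⟨As, N, rfl, hC, h⟩
    have gap := hC.gap hA hm hn
    refine ⟨As, ⟨rfl, fun t ht h0 => ?_, hC.2, fun t ht => ?_⟩, fun t ht => ?_⟩
    · obtain ⟨a, _, b, _, h1, _⟩ := ((hC.1 t ht).w 0).s.att 0 0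
      rw [h0] at h1; exact h1 rfl
    · have L := hC.1 t ht
      exact ⟨_, sw_of_minSol (gap t ht.le) hm hn (L.w 0), ((L.w 0).s.flat_iff (gap t ht.le) hm hn fun _ _ => rfl).2 L.f⟩
    · have L := hC.1 t ht
      obtain ⟨e, r₁, r₂, D, hr⟩ := h t ht
      refine ⟨_, e, sw_of_minSol (gap t ht.le) hm hn (L.w 0), (L.w 0).s.bp_enum D.bp, ?_, r₁, r₂, D.a, D.b, hr⟩
      ext c
      rw [(L.w 0).s.bp_set (gap t ht.le) hm hn fun _ _ => rfl]
      exact ⟨fun ⟨k, hk⟩ => ⟨k, hk ▸ D.bp k⟩, fun ⟨k, hk⟩ => ⟨k, (L.w 0).s.bp_uniq (D.bp k) hk⟩⟩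

section
variable {m n l s : ℕ} {A A' B B' : Mat} {N N' : ℤ → ℤ → ℤ} {i j : ℤ} {D : ℤ → ℤ}

theorem flat_ex (S : Sol m n A l N) : ∃ B, FlatEq A B N := by
  have : ∀ x y, ∃ b : ℕ, (b : ℤ) + N x y + N (x - 1) (y - 1) = A x y + N (x - 1) y + N x (y - 1) := by
    intro x y
    have key : 0 ≤ (A x y : ℤ) + N (x - 1) y + N x (y - 1) - N x y - N (x - 1) (y - 1) := by
      have h1 := S.monx x y
      have h2 := S.mony x y
      have h3 := S.mony (x - 1) y
      have h4 := S.monx x (y - 1)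
      have h5 := S.le1 x y
      by_cases hc : N (x - 1) y < N x y ∧ N x (y - 1) < N x y
      · have := (S.crn_iff (d := fun c => N c.1 c.2) (fun _ _ => rfl) (N x y) (x, y)).2 ⟨le_refl _, hc.1, hc.2⟩
        have h6 : A x y ≠ 0 := this.1.1
        omega
      · omega
    exact ⟨_, by rw [Int.toNat_of_nonneg key]; ring⟩
  choose B hB using this
  exact ⟨B, hB⟩

/-- one layer, relative to a gauge -/
def GLay (G : (ℤ → ℤ → ℤ) → ℤ → Prop) (m n : ℕ) (A B : Mat) (l : ℕ) (N : ℤ → ℤ → ℤ) : Prop :=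
  MinSol G m n A l N ∧ FlatEq A B N

def GChain (G : (ℤ → ℤ → ℤ) → ℤ → Prop) (m n s : ℕ) (A : ℕ → Mat) (μ : ℕ → ℕ) (N : ℕ → ℤ → ℤ → ℤ) : Prop :=
  (∀ t < s, GLay G m n (A t) (A (t + 1)) (μ t) (N t)) ∧ A s = 0

def ES (i : ℤ) (s : ℕ) (N : ℕ → ℤ → ℤ → ℤ) (E : ℕ → ℤ) : Prop :=
  (∀ t, s ≤ t → E t = 0) ∧ ∀ t < s, E (t + 1) = E t + (if HasR (N t) i then 1 else 0)
    - (if HasR (N t) (i + 1) then 1 else 0)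

variable {G : (ℤ → ℤ → ℤ) → ℤ → Prop} {μ : ℕ → ℕ} {E : ℕ → ℤ}

theorem es_ex (i : ℤ) (s : ℕ) (N : ℕ → ℤ → ℤ → ℤ) : ∃ E, ES i s N E := by
  induction s generalizing N with
  | zero => exact ⟨fun _ => 0, fun _ _ => rfl, fun t h => absurd h (by omega)⟩
  | succ s ih =>
    obtain ⟨E, h1, h2⟩ := ih fun t => N (t + 1)
    refine ⟨fun t => Nat.casesOn t (E 0 - (if HasR (N 0) i then 1 else 0) + (if HasR (N 0) (i + 1) then 1 else 0)) E, ?_, ?_⟩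
    · rintro (_ | t) h
      · omega
      · exact h1 t (by omega)
    · rintro (_ | t) h
      · show E 0 = _ - _ + _ + _ - _; ring
      · exact h2 t (by omega)

theorem ES.tail {N : ℕ → ℤ → ℤ → ℤ} (h : ES i (s + 1) N E) : ES i s (fun t => N (t + 1)) (fun t => E (t + 1)) :=
  ⟨fun t ht => h.1 (t + 1) (by omega), fun t ht => h.2 (t + 1) (by omega)⟩

theorem ES.uniq {N : ℕ → ℤ → ℤ → ℤ} {E E' : ℕ → ℤ} (h : ES i s N E) (h' : ES i s N E') (t : ℕ) : E t = E' t := by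
  by_cases ht : s ≤ t
  · rw [h.1 t ht, h'.1 t ht]
  · have : ∀ r : ℕ, r ≤ s → E (s - r) = E' (s - r) := by
      intro r
      induction r with
      | zero => intro _; rw [h.1 _ (by omega), h'.1 _ (by omega)]
      | succ r ih =>
        intro hr
        have a := h.2 (s - (r + 1)) (by omega)
        have b := h'.2 (s - (r + 1)) (by omega)
        rw [show s - (r + 1) + 1 = s - r by omega] at a b
        have := ih (by omega)
        linarith
    have := this (s - t) (by omega)
    rwa [show s - (s - t) = t by omega] at this

theorem GChain.tail {A : ℕ → Mat} {N : ℕ → ℤ → ℤ → ℤ} (h : GChain G m n (s + 1) A μ N) :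
    GChain G m n s (fun t => A (t + 1)) (fun t => μ (t + 1)) (fun t => N (t + 1)) :=
  ⟨fun t ht => h.1 (t + 1) (by omega), h.2⟩

theorem GLay.gap (h : GLay G m n A B l N) (hA : IsGAP m n A) (hm : 0 < m) (hn : 0 < n) : IsGAP m n B :=
  flat_gap hA h.1.s h.2 hm hn

theorem isD_zero (h : IsD (fun _ => 0 : ℤ → ℕ) (fun _ => 0 : ℤ → ℕ) D) (y : ℤ) : D y = 0 := by
  have := h.uniq (D' := fun _ => 0) ⟨fun y => by simp, 0, fun _ _ => rfl⟩
  rw [this]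

theorem chain_lim (hm : 0 < m) (hn : 0 < n) (s : ℕ) : ∀ {A : ℕ → Mat} {μ : ℕ → ℕ} {N : ℕ → ℤ → ℤ → ℤ} {E : ℕ → ℤ} {D : ℤ → ℤ},
    GChain G m n s A μ N → IsGAP m n (A 0) → ES i s N E → IsD (A 0 i) (A 0 (i + 1)) D →
    Lim D (E 0) ∧ ∀ T, (∀ y, D y ≤ T) → ∀ t, E t ≤ T := by
  induction s with
  | zero =>
    intro A μ N E D hC hA hE hD
    have h0 : A 0 = 0 := hC.2
    rw [h0] at hD
    have hz := isD_zero hD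
    refine ⟨⟨0, fun y _ => by rw [hz, hE.1 0 le_rfl]⟩, fun T hT t => ?_⟩
    have := hT 0; rw [hz] at this; rw [hE.1 t (by omega)]; exact this
  | succ s ih =>
    intro A μ N E D hC hA hE hD
    have L := hC.1 0 (by omega)
    have hD1 := flD_isD L.1.s hA hm hn hD L.2
    obtain ⟨l1, b1⟩ := ih hC.tail (L.gap hA hm hn) hE.tail hD1
    have e0 := hE.2 0 (by omega)
    have hE0 : Lim D (E 0) := by
      obtain ⟨E', hE'⟩ : ∃ E', Lim D E' := by
        obtain ⟨Y, hY⟩ := hA.bdY hm hn (i + 1)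
        refine ⟨D (Y + 1), Y + 1, fun y hy => ?_⟩
        refine int_up (P := fun y => D y = D (Y + 1)) rfl (fun y hy h => ?_) y hy
        have h1 := hD.1 y
        have h2 : A 0 (i + 1) y = 0 := by by_contra hc; have := hY (i + 1) le_rfl y hc; omega
        have h3 : A 0 i (y - 1) = 0 := by by_contra hc; have := hY i (by omega) (y - 1) hc; omega
        simp only [h2, h3] at h1; show D y = _; omega
      have := (lim_flat (i := i) L.1.s hA hm hn hE').uniq l1
      have : E 0 = E' := by simp only [zero_add] at this e0; omega
      rw [this]; exact hE'
    refine ⟨hE0, fun T hT t => ?_⟩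
    rcases t with _ | t
    · obtain ⟨Y, hY⟩ := hE0; rw [← hY Y le_rfl]; exact hT Y
    · exact b1 T (flD_le L.1.s hA hm hn hD hT) t

structure Res (m : ℕ) (i : ℤ) (s : ℕ) (μ : ℕ → ℕ) (N N' : ℕ → ℤ → ℤ → ℤ) (t₀ : ℕ) : Prop where
  lt : t₀ < s
  same : ∀ t < s, t ≠ t₀ → ∀ k x, Rg (N' t) k x ↔ Rg (N t) k x
  ch : ∃ K, Rg (N t₀) K i ∧ ¬ Rg (N t₀) K (i - 1) ∧ (∀ k, Rg (N t₀) k (i + 1) → Rg (N t₀) k i) ∧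
      ∀ k x, Rg (N' t₀) k x ↔ Rg (N t₀) k x ∧ ¬ ∃ q : ℤ, x = i + q * m ∧ k = K + q * μ t₀
  col : ∀ t < s, ∀ k y, Gc y (N' t) k ↔ Gc y (N t) k

structure Two (G : (ℤ → ℤ → ℤ) → ℤ → Prop) (m n : ℕ) (i : ℤ) (s : ℕ) (μ : ℕ → ℕ) (M : ℤ) (A A' : ℕ → Mat)
    (N N' : ℕ → ℤ → ℤ → ℤ) (t₀ : ℕ) : Prop where
  c : GChain G m n s A μ N
  c' : GChain G m n s A' μ N'
  r : Res m i s μ N N' t₀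
  e1 : ∀ E, ES i s N E → ∀ t ≤ t₀, E t < M
  e2 : ∀ E, ES i s N E → E (t₀ + 1) = M
  e3 : ∀ E, ES i s N E → ∀ t, E t ≤ M

def cns {α : Type} (a : α) (f : ℕ → α) : ℕ → α := fun t => Nat.casesOn t a f

theorem GChain.cons {A : ℕ → Mat} {N1 : ℕ → ℤ → ℤ → ℤ} (h : GChain G m n s A (fun t => μ (t + 1)) N1)
    (L : GLay G m n B (A 0) (μ 0) N) : GChain G m n (s + 1) (cns B A) μ (cns N N1) := by
  refine ⟨?_, h.2⟩
  rintro (_ | t) ht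
  · exact L
  · exact h.1 t (by omega)

theorem cns_eta {α : Type} (f : ℕ → α) : cns (f 0) (fun t => f (t + 1)) = f := by
  funext t; cases t <;> rfl

theorem two_step (hm : 2 ≤ m) (hn : 0 < n) (s : ℕ) (h : FRel m n i j D A A') (hA : IsGAP m n A)
    (c : Cpl m n i j (μ 0) D A A' N N') (f : GLay G m n A B (μ 0) N) (f' : GLay G m n A' B' (μ 0) N')
    (dir : Bool) (As : ℕ → Mat) (Ns : ℕ → ℤ → ℤ → ℤ) (hC : GChain G m n s As (fun t => μ (t + 1)) Ns)
    (h0 : As 0 = if dir then B else B')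
    (ih : ∀ {u D1}, FRel m n i u D1 B B' → ∃ Bs Bs' N1 N1' t₀, Bs 0 = B ∧ Bs' 0 = B' ∧
      Two G m n i s (fun t => μ (t + 1)) (D1 u) Bs Bs' N1 N1' t₀ ∧
        (if dir then Bs = As ∧ N1 = Ns else Bs' = As ∧ N1' = Ns)) :
    ∃ Bs Bs' N1 N1' t₀, Bs 0 = A ∧ Bs' 0 = A' ∧ Two G m n i (s + 1) μ (D j) Bs Bs' N1 N1' t₀ ∧
      (if dir then Bs = cns A As ∧ N1 = cns N Ns else Bs' = cns A' As ∧ N1' = cns N' Ns) := by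
  have hm0 : 0 < m := by omega
  have hA1 : IsGAP m n B := f.gap hA hm0 hn
  rcases one_step h hA hm hn c f.2 f'.2 with ⟨u, h1, h2, h3⟩ | ⟨rfl, h2, K, k1, k2, k3, k4⟩
  · obtain ⟨Bs, Bs', N1, N1', t₀, q1, q2, T, hd⟩ := ih h1
    subst q1 q2
    have CC := T.c.cons f
    have lim : ∀ E, ES i (s + 1) (cns N N1) E → E 0 < D j := by
      intro E hE
      obtain ⟨⟨Y, hY⟩, -⟩ := chain_lim hm0 hn _ CC hA hE h.isD
      have a := hY (max Y (j + 1)) (le_max_left _ _)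
      have b := h.top.1 (max Y (j + 1)) (by have := le_max_right Y (j + 1); omega)
      rw [← a]; exact b
    refine ⟨cns A Bs, cns A' Bs', cns N N1, cns N' N1', t₀ + 1, rfl, rfl, ⟨CC, T.c'.cons f', ⟨?_, ?_, T.r.ch, ?_⟩, ?_, ?_, ?_⟩, ?_⟩
    · have := T.r.lt; omega
    · rintro (_ | t) ht ht0
      · exact h3
      · exact T.r.same t (by omega) (by omega)
    · rintro (_ | t) ht k y
      · exact c.colg hm k y
      · exact T.r.col t (by omega) k y
    · rintro E hE (_ | t) ht
      · exact lim E hE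
      · have := T.e1 _ hE.tail t (by omega); rwa [h2] at this
    · intro E hE
      have := T.e2 _ hE.tail; rwa [h2] at this
    · rintro E hE (_ | t)
      · exact (lim E hE).le
      · have := T.e3 _ hE.tail t; rwa [h2] at this
    · cases dir
      · simp only [Bool.false_eq_true, if_false] at hd ⊢; rw [hd.1, hd.2]; exact ⟨rfl, rfl⟩
      · simp only [if_true] at hd ⊢; rw [hd.1, hd.2]; exact ⟨rfl, rfl⟩
  · have h0 : As 0 = B' := by rw [h0]; split <;> rfl
    subst h0
    have CC := hC.cons f
    have key : ∀ E, ES i (s + 1) (cns N Ns) E → E 0 < D j ∧ E 1 = D j ∧ ∀ t, E t ≤ D j := by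
      intro E hE
      obtain ⟨⟨Y, hY⟩, bd⟩ := chain_lim hm0 hn _ CC hA hE h.isD
      have a := hY (max Y (j + 1)) (le_max_left _ _)
      have b := h.top.1 (max Y (j + 1)) (by have := le_max_right Y (j + 1); omega)
      refine ⟨by rw [← a]; exact b, ?_, bd _ h.top.2⟩
      exact (chain_lim hm0 hn _ hC hA1 hE.tail (flD_isD c.s hA hm0 hn h.isD f.2)).1.uniq h2
    refine ⟨cns A As, cns A' As, cns N Ns, cns N' Ns, 0, rfl, rfl, ⟨CC, hC.cons f', ⟨by omega, ?_, ⟨K, k1, k2, k3, k4⟩, ?_⟩, ?_, ?_, ?_⟩, ?_⟩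
    · rintro (_ | t) ht ht0
      · omega
      · exact fun _ _ => Iff.rfl
    · rintro (_ | t) ht k y
      · exact c.colg hm k y
      · exact Iff.rfl
    · intro E hE t ht
      obtain rfl : t = 0 := by omega
      exact (key E hE).1
    · exact fun E hE => (key E hE).2.1
    · exact fun E hE => (key E hE).2.2
    · cases dir <;> simp

theorem frel_ne (h : FRel m n i j D A A') (hm : 2 ≤ m) : A ≠ 0 ∧ A' ≠ 0 := by
  constructor
  · intro h0
    have h1 := h.isD; rw [h0] at h1
    have hz := isD_zero h1
    have := h.top.1 (j + 1) (by omega)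
    rw [hz, hz] at this; omega
  · intro h0
    have := congrFun (congrFun (h0 ▸ h.eq) (i + 1)) j
    rw [sa_i1 hm] at this
    simp at this

theorem multi (hG : GInv m n i G) (hm : 2 ≤ m) (hn : 0 < n) (dir : Bool) (s : ℕ) : ∀ {μ : ℕ → ℕ} {A A' : Mat} {j : ℤ} {D : ℤ → ℤ},
    FRel m n i j D A A' → IsGAP m n A → ∀ (As : ℕ → Mat) (Ns : ℕ → ℤ → ℤ → ℤ), GChain G m n s As μ Ns →
    (As 0 = if dir then A else A') →
    ∃ Bs Bs' N1 N1' t₀, Bs 0 = A ∧ Bs' 0 = A' ∧ Two G m n i s μ (D j) Bs Bs' N1 N1' t₀ ∧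
      (if dir then Bs = As ∧ N1 = Ns else Bs' = As ∧ N1' = Ns) := by
  induction s with
  | zero =>
    intro μ A A' j D h hA As Ns hC h0
    exfalso
    have := frel_ne h hm
    have h1 : As 0 = 0 := hC.2
    rw [h1] at h0
    cases dir
    · exact this.2 h0.symm
    · exact this.1 h0.symm
  | succ s ih =>
    intro μ A A' j D h hA As Ns hC h0
    have L := hC.1 0 (by omega)
    cases dir
    · simp only [Bool.false_eq_true, if_false] at h0 ih ⊢
      rw [h0] at L
      obtain ⟨N, c⟩ := couple2 h hA hm hn L.1.s
      have W := min_transfer' hG h hA hm hn c L.1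
      obtain ⟨B, f⟩ := flat_ex W.s
      have := two_step hm hn s h hA c ⟨W, f⟩ L false _ _ hC.tail rfl fun hF => by
        have := ih hF (flat_gap hA W.s f (by omega) hn) _ _ hC.tail rfl
        simpa using this
      rw [← h0, cns_eta, cns_eta] at this
      simpa [h0] using this
    · simp only [if_true] at h0 ih ⊢
      rw [h0] at L
      obtain ⟨N', c⟩ := couple1 h hA hm hn L.1.s
      have W := min_transfer hG h hA hm hn c L.1
      obtain ⟨B', f⟩ := flat_ex W.s
      have := two_step hm hn s h hA c L ⟨W, f⟩ true _ _ hC.tail rfl fun hF => by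
        have := ih hF (L.gap hA (by omega) hn) _ _ hC.tail rfl
        simpa using this
      rw [← h0, cns_eta, cns_eta] at this
      simpa [h0] using this

end

section
variable {m n l s : ℕ} {A A' B B' : Mat} {i j : ℤ} {D : ℤ → ℤ}

theorem last_max (D : ℤ → ℤ) {a b : ℤ} (h : a ≤ b) : ∃ z, a ≤ z ∧ z ≤ b ∧
    (∀ y, a ≤ y → y ≤ b → D y ≤ D z) ∧ ∀ y, z < y → y ≤ b → D y < D z := by
  refine int_up (P := fun b => ∃ z, a ≤ z ∧ z ≤ b ∧ (∀ y, a ≤ y → y ≤ b → D y ≤ D z) ∧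
    ∀ y, z < y → y ≤ b → D y < D z) ?_ ?_ b h
  · refine ⟨a, le_rfl, le_rfl, fun y h1 h2 => ?_, fun y h1 h2 => by omega⟩
    rw [show y = a by omega]
  · rintro y hy ⟨z, h1, h2, h3, h4⟩
    by_cases hc : D z ≤ D y
    · refine ⟨y, by omega, le_rfl, fun w hw hw2 => ?_, fun w hw hw2 => by omega⟩
      by_cases hwy : w = y
      · rw [hwy]
      · exact (h3 w hw (by omega)).trans hc
    · refine ⟨z, h1, by omega, fun w hw hw2 => ?_, fun w hw hw2 => ?_⟩
      · by_cases hwy : w = y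
        · rw [hwy]; omega
        · exact h3 w hw (by omega)
      · by_cases hwy : w = y
        · rw [hwy]; omega
        · exact h4 w hw (by omega)

theorem first_max (D : ℤ → ℤ) {a b : ℤ} (h : a ≤ b) : ∃ z, a ≤ z ∧ z ≤ b ∧
    (∀ y, a ≤ y → y ≤ b → D y ≤ D z) ∧ ∀ y, a ≤ y → y < z → D y < D z := by
  obtain ⟨z, h1, h2, h3, h4⟩ := last_max (fun y => D (-y)) (neg_le_neg h)
  refine ⟨-z, by omega, by omega, fun y a1 a2 => ?_, fun y a1 a2 => ?_⟩
  · have := h3 (-y) (by omega) (by omega); simpa using this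
  · have := h4 (-y) (by omega) (by omega); simpa using this

theorem isD_ex (hA : IsGAP m n A) (hm : 0 < m) (hn : 0 < n) (i : ℤ) : ∃ D, IsD (A i) (A (i + 1)) D := by
  obtain ⟨Y, hY⟩ := hA.bdYl hm hn i
  have z1 : ∀ y, y < Y → A i y = 0 := fun y hy => by by_contra hc; have := hY i le_rfl y hc; omega
  have z2 : ∀ y, y < Y → A (i + 1) y = 0 := fun y hy => by by_contra hc; have := hY (i + 1) (by omega) y hc; omega
  refine ⟨fun y => ∑ t ∈ Finset.Ioc (Y - 1) y, ((A (i + 1) t : ℤ) - A i (t - 1)), fun y => ?_, Y - 1, fun y hy => ?_⟩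
  · by_cases hy : Y ≤ y
    · have : Finset.Ioc (Y - 1) y = insert y (Finset.Ioc (Y - 1) (y - 1)) := by
        ext t; simp only [Finset.mem_Ioc, Finset.mem_insert]; omega
      simp only
      rw [this, Finset.sum_insert (by simp)]; ring
    · simp only
      rw [Finset.Ioc_eq_empty (by omega), Finset.Ioc_eq_empty (by omega), z1 _ (by omega), z2 _ (by omega)]; simp
  · simp only; rw [Finset.Ioc_eq_empty (by omega)]; simp

theorem isD_lim (hD : IsD (A i) (A (i + 1)) D) (hA : IsGAP m n A) (hm : 0 < m) (hn : 0 < n) : ∃ E, Lim D E := by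
  obtain ⟨Y, hY⟩ := hA.bdY hm hn (i + 1)
  refine ⟨D (Y + 1), Y + 1, fun y hy => ?_⟩
  refine int_up (P := fun y => D y = D (Y + 1)) rfl (fun y hy h => ?_) y hy
  have h1 := hD.1 y
  have h2 : A (i + 1) y = 0 := by by_contra hc; have := hY (i + 1) le_rfl y hc; omega
  have h3 : A i (y - 1) = 0 := by by_contra hc; have := hY i (by omega) (y - 1) hc; omega
  simp only [h2, h3] at h1; show D y = _; omega

theorem dsum {X1 X2 : ℤ → ℕ} (hD : IsD X1 X2 D) {y y' : ℤ} (h : y ≤ y') :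
    D y' + (∑ t ∈ Finset.Ico y y', X1 t : ℕ) = D y + (∑ t ∈ Finset.Ioc y y', X2 t : ℕ) := by
  refine int_up (P := fun y' => D y' + (∑ t ∈ Finset.Ico y y', X1 t : ℕ) = D y + (∑ t ∈ Finset.Ioc y y', X2 t : ℕ))
    (by simp) (fun z hz ih => ?_) y' h
  have e1 : Finset.Ioc y z = insert z (Finset.Ioc y (z - 1)) := by
    ext t; simp only [Finset.mem_Ioc, Finset.mem_insert]; omega
  have e2 : Finset.Ico y z = insert (z - 1) (Finset.Ico y (z - 1)) := by
    ext t; simp only [Finset.mem_Ico, Finset.mem_insert]; omega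
  have := hD.1 z
  rw [e1, e2, Finset.sum_insert (by simp), Finset.sum_insert (by simp)]
  push_cast at ih ⊢
  linarith

theorem survPlus_iff (hD : IsD (A i) (A (i + 1)) D) (j : ℤ) : SurvPlus A i j ↔ ∀ y, j < y → D y < D j := by
  have key : ∀ y, j < y → (D y < D j ↔ (∑ t ∈ Finset.Ioc j y, A (i + 1) t) < A i j + ∑ t ∈ Finset.Ioo j y, A i t) := by
    intro y hy
    have h1 := dsum hD hy.le
    have e : Finset.Ico j y = insert j (Finset.Ioo j y) := by
      ext t; simp only [Finset.mem_Ico, Finset.mem_Ioo, Finset.mem_insert]; omega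
    rw [e, Finset.sum_insert (by simp)] at h1
    omega
  constructor
  · rintro ⟨h1, h2⟩ y hy
    rw [key y hy]; have := h2 y hy; omega
  · intro h
    have h0 : 0 < A i j := by
      have a := hD.1 (j + 1); have b := h (j + 1) (by omega)
      rw [add_sub_cancel_right] at a; omega
    refine ⟨h0, fun y hy => ?_⟩
    have := (key y hy).1 (h y hy); omega

theorem survMinus_iff (hD : IsD (A i) (A (i + 1)) D) (j : ℤ) : SurvMinus A i j ↔ ∀ y, y < j → D y < D j := by
  have key : ∀ y, y < j → (D y < D j ↔ (∑ t ∈ Finset.Ico y j, A i t) < A (i + 1) j + ∑ t ∈ Finset.Ioo y j, A (i + 1) t) := by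
    intro y hy
    have h1 := dsum hD hy.le
    have e : Finset.Ioc y j = insert j (Finset.Ioo y j) := by
      ext t; simp only [Finset.mem_Ioc, Finset.mem_Ioo, Finset.mem_insert]; omega
    rw [e, Finset.sum_insert (by simp)] at h1
    omega
  constructor
  · rintro ⟨h1, h2⟩ y hy
    rw [key y hy]; have := h2 y hy; omega
  · intro h
    have h0 : 0 < A (i + 1) j := by
      have a := hD.1 j; have b := h (j - 1) (by omega)
      omega
    refine ⟨h0, fun y hy => ?_⟩
    have := (key y hy).1 (h y hy); omega

theorem fMat_some (hA : IsGAP m n A) (hm : 2 ≤ m) (hn : 0 < n) (h : fMat m n i A = some A') :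
    ∃ D j, FRel m n i j D A A' := by
  obtain ⟨D, hD⟩ := isD_ex hA (by omega) hn i
  unfold fMat at h
  split at h
  · rename_i hx
    obtain ⟨h1, h2⟩ := hx.choose_spec
    set j := hx.choose
    rw [survPlus_iff hD] at h1
    refine ⟨D, j, hD, ⟨h1, fun y => ?_⟩, (Option.some.inj h).symm⟩
    by_contra hc
    have hy : y < j := by
      by_contra hy
      rcases (not_lt.1 hy).lt_or_eq with hy | hy
      · exact hc (h1 y hy).le
      · exact hc (by rw [← hy])
    obtain ⟨z, z1, z2, z3, z4⟩ := last_max D (show y ≤ j - 1 by omega)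
    have z5 := z3 y le_rfl (by omega)
    have := h2 z ((survPlus_iff hD z).2 fun w hw => by
      by_cases hwj : w ≤ j - 1
      · exact z4 w hw hwj
      · rcases (show j ≤ w by omega).lt_or_eq with hy | hy
        · have := h1 w hy; omega
        · rw [← hy]; omega)
    omega
  · simp at h

theorem fMat_none (hA : IsGAP m n A) (hm : 2 ≤ m) (hn : 0 < n) (h : fMat m n i A = none) :
    ∃ D E, IsD (A i) (A (i + 1)) D ∧ Lim D E ∧ ∀ y, D y ≤ E := by
  obtain ⟨D, hD⟩ := isD_ex hA (by omega) hn i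
  obtain ⟨E, hE⟩ := isD_lim hD hA (by omega) hn
  refine ⟨D, E, hD, hE, fun y => ?_⟩
  unfold fMat at h
  split at h
  · simp at h
  · rename_i hx
    by_contra hc
    apply hx
    obtain ⟨Y, hY⟩ := hE
    obtain ⟨Y0, hY0⟩ := hD.2
    apply least_int
    · obtain ⟨z, z1, z2, z3, z4⟩ := last_max D (le_max_left y Y)
      have z5 := z3 y le_rfl (le_max_left _ _)
      refine ⟨z, (survPlus_iff hD z).2 fun w hw => ?_⟩
      by_cases hwj : w ≤ max y Y
      · exact z4 w hw hwj
      · rw [hY w (by have := le_max_right y Y; omega)]; omega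
    · refine ⟨Y0, fun x hx => ?_⟩
      by_contra hc2
      have := (survPlus_iff hD x).1 hx (x + 1) (by omega)
      rw [hY0 _ (by omega), hY0 _ (by omega)] at this; omega

theorem sa_e1 (hm : 2 ≤ m) : subAddAt m n (i + 1) i j A (i + 1) = fun y => if y = j then A (i + 1) y - 1 else A (i + 1) y := by
  funext y
  have h1 : (∃ k : ℤ, i + 1 = i + 1 + k * m ∧ y = j + k * n) ↔ y = j := by
    refine ⟨fun ⟨k, h, h'⟩ => ?_, fun h => ⟨0, by simp, by simpa using h⟩⟩
    have : k = 0 := keq hm (i := i) (by linarith)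
    simp [h', this]
  have h2 : ¬ ∃ k : ℤ, i + 1 = i + k * m ∧ y = j + k * n := by
    rintro ⟨k, h, _⟩; exact ne1 hm i k 0 (by linarith)
  simp only [subAddAt, h1, if_neg h2]

theorem sa_e (hm : 2 ≤ m) :
    subAddAt m n (i + 1) i j A i = fun y => if y = j then A i y + 1 else A i y := by
  funext y
  have h1 : (∃ k : ℤ, i = i + k * m ∧ y = j + k * n) ↔ y = j := by
    refine ⟨fun ⟨k, h, h'⟩ => ?_, fun h => ⟨0, by simp, by simpa using h⟩⟩
    have : k = 0 := keq hm (i := i) (by linarith)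
    simp [h', this]
  have h2 : ¬ ∃ k : ℤ, i = i + 1 + k * m ∧ y = j + k * n := by
    rintro ⟨k, h, _⟩; exact ne1 hm i 0 k (by linarith)
  simp only [subAddAt, h1, if_neg h2]

theorem eMat_some (hA : IsGAP m n A') (hm : 2 ≤ m) (hn : 0 < n) (h : eMat m n i A' = some A) :
    IsGAP m n A ∧ ∃ D j, FRel m n i j D A A' := by
  obtain ⟨D, hD⟩ := isD_ex hA (by omega) hn i
  unfold eMat at h
  split at h
  · rename_i hx
    obtain ⟨h1, h2⟩ := hx.choose_spec
    set j := hx.choose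
    have h0 := h1.1
    rw [survMinus_iff hD] at h1
    have h := (Option.some.inj h).symm
    have top : ∀ y, D y ≤ D j := by
      intro y
      by_contra hc
      have hy : j < y := by
        by_contra hy
        rcases (not_lt.1 hy).lt_or_eq with hy | hy
        · exact hc (h1 y hy).le
        · exact hc (by rw [hy])
      obtain ⟨z, z1, z2, z3, z4⟩ := first_max D (show j + 1 ≤ y by omega)
      have z5 := z3 y (by omega) le_rfl
      have := h2 z ((survMinus_iff hD z).2 fun w hw => by
        by_cases hwj : j + 1 ≤ w
        · exact z4 w hwj hw
        · rcases (show w ≤ j by omega).lt_or_eq with hy | hy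
          · have := h1 w hy; omega
          · rw [hy]; omega)
      omega
    have hi : A i = fun y => if y = j then A' i y + 1 else A' i y := by rw [h, sa_e hm]
    have hi1 : A (i + 1) = fun y => if y = j then A' (i + 1) y - 1 else A' (i + 1) y := by rw [h, sa_e1 hm]
    refine ⟨h ▸ sa_gap hn hA, fun y => if y < j then D y else if y = j then D y - 1 else D y - 2, j, ⟨?_, ?_, ?_⟩⟩
    · refine ⟨fun y => ?_, ?_⟩
      · have a := hD.1 y
        rw [hi, hi1]
        rcases lt_trichotomy y j with hy | rfl | hy
        · simp only [if_pos hy, if_neg hy.ne, if_pos (show y - 1 < j by omega), if_neg (show ¬ y - 1 = j by omega)]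
          exact a
        · simp only [if_true, lt_irrefl, if_false, if_pos (show j - 1 < j by omega), if_neg (show ¬ j - 1 = j by omega)]
          omega
        · simp only [if_neg (show ¬ y < j by omega), if_neg (show ¬ y = j by omega), if_neg (show ¬ y - 1 < j by omega)]
          by_cases hy1 : y - 1 = j
          · simp only [if_pos hy1]; push_cast; omega
          · simp only [if_neg hy1]; omega
      · obtain ⟨Y, hY⟩ := hD.2
        refine ⟨min Y (j - 1), fun y hy => ?_⟩
        have := min_le_left Y (j - 1); have := min_le_right Y (j - 1)
        simp only [if_pos (show y < j by omega)]
        exact hY y (by omega)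
    · constructor
      · intro y hy
        have := top y
        simp only [if_neg (show ¬ y < j by omega), if_neg (show ¬ y = j by omega), lt_irrefl, if_true, if_false]
        omega
      · intro y
        simp only [lt_irrefl, if_true, if_false]
        rcases lt_trichotomy y j with hy | rfl | hy
        · have := h1 y hy
          simp only [if_pos hy]; omega
        · simp
        · have := top y
          simp only [if_neg (show ¬ y < j by omega), if_neg (show ¬ y = j by omega)]; omega
    · apply per_ext (i := i) hA.1 (sa_per (h ▸ sa_gap hn hA : IsGAP m n A).1)
      · rw [sa_i hm, hi]; funext y
        by_cases hy : y = j <;> simp [hy]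
      · rw [sa_i1 hm, hi1]; funext y
        by_cases hy : y = j
        · simp only [hy, if_true]; omega
        · simp [hy]
      · intro x hx1 hx2
        rw [sa_o hx1 hx2, h, sa_o hx2 hx1]
  · simp at h

theorem eMat_none (hA : IsGAP m n A) (hm : 2 ≤ m) (hn : 0 < n) (h : eMat m n i A = none) :
    ∃ D, IsD (A i) (A (i + 1)) D ∧ ∀ y, D y ≤ 0 := by
  obtain ⟨D, hD⟩ := isD_ex hA (by omega) hn i
  obtain ⟨E, hE⟩ := isD_lim hD hA (by omega) hn
  refine ⟨D, hD, fun y => ?_⟩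
  unfold eMat at h
  split at h
  · simp at h
  · rename_i hx
    by_contra hc
    apply hx
    obtain ⟨Y, hY⟩ := hE
    obtain ⟨Y0, hY0⟩ := hD.2
    have : ∃ x, SurvMinus A i (-x) ∧ ∀ w, SurvMinus A i (-w) → x ≤ w := by
      apply least_int (P := fun x => SurvMinus A i (-x))
      · obtain ⟨z, z1, z2, z3, z4⟩ := first_max D (min_le_left y Y0)
        have z5 := z3 y (min_le_left _ _) le_rfl
        refine ⟨-z, ?_⟩
        rw [neg_neg]
        refine (survMinus_iff hD z).2 fun w hw => ?_
        by_cases hwj : min y Y0 ≤ w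
        · exact z4 w hwj hw
        · rw [hY0 w (by have := min_le_right y Y0; omega)]; omega
      · refine ⟨-Y, fun x hx => ?_⟩
        by_contra hc2
        have := (survMinus_iff hD (-x)).1 hx (-x - 1) (by omega)
        rw [hY _ (by omega), hY _ (by omega)] at this; omega
    obtain ⟨x, hx1, hx2⟩ := this
    exact ⟨-x, hx1, fun w hw => by have := hx2 (-w) (by rwa [neg_neg]); omega⟩

/-! ### Abstract signature rule -/

section
variable {hp hq : ℕ → Prop} {E : ℕ → ℤ}

theorem sig_sum (hE : ∀ t, E (t + 1) = E t + (if hp t then 1 else 0) - (if hq t then 1 else 0)) {t t' : ℕ} (h : t' ≤ t) :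
    E t + ((Finset.Ico t' t).filter hq).card = E t' + ((Finset.Ico t' t).filter hp).card := by
  induction t, h using Nat.le_induction with
  | base => simp
  | succ t h ih =>
    rw [show Finset.Ico t' (t + 1) = insert t (Finset.Ico t' t) from (Finset.insert_Ico_right_eq_Ico_add_one h).symm,
      Finset.filter_insert, Finset.filter_insert, hE t]
    by_cases h1 : hp t <;> by_cases h2 : hq t <;> simp [h1, h2] <;> omega

theorem sig_plus (hE : ∀ t, E (t + 1) = E t + (if hp t then 1 else 0) - (if hq t then 1 else 0))
    (hx : ∀ t, ¬ (hp t ∧ hq t)) (t : ℕ) :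
    (∀ t' < t, ((Finset.Ico t' t).filter hq).card ≤ ((Finset.Ioo t' t).filter hp).card) ↔ ∀ t' < t, E t' ≤ E t := by
  have key : ∀ t' < t, ((Finset.Ico t' t).filter hp).card = ((Finset.Ioo t' t).filter hp).card + if hp t' then 1 else 0 := by
    intro t' ht
    have : Finset.Ico t' t = insert t' (Finset.Ioo t' t) := by
      ext u; simp only [Finset.mem_Ico, Finset.mem_Ioo, Finset.mem_insert]; omega
    rw [this, Finset.filter_insert]
    by_cases h1 : hp t' <;> simp [h1]
  constructor
  · intro h t' ht
    have a := h t' ht; have b := key t' ht; have c := sig_sum hE ht.le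
    omega
  · intro h t' ht
    have a := h t' ht; have b := key t' ht; have c := sig_sum hE ht.le
    by_cases h1 : hp t'
    · have d := hE t'
      have h2 : ¬ hq t' := fun h2 => hx t' ⟨h1, h2⟩
      rw [if_pos h1, if_neg h2] at d
      rw [if_pos h1] at b
      have e : E (t' + 1) ≤ E t := by
        rcases (show t' + 1 ≤ t by omega).lt_or_eq with hh | hh
        · exact h _ hh
        · rw [hh]
      omega
    · rw [if_neg h1] at b; omega

theorem sig_minus (hE : ∀ t, E (t + 1) = E t + (if hp t then 1 else 0) - (if hq t then 1 else 0))
    (hx : ∀ t, ¬ (hp t ∧ hq t)) (t : ℕ) :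
    (∀ u, t < u → ((Finset.Ioc t u).filter hp).card ≤ ((Finset.Ioo t u).filter hq).card) ↔ ∀ u, t + 1 < u → E u ≤ E (t + 1) := by
  have key : ∀ u, t < u → E (u + 1) + ((Finset.Ioo t u).filter hq).card + (if hq u then 1 else 0) =
      E (t + 1) + ((Finset.Ioc t u).filter hp).card := by
    intro u hu
    have : Finset.Ico (t + 1) (u + 1) = Finset.Ioc t u := by
      ext u; simp only [Finset.mem_Ico, Finset.mem_Ioc]; omega
    have c := sig_sum hE (show t + 1 ≤ u + 1 by omega)
    rw [this] at c
    have e : Finset.Ioc t u = insert u (Finset.Ioo t u) := by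
      ext w; simp only [Finset.mem_Ioc, Finset.mem_Ioo, Finset.mem_insert]; omega
    have : ((Finset.Ioc t u).filter hq).card = ((Finset.Ioo t u).filter hq).card + if hq u then 1 else 0 := by
      rw [e, Finset.filter_insert]
      by_cases h1 : hq u <;> simp [h1]
    rw [this] at c
    push_cast at c
    omega
  constructor
  · intro h u hu
    obtain ⟨u, rfl⟩ : ∃ v, u = v + 1 := ⟨u - 1, by omega⟩
    have a := h u (by omega); have b := key u (by omega)
    split at b <;> omega
  · intro h u hu
    have a := h (u + 1) (by omega); have b := key u hu
    by_cases h1 : hq u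
    · have d := hE u
      have h2 : ¬ hp u := fun h2 => hx u ⟨h2, h1⟩
      rw [if_pos h1, if_neg h2] at d
      rw [if_pos h1] at b
      have e : E u ≤ E (t + 1) := by
        rcases (show t + 1 ≤ u by omega).lt_or_eq with hh | hh
        · exact h _ hh
        · rw [hh]
      omega
    · rw [if_neg h1] at b; omega

end
end

section
variable {m n l s : ℕ} {A A' B B' : Mat} {i j : ℤ} {D : ℤ → ℤ} {μ : ℕ → ℕ} {G : (ℤ → ℤ → ℤ) → ℤ → Prop}

def trN (N : ℤ → ℤ → ℤ) : ℤ → ℤ → ℤ := fun x y => N y x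

theorem Chain.g {As : ℕ → Mat} {N : ℕ → ℤ → ℤ → ℤ} (h : Chain m n s As μ N) (y0 : ℤ) : GChain (Gc y0) m n s As μ N :=
  ⟨fun t ht => ⟨(h.1 t ht).w y0, (h.1 t ht).f⟩, h.2⟩

theorem GChain.gap {As : ℕ → Mat} {N : ℕ → ℤ → ℤ → ℤ} (h : GChain G m n s As μ N) (hA : IsGAP m n (As 0))
    (hm : 0 < m) (hn : 0 < n) (t : ℕ) (ht : t ≤ s) : IsGAP m n (As t) := by
  induction t with
  | zero => exact hA
  | succ t ih => exact (h.1 t (by omega)).gap (ih (by omega)) hm hn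

theorem GChain.chain {As : ℕ → Mat} {N : ℕ → ℤ → ℤ → ℤ} {y0 : ℤ} (h : GChain (Gc y0) m n s As μ N) (hA : IsGAP m n (As 0))
    (hm : 0 < m) (hn : 0 < n) : Chain m n s As μ N :=
  ⟨fun t ht => ⟨minSol_all (h.gap hA hm hn t ht.le) hm hn (h.1 t ht).1, (h.1 t ht).2⟩, h.2⟩

theorem GChain.tr {As : ℕ → Mat} {N : ℕ → ℤ → ℤ → ℤ} {y0 : ℤ} (h : GChain (Gc y0) m n s As μ N) :
    GChain (fun N k => Rg N k y0) n m s (fun t => transM (As t)) μ (fun t => trN (N t)) :=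
  ⟨fun t ht => ⟨minSol_trans.1 (h.1 t ht).1, (h.1 t ht).2.trans⟩, by show transM (As s) = 0; rw [h.2]; rfl⟩

theorem GChain.tr' {As : ℕ → Mat} {N : ℕ → ℤ → ℤ → ℤ} {y0 : ℤ} (h : GChain (fun N k => Rg N k y0) n m s As μ N) :
    GChain (Gc y0) m n s (fun t => transM (As t)) μ (fun t => trN (N t)) :=
  ⟨fun t ht => ⟨minSol_trans.2 (h.1 t ht).1, (h.1 t ht).2.trans⟩, by show transM (As s) = 0; rw [h.2]; rfl⟩

/-! ### Sequences -/

structure IsSeq (m l : ℕ) (X : ℤ → ℤ) : Prop where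
  lpos : 0 < l
  inc : ∀ k, X k < X (k + 1)
  per : ∀ k, X (k + l) = X k + m

theorem IsSeq.lt {X : ℤ → ℤ} (h : IsSeq m l X) : StrictMono X := by
  intro a b hab
  refine int_up (P := fun b => X a < X b) (h.inc a) (fun y _ ih => ?_) b (show a + 1 ≤ b by omega)
  have := h.inc (y - 1); rw [sub_add_cancel] at this
  exact lt_trans ih this

theorem IsSeq.perq {X : ℤ → ℤ} (h : IsSeq m l X) (q k : ℤ) : X (k + q * l) = X k + q * m := by
  induction q using Int.induction_on with
  | zero => simp
  | succ q ih => rw [show k + ((q : ℤ) + 1) * l = k + q * l + l by ring, h.per, ih]; ring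
  | pred q ih =>
    have := h.per (k + (-(q : ℤ) - 1) * l)
    rw [show k + (-(q : ℤ) - 1) * l + l = k + -q * l by ring, ih] at this
    linarith

theorem IsSeq.colExt {X : ℤ → ℤ} (h : IsSeq m l X) {a : ℕ → ℤ} {c : ℤ} (ha : ∀ p < l, a p = X (c + p)) (z : ℤ) :
    colExt m l a z = X (c + z) := by
  have hl : (0 : ℤ) < l := by exact_mod_cast h.lpos
  have h1 := Int.emod_nonneg z hl.ne'
  have h2 := Int.emod_lt_of_pos z hl
  have h3 := Int.emod_add_mul_ediv z l
  show a (Int.toNat (z % l)) + (m : ℤ) * (z / l) = _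
  rw [ha _ (by omega), Int.toNat_of_nonneg h1]
  have := h.perq (z / l) (c + z % l)
  rw [show c + z % l + z / l * l = c + z by linarith] at this
  rw [this]; ring

theorem IsSeq.rep {X : ℤ → ℤ} (h : IsSeq m l X) (c k : ℤ) : ∃ p : ℕ, p < l ∧ ∃ q : ℤ, k = c + p + q * l := by
  have hl : (0 : ℤ) < l := by exact_mod_cast h.lpos
  have h1 := Int.emod_nonneg (k - c) hl.ne'
  have h2 := Int.emod_lt_of_pos (k - c) hl
  have h3 := Int.emod_add_mul_ediv (k - c) l
  exact ⟨((k - c) % l).toNat, by omega, (k - c) / l, by rw [Int.toNat_of_nonneg h1]; linarith⟩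

theorem IsSeq.norm {X : ℤ → ℤ} (h : IsSeq m l X) (hm : 0 < m) : ∃ r, ∀ p : ℕ, p < l → 1 ≤ X (r + 1 + p) ∧ X (r + 1 + p) ≤ m := by
  have hm' : (0 : ℤ) < m := by exact_mod_cast hm
  obtain ⟨r, h1, h2⟩ : ∃ r, 1 ≤ X r ∧ ∀ k, 1 ≤ X k → r ≤ k := by
    apply least_int
    · refine ⟨0 + |1 - X 0| * l, ?_⟩
      rw [h.perq]; have := le_abs_self (1 - X 0); have := abs_nonneg (1 - X 0); nlinarith
    · refine ⟨0 + (-|X 0|) * l, fun k hk => ?_⟩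
      by_contra hc
      have := h.lt (not_le.1 hc)
      rw [h.perq] at this; have := le_abs_self (X 0); have := abs_nonneg (X 0); nlinarith
  refine ⟨r - 1, fun p hp => ?_⟩
  rw [show r - 1 + 1 + (p : ℤ) = r + p by ring]
  constructor
  · exact h1.trans (h.lt.monotone (by omega))
  · by_contra hc
    have := h.per (r + p - l)
    rw [sub_add_cancel] at this
    have := h2 (r + p - l) (by omega)
    omega

def XR (N : ℤ → ℤ → ℤ) (X : ℤ → ℤ) : Prop := ∀ k, Rg N k (X k) ∧ ¬ Rg N k (X k - 1)

theorem XR.uniq {N : ℤ → ℤ → ℤ} {X : ℤ → ℤ} (h : XR N X) (S : Sol m n A l N) {k x : ℤ} (hx : Rg N k x ∧ ¬ Rg N k (x - 1)) : X k = x := by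
  have h1 := (S.r1 (h k)).1 hx.1
  have h2 := (S.r1 hx).1 (h k).1
  omega

theorem XR.hasR {N : ℤ → ℤ → ℤ} {X : ℤ → ℤ} (h : XR N X) (S : Sol m n A l N) : HasR N i ↔ ∃ k, X k = i :=
  ⟨fun ⟨k, hk⟩ => ⟨k, h.uniq S hk⟩, fun ⟨k, hk⟩ => ⟨k, hk ▸ h k⟩⟩

theorem XR.seq {N : ℤ → ℤ → ℤ} {X : ℤ → ℤ} (h : XR N X) (S : Sol m n A l N) : IsSeq m l X := by
  refine ⟨S.lpos, fun k => ?_, fun k => ?_⟩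
  · have := (S.r1 (h k)).1 (S.rg_pred (h (k + 1)).1); omega
  · apply h.uniq S
    have a := S.rgper 1 (k + l) (X k)
    have b := S.rgper 1 (k + l) (X k - 1)
    simp only [one_mul, add_sub_cancel_right] at a b
    rw [show X k + m - 1 = X k - 1 + m by ring, a, b]; exact h k

structure SOp (m : ℕ) (i : ℤ) (s t₀ : ℕ) (X X' : ℕ → ℤ → ℤ) : Prop where
  lt : t₀ < s
  same : ∀ t < s, t ≠ t₀ → X' t = X t
  has : ∃ k, X t₀ k = i
  not : ∀ k, X t₀ k ≠ i + 1
  ch : ∀ k, X' t₀ k = if ∃ q : ℤ, X t₀ k = i + q * m then X t₀ k + 1 else X t₀ k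
  lft : ∀ u, u + 1 = t₀ → (∃ k, X u k = i + 1) → ∃ k, X u k = i
  rgt : t₀ + 1 < s → (∃ k, X (t₀ + 1) k = i) → ∃ k, X (t₀ + 1) k = i + 1

variable {M : ℤ} {As As' : ℕ → Mat} {N N' : ℕ → ℤ → ℤ → ℤ} {t₀ : ℕ} {X X' : ℕ → ℤ → ℤ}

theorem es_sig {E : ℕ → ℤ} {hp hq : ℕ → Prop} (hE : ES i s N E) (hC : GChain G m n s As μ N) (hX : ∀ t < s, XR (N t) (X t))
    (h1 : ∀ t, hp t ↔ t < s ∧ (∃ k, X t k = i) ∧ ¬ ∃ k, X t k = i + 1)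
    (h2 : ∀ t, hq t ↔ t < s ∧ (∃ k, X t k = i + 1) ∧ ¬ ∃ k, X t k = i) (t : ℕ) :
    E (t + 1) = E t + (if hp t then 1 else 0) - (if hq t then 1 else 0) := by
  by_cases ht : t < s
  · rw [hE.2 t ht, (hX t ht).hasR (hC.1 t ht).1.s, (hX t ht).hasR (hC.1 t ht).1.s, h1, h2]
    by_cases a : ∃ k, X t k = i <;> by_cases b : ∃ k, X t k = i + 1 <;> simp [a, b, ht]
  · rw [hE.1 _ (by omega), hE.1 _ (by omega), h1, h2]; simp [ht]

theorem Two.sop (T : Two G m n i s μ M As As' N N' t₀) (hm : 2 ≤ m) (hX : ∀ t < s, XR (N t) (X t))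
    (hX' : ∀ t < s, XR (N' t) (X' t)) : SOp m i s t₀ X X' := by
  have S := fun t ht => (T.c.1 t ht).1.s
  have S' := fun t ht => (T.c'.1 t ht).1.s
  obtain ⟨E, hE⟩ := es_ex i s N
  obtain ⟨K, k1, k2, k3, k4⟩ := T.r.ch
  have lt := T.r.lt
  have hK := (hX _ lt).uniq (S _ lt) ⟨k1, k2⟩
  have sq := (hX _ lt).seq (S _ lt)
  have hnot : ∀ k, X t₀ k ≠ i + 1 := by
    intro k hk
    have := hX _ lt k
    rw [hk, add_sub_cancel_right] at this
    exact this.2 (k3 k this.1)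
  have e0 := T.e1 E hE t₀ le_rfl
  have e1 := T.e2 E hE
  have e3 := T.e3 E hE
  have eM : E t₀ = M - 1 := by
    have := hE.2 t₀ lt
    rw [(hX t₀ lt).hasR (S t₀ lt), (hX t₀ lt).hasR (S t₀ lt), if_pos ⟨K, hK⟩, if_neg (by simpa using hnot)] at this
    omega
  refine ⟨lt, fun t ht htt => ?_, ⟨K, hK⟩, hnot, fun k => ?_, fun u hu h => ?_, fun h0 h => ?_⟩
  · funext k
    apply (hX' t ht).uniq (S' t ht)
    rw [T.r.same t ht htt, T.r.same t ht htt]; exact hX t ht k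
  · have hc : ∀ q : ℤ, X t₀ k = i + q * m ↔ k = K + q * μ t₀ := by
      intro q
      rw [← sq.lt.injective.eq_iff (b := K + q * μ t₀), sq.perq, hK]
    apply (hX' _ lt).uniq (S' _ lt)
    rw [k4, k4]
    have hk := hX _ lt k
    split
    · rename_i hq
      obtain ⟨q, hq⟩ := hq
      refine ⟨⟨(S _ lt).rg_mono hk.1 (by omega), ?_⟩, ?_⟩
      · rintro ⟨q', a, b⟩; exact ne1 hm i q' q (by linarith)
      · rintro ⟨a, b⟩; exact b ⟨q, by linarith, (hc q).1 hq⟩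
    · rename_i hq
      exact ⟨⟨hk.1, fun ⟨q, a, b⟩ => hq ⟨q, a⟩⟩, fun h => hk.2 h.1⟩
  · by_contra hc
    have hu' : u < s := by omega
    have := hE.2 u hu'
    rw [(hX u hu').hasR (S u hu'), (hX u hu').hasR (S u hu'), if_neg hc, if_pos h, hu] at this
    have := T.e1 E hE u (by omega)
    omega
  · by_contra hc
    have := hE.2 _ h0
    rw [(hX _ h0).hasR (S _ h0), (hX _ h0).hasR (S _ h0), if_pos h, if_neg hc] at this
    have := e3 (t₀ + 1 + 1)
    omega

theorem Two.es (T : Two G m n i s μ M As As' N N' t₀) (hm : 2 ≤ m) {E : ℕ → ℤ} (hE : ES i s N E) (hX : ∀ t < s, XR (N t) (X t))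
    (hX' : ∀ t < s, XR (N' t) (X' t)) : ES i s N' (fun t => if t ≤ t₀ then E t + 2 else E t) := by
  have O := T.sop hm hX hX'
  have S := fun t ht => (T.c.1 t ht).1.s
  have S' := fun t ht => (T.c'.1 t ht).1.s
  refine ⟨fun t ht => ?_, fun t ht => ?_⟩
  · have := O.lt
    simp only [if_neg (show ¬ t ≤ t₀ by omega)]; exact hE.1 t ht
  · have h := hE.2 t ht
    rw [(hX t ht).hasR (S t ht), (hX t ht).hasR (S t ht)] at h
    rw [(hX' t ht).hasR (S' t ht), (hX' t ht).hasR (S' t ht)]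
    by_cases htt : t = t₀
    · subst htt
      have hn' := O.not
      have h1 : ¬ ∃ k, X' t k = i := by
        rintro ⟨k, hk⟩
        rw [O.ch k] at hk
        split at hk
        · rename_i hq; obtain ⟨q, hq⟩ := hq
          exact ne1 hm i 0 q (by linarith)
        · rename_i hq; exact hq ⟨0, by linarith⟩
      have h2 : ∃ k, X' t k = i + 1 := by
        obtain ⟨k, hk⟩ := O.has
        exact ⟨k, by rw [O.ch k, if_pos ⟨0, by linarith⟩, hk]⟩
      rw [if_pos O.has, if_neg (by simpa using hn')] at h
      simp only [if_neg h1, if_pos h2, le_refl, if_true, if_neg (show ¬ t + 1 ≤ t by omega)]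
      omega
    · rw [O.same t ht htt]
      by_cases hlt : t < t₀
      · simp only [if_pos (show t + 1 ≤ t₀ by omega), if_pos hlt.le]; rw [h]; ring
      · simp only [if_neg (show ¬ t + 1 ≤ t₀ by omega), if_neg (show ¬ t ≤ t₀ by omega)]; exact h

section
variable {hp hq : ℕ → Prop}

theorem surv_f (T : Two G m n i s μ M As As' N N' t₀) (hm : 2 ≤ m) (hX : ∀ t < s, XR (N t) (X t))
    (hX' : ∀ t < s, XR (N' t) (X' t))
    (h1 : ∀ t, hp t ↔ t < s ∧ (∃ k, X t k = i) ∧ ¬ ∃ k, X t k = i + 1)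
    (h2 : ∀ t, hq t ↔ t < s ∧ (∃ k, X t k = i + 1) ∧ ¬ ∃ k, X t k = i) :
    (hp t₀ ∧ ∀ t' < t₀, ((Finset.Ico t' t₀).filter hq).card ≤ ((Finset.Ioo t' t₀).filter hp).card) ∧
    ∀ t, (hp t ∧ ∀ t' < t, ((Finset.Ico t' t).filter hq).card ≤ ((Finset.Ioo t' t).filter hp).card) → t ≤ t₀ := by
  have O := T.sop hm hX hX'
  obtain ⟨E, hE⟩ := es_ex i s N
  have hs := es_sig hE T.c hX h1 h2
  have hx : ∀ t, ¬ (hp t ∧ hq t) := by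
    intro t; rw [h1, h2]; tauto
  have hp0 : hp t₀ := (h1 _).2 ⟨O.lt, O.has, by simpa using O.not⟩
  have e0 := T.e1 E hE
  have e1 := T.e2 E hE
  have e3 := T.e3 E hE
  have st : ∀ t, hp t → E (t + 1) = E t + 1 := by
    intro t h; rw [hs, if_pos h, if_neg fun h' => hx t ⟨h, h'⟩]; ring
  refine ⟨⟨hp0, (sig_plus hs hx t₀).2 fun t' ht => ?_⟩, ?_⟩
  · have := e0 t' ht.le; have := st _ hp0; omega
  · rintro t ⟨h, h'⟩
    by_contra hc
    have h' := (sig_plus hs hx t).1 h'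
    have a := e3 (t + 1); have b := st _ h
    rcases (show t₀ + 1 ≤ t by omega).lt_or_eq with hh | hh
    · have := h' _ hh; omega
    · rw [hh] at e1; omega

theorem surv_e (T : Two G m n i s μ M As As' N N' t₀) (hm : 2 ≤ m) (hX : ∀ t < s, XR (N t) (X t))
    (hX' : ∀ t < s, XR (N' t) (X' t))
    (h1 : ∀ t, hp t ↔ t < s ∧ (∃ k, X' t k = i) ∧ ¬ ∃ k, X' t k = i + 1)
    (h2 : ∀ t, hq t ↔ t < s ∧ (∃ k, X' t k = i + 1) ∧ ¬ ∃ k, X' t k = i) :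
    (hq t₀ ∧ ∀ u, t₀ < u → ((Finset.Ioc t₀ u).filter hp).card ≤ ((Finset.Ioo t₀ u).filter hq).card) ∧
    ∀ t, (hq t ∧ ∀ u, t < u → ((Finset.Ioc t u).filter hp).card ≤ ((Finset.Ioo t u).filter hq).card) → t₀ ≤ t := by
  have O := T.sop hm hX hX'
  obtain ⟨E, hE⟩ := es_ex i s N
  have hE' := T.es hm hE hX hX'
  have hs := es_sig hE' T.c' hX' h1 h2
  have hx : ∀ t, ¬ (hp t ∧ hq t) := by
    intro t; rw [h1, h2]; tauto
  have e0 := T.e1 E hE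
  have e1 := T.e2 E hE
  have e3 := T.e3 E hE
  have hq0 : hq t₀ := by
    rw [h2]
    refine ⟨O.lt, ?_, ?_⟩
    · obtain ⟨k, hk⟩ := O.has
      exact ⟨k, by rw [O.ch k, if_pos ⟨0, by linarith⟩, hk]⟩
    · rintro ⟨k, hk⟩
      rw [O.ch k] at hk
      split at hk
      · rename_i hq; obtain ⟨q, hq⟩ := hq
        exact ne1 hm i 0 q (by linarith)
      · rename_i hq; exact hq ⟨0, by linarith⟩
  have st : ∀ t, hq t → (if t + 1 ≤ t₀ then E (t + 1) + 2 else E (t + 1)) = (if t ≤ t₀ then E t + 2 else E t) - 1 := by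
    intro t h
    have := hs t
    rw [if_pos h, if_neg fun h' => hx t ⟨h', h⟩] at this
    simpa using this
  refine ⟨⟨hq0, (sig_minus (E := fun t => if t ≤ t₀ then E t + 2 else E t) hs hx t₀).2 fun u hu => ?_⟩, ?_⟩
  · show (if u ≤ t₀ then E u + 2 else E u) ≤ (if t₀ + 1 ≤ t₀ then E (t₀ + 1) + 2 else E (t₀ + 1))
    rw [if_neg (by omega), if_neg (by omega)]; have := e3 u; omega
  · rintro t ⟨h, h'⟩
    by_contra hc
    have h' := (sig_minus (E := fun t => if t ≤ t₀ then E t + 2 else E t) hs hx t).1 h'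
    have a := e0 t (by omega)
    have b := st _ h
    have c := st _ hq0
    rw [if_pos (by omega), if_pos (by omega)] at b
    rw [if_neg (by omega), if_pos (by omega)] at c
    rcases (show t + 1 ≤ t₀ by omega).lt_or_eq with hh | hh
    · have := h' _ hh; rw [if_pos (by omega), if_pos (by omega)] at this; omega
    · rw [hh] at b; omega

theorem none_f {A : Mat} (hA : IsGAP m n A) (hm : 2 ≤ m) (hn : 0 < n) (h : fMat m n i A = none) (hC : GChain G m n s As μ N)
    (h0 : As 0 = A) (hX : ∀ t < s, XR (N t) (X t))
    (h1 : ∀ t, hp t ↔ t < s ∧ (∃ k, X t k = i) ∧ ¬ ∃ k, X t k = i + 1)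
    (h2 : ∀ t, hq t ↔ t < s ∧ (∃ k, X t k = i + 1) ∧ ¬ ∃ k, X t k = i) (t : ℕ) :
    ¬ (hp t ∧ ∀ t' < t, ((Finset.Ico t' t).filter hq).card ≤ ((Finset.Ioo t' t).filter hp).card) := by
  subst h0
  rintro ⟨h3, h4⟩
  obtain ⟨D, F, hD, hF, hl⟩ := fMat_none hA hm hn h
  obtain ⟨E, hE⟩ := es_ex i s N
  have hs := es_sig hE hC hX h1 h2
  have hx : ∀ t, ¬ (hp t ∧ hq t) := by
    intro t; rw [h1, h2]; tauto
  obtain ⟨b1, b2⟩ := chain_lim (by omega) hn s hC hA hE hD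
  obtain rfl := b1.uniq hF
  have c1 := b2 _ hl (t + 1)
  have c2 := hs t
  rw [if_pos h3, if_neg fun h' => hx t ⟨h3, h'⟩] at c2
  have h4 := (sig_plus hs hx t).1 h4
  have : E 0 ≤ E t := by
    rcases Nat.eq_zero_or_pos t with rfl | h
    · exact le_rfl
    · exact h4 0 h
  omega

theorem none_e {A : Mat} (hA : IsGAP m n A) (hm : 2 ≤ m) (hn : 0 < n) (h : eMat m n i A = none) (hC : GChain G m n s As μ N)
    (h0 : As 0 = A) (hX : ∀ t < s, XR (N t) (X t))
    (h1 : ∀ t, hp t ↔ t < s ∧ (∃ k, X t k = i) ∧ ¬ ∃ k, X t k = i + 1)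
    (h2 : ∀ t, hq t ↔ t < s ∧ (∃ k, X t k = i + 1) ∧ ¬ ∃ k, X t k = i) (t : ℕ) :
    ¬ (hq t ∧ ∀ u, t < u → ((Finset.Ioc t u).filter hp).card ≤ ((Finset.Ioo t u).filter hq).card) := by
  subst h0
  rintro ⟨h3, h4⟩
  obtain ⟨D, hD, hl⟩ := eMat_none hA hm hn h
  obtain ⟨E, hE⟩ := es_ex i s N
  have hs := es_sig hE hC hX h1 h2
  have hx : ∀ t, ¬ (hp t ∧ hq t) := by
    intro t; rw [h1, h2]; tauto
  obtain ⟨b1, b2⟩ := chain_lim (by omega) hn s hC hA hE hD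
  have c1 := b2 _ hl t
  have c2 := hs t
  rw [if_pos h3, if_neg fun h' => hx t ⟨h', h3⟩] at c2
  have h4 := (sig_minus hs hx t).1 h4 (t + 2 + s) (by omega)
  rw [hE.1 _ (by omega)] at h4
  omega

end

/-! ### Shape -/

theorem flow_mono {N1 N2 : ℤ → ℤ → ℤ} {l1 l2 : ℕ} (S1 : Sol m n A l1 N1) (f : FlatEq A B N1) (S2 : Sol m n B l2 N2)
    (hB : IsGAP m n B) (hn : 0 < n) : l2 ≤ l1 := by
  obtain ⟨e, C⟩ := S2.canon hB hn
  have key : ∀ x y, B x y ≠ 0 → N1 (x - 1) (y - 1) + 1 ≤ N1 x y := by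
    intro x y h
    by_contra hc
    have h1 := S1.monx x y
    have h2 := S1.mony x y
    have h3 := S1.mony (x - 1) y
    have h4 := S1.monx x (y - 1)
    have h5 : A x y = 0 := by by_contra h6; exact hc (S1.cell x y h6)
    have := f x y
    omega
  refine flow_le (f := fun i => N1 (e i).1 (e i).2) (fun i => ?_) ?_
  · have a := key _ _ (C.ext (i + 1)).mem
    have b := C.str.2.1 i
    have := S1.mono (show (e i).1 ≤ (e (i + 1)).1 - 1 by have := b.1; omega) (show (e i).2 ≤ (e (i + 1)).2 - 1 by have := b.2; omega)
    omega
  · rw [← C.str.2.2]; exact S1.per _ _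

theorem GChain.mu (h : GChain G m n s As μ N) (hA : IsGAP m n (As 0)) (hm : 0 < m) (hn : 0 < n) {t t' : ℕ} (hl : t ≤ t') (ht : t' < s) :
    μ t' ≤ μ t := by
  induction t', hl using Nat.le_induction with
  | base => exact le_rfl
  | succ t' hl ih =>
    refine le_trans ?_ (ih (by omega))
    exact flow_mono (h.1 t' (by omega)).1.s (h.1 t' (by omega)).2 (h.1 (t' + 1) ht).1.s (h.gap hA hm hn _ ht.le) hn

end

section
variable {m n l s : ℕ} {A : Mat} {i : ℤ} {μ : ℕ → ℕ} {As : ℕ → Mat} {N : ℕ → ℤ → ℤ → ℤ} {t₀ : ℕ} {X X' Y : ℕ → ℤ → ℤ}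
  {P P' Q : ℕ → ℕ → ℤ} {r : ℕ → ℤ}

/-! ### The tableaux in terms of streams -/

theorem pair_iff {Z Z' : ℤ → ℤ} {u : ℕ} {c c' : ℤ} (h : IsSeq m (μ u) Z) (h' : IsSeq m (μ u) Z') (hP : ∀ x < μ u, P x u = Z (c + x))
    (hP' : ∀ x < μ u, P x (u + 1) = Z' (c' + x)) (r : ℕ) : pairCond m μ P u r ↔ ∀ z : ℤ, Z (c + z) ≤ Z' (c' + r + z) := by
  have e : ∀ x : ℕ, tauPow m (μ u) (r : ℤ) (fun y => P y (u + 1)) x = Z' (c' + r + x) := by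
    intro x
    show AffineRSK.colExt m (μ u) (fun y => P y (u + 1)) ((x : ℤ) + r) = _
    rw [h'.colExt (c := c') hP']
    congr 1; ring
  constructor
  · rintro ⟨-, -, h3⟩ z
    obtain ⟨p, hp, q, hq⟩ := h.rep 0 z
    have := h3 p hp
    rw [e, hP p hp] at this
    rw [hq, show c + (0 + (p : ℤ) + q * (μ u : ℕ)) = c + p + q * (μ u : ℕ) by ring, h.perq,
      show c' + r + (0 + (p : ℤ) + q * (μ u : ℕ)) = c' + r + p + q * (μ u : ℕ) by ring, h'.perq]
    linarith
  · intro h3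
    refine ⟨fun x hx => ?_, fun x hx => ?_, fun x hx => ?_⟩
    · rw [hP x (by omega), hP (x + 1) hx]; apply h.lt; push_cast; omega
    · rw [e, e]; apply h'.lt; push_cast; omega
    · rw [e, hP x hx]; exact h3 x

theorem eta_congr (mo : ∀ t t', t ≤ t' → t' < s → μ t' ≤ μ t)
    (h : ∀ u, u + 1 < s → μ u = μ (u + 1) → ∀ r, pairCond m μ P u r ↔ pairCond m μ P' u r) {t : ℕ} (ht : t < s) :
    etaCol m μ P t = etaCol m μ P' t := by
  refine Finset.sum_congr rfl fun u hu => ?_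
  rw [Finset.mem_Ico] at hu
  have hb : μ (blockStart μ t) = μ t := Nat.sInf_mem (s := {t' : ℕ | μ t' = μ t}) ⟨t, rfl⟩
  have h1 := mo _ _ hu.1 (by omega)
  have h2 := mo u (u + 1) (by omega) (by omega)
  have h3 := mo (u + 1) t (by omega) ht
  unfold rOff
  congr 1
  ext r
  exact h u (by omega) (by omega) r

structure KD (m n s : ℕ) (μ : ℕ → ℕ) (N : ℕ → ℤ → ℤ → ℤ) (X Y : ℕ → ℤ → ℤ) (r : ℕ → ℤ) (P Q : ℕ → ℕ → ℤ) : Prop where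
  x : ∀ t < s, XR (N t) (X t)
  y : ∀ t < s, XR (trN (N t)) (Y t)
  nr : ∀ t < s, ∀ p : ℕ, p < μ t → 1 ≤ X t (r t + 1 + p) ∧ X t (r t + 1 + p) ≤ m
  p : ∀ t < s, ∀ x : ℕ, x < μ t → P x t = X t (r t + 1 + x)
  q : ∀ t < s, ∀ x : ℕ, x < μ t → Q x t = Y t (r t + 1 + etaCol m μ P t + x)
  zp : PadZeroT s μ P
  zq : PadZeroT s μ Q
  mu : ∀ t, s ≤ t → μ t = 0

theorem kappa_iff (hA : IsGAP m n A) (hm : 0 < m) (hn : 0 < n) : KappaRel m n A s μ P Q ↔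
    ∃ As N X Y r, As 0 = A ∧ Chain m n s As μ N ∧ KD m n s μ N X Y r P Q := by
  constructor
  · rintro ⟨P', Q', ρ, h, h1, h2, h3, h4⟩
    obtain ⟨As, N, h0, C, h5⟩ := (kappa0_iff hA hm hn).1 h
    have h5' : ∀ t, ∃ e r₁ r₂, t < s → SData m n (N t) e (μ t) (fun x => P' x t) (fun x => Q' x t) r₁ r₂ ∧ ρ t = r₁ - r₂ := by
      intro t
      by_cases ht : t < s
      · obtain ⟨e, r₁, r₂, h⟩ := h5 t ht; exact ⟨e, r₁, r₂, fun _ => h⟩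
      · exact ⟨fun _ => (0, 0), 0, 0, fun h => absurd h ht⟩
    choose e r₁ r₂ h5 using h5'
    subst h0
    have S := fun t ht => ((C.g 0).1 t ht).1.s
    have hx : ∀ t < s, XR (N t) (fun k => (e t k).1) := fun t ht k => ((h5 t ht).1.bp k).1
    have hy : ∀ t < s, XR (trN (N t)) (fun k => (e t k).2) := fun t ht k => ((h5 t ht).1.bp k).2
    have he : ∀ t < s, etaCol m μ P t = etaCol m μ P' t := fun t ht => by
      refine eta_congr (fun a b hab hb => (C.g 0).mu hA hm hn hab hb) (fun u hu hmu r => ?_) ht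
      have s1 := (hx u (by omega)).seq (S u (by omega))
      have s2 := (hx (u + 1) hu).seq (S (u + 1) hu)
      rw [← hmu] at s2
      rw [pair_iff s1 s2 (c := r₁ u + 1) (c' := r₁ (u + 1) + 1) (P := P), pair_iff s1 s2 (c := r₁ u + 1) (c' := r₁ (u + 1) + 1) (P := P')]
      · exact fun x hx => ((h5 u (by omega)).1.a x hx).1
      · exact fun x hx => ((h5 (u + 1) (by omega)).1.a x (hmu ▸ hx)).1
      · exact fun x hx => (h1 u (by omega) x hx).1.trans ((h5 u (by omega)).1.a x hx).1
      · exact fun x hx => (h1 (u + 1) (by omega) x (hmu ▸ hx)).1.trans ((h5 (u + 1) (by omega)).1.a x (hmu ▸ hx)).1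
    refine ⟨As, N, fun t k => (e t k).1, fun t k => (e t k).2, r₁, rfl, C, hx, hy, fun t ht p hp => ?_, fun t ht p hp => ?_,
      fun t ht p hp => ?_, h2, h3, h4⟩
    · obtain ⟨a, b, c⟩ := (h5 t ht).1.a p hp
      rw [a] at b c
      exact ⟨b, c⟩
    · exact (h1 t ht p hp).1.trans ((h5 t ht).1.a p hp).1
    · rw [(h1 t ht p hp).2, he t ht]
      show AffineRSK.colExt n (μ t) (fun y => Q' y t) ((p : ℤ) + (ρ t + _)) = _
      rw [((hy t ht).seq (S t ht).trans).colExt (c := r₂ t + 1) (fun x hx => ((h5 t ht).1.b x hx).1), (h5 t ht).2]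
      congr 2; ring
  · rintro ⟨As, N, X, Y, r, h0, C, K⟩
    subst h0
    have S := fun t ht => ((C.g 0).1 t ht).1.s
    have h5' : ∀ t, ∃ r₂, t < s → ∀ p : ℕ, p < μ t → 1 ≤ Y t (r₂ + 1 + p) ∧ Y t (r₂ + 1 + p) ≤ n := by
      intro t
      by_cases ht : t < s
      · obtain ⟨r₂, h⟩ := ((K.y t ht).seq (S t ht).trans).norm hn; exact ⟨r₂, fun _ => h⟩
      · exact ⟨0, fun h => absurd h ht⟩
    choose r₂ h5 using h5'
    refine ⟨P, fun x t => Y t (r₂ t + 1 + x), fun t => r t - r₂ t, (kappa0_iff hA hm hn).2 ⟨As, N, rfl, C, fun t ht =>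
      ⟨fun k => (X t k, Y t k), r t, r₂ t, ⟨fun k => ⟨K.x t ht k, K.y t ht k⟩, fun p hp => ?_, fun p hp => ?_⟩, rfl⟩⟩, fun t ht x hx => ⟨rfl, ?_⟩, K.zp, K.zq, K.mu⟩
    · have := K.nr t ht p hp
      rw [← K.p t ht p hp] at this
      exact ⟨K.p t ht p hp, this⟩
    · exact ⟨rfl, h5 t ht p hp⟩
    · rw [K.q t ht x hx]
      show _ = AffineRSK.colExt n (μ t) (fun y => Y t (r₂ t + 1 + y)) ((x : ℤ) + (r t - r₂ t + _))
      rw [((K.y t ht).seq (S t ht).trans).colExt (c := r₂ t + 1) (fun x hx => rfl)]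
      congr 1; ring

theorem SOp.chv (O : SOp m i s t₀ X X') (k : ℤ) : X t₀ k ≤ X' t₀ k ∧ (X' t₀ k ≠ X t₀ k → ∃ q : ℤ, X t₀ k = i + q * m ∧ X' t₀ k = i + q * m + 1) := by
  rw [O.ch]
  split
  · rename_i h; obtain ⟨q, h⟩ := h
    exact ⟨by omega, fun _ => ⟨q, h, by rw [h]⟩⟩
  · exact ⟨le_rfl, fun h => absurd rfl h⟩

theorem IsSeq.ex {Z : ℤ → ℤ} (h : IsSeq m l Z) {v q : ℤ} : (∃ k, Z k = v + q * m) ↔ ∃ k, Z k = v := by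
  constructor
  · rintro ⟨k, hk⟩
    refine ⟨k + (-q) * l, ?_⟩
    rw [h.perq, hk]; ring
  · rintro ⟨k, hk⟩
    refine ⟨k + q * l, ?_⟩
    rw [h.perq, hk]

theorem SOp.pair (O : SOp m i s t₀ X X') (hs : ∀ t < s, IsSeq m (μ t) (X t)) (hs' : ∀ t < s, IsSeq m (μ t) (X' t)) {u : ℕ} (hu : u + 1 < s)
    (c d : ℤ) : (∀ z, X u (c + z) ≤ X (u + 1) (d + z)) ↔ ∀ z, X' u (c + z) ≤ X' (u + 1) (d + z) := by
  have w : ∀ Z : ℤ → ℤ, ∀ k, Z (k + 1 - 1) = Z k := fun Z k => by rw [add_sub_cancel_right]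
  by_cases h1 : u = t₀
  · subst h1
    rw [O.same (u + 1) hu (by omega)]
    constructor
    · intro h z
      by_contra hc
      obtain ⟨a, b⟩ := O.chv (c + z)
      have h0 := h z
      obtain ⟨q, h2, h3⟩ := b (by omega)
      have h4 : X (u + 1) (d + z) = i + q * m := by omega
      obtain ⟨k, hk⟩ := ((hs (u + 1) hu).ex (q := q)).2 (O.rgt hu ((hs (u + 1) hu).ex.1 ⟨_, h4⟩))
      have h5 : d + z < k := (hs (u + 1) hu).lt.lt_iff_lt.1 (by omega)
      have h6 : X (u + 1) (d + (z + 1)) ≤ X (u + 1) k := (hs (u + 1) hu).lt.monotone (by omega)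
      have h7 := h (z + 1)
      have h8 : X u (c + z) < X u (c + (z + 1)) := (hs u (by omega)).lt (by omega)
      obtain ⟨k, hk⟩ := (hs u (by omega)).ex.1 ⟨c + (z + 1), show X u (c + (z + 1)) = i + 1 + q * m by omega⟩
      exact O.not _ hk
    · exact fun h z => (O.chv (c + z)).1.trans (h z)
  rw [O.same u (by omega) h1]
  by_cases h2 : u + 1 = t₀
  · subst h2
    constructor
    · exact fun h z => (h z).trans (O.chv (d + z)).1
    · intro h z
      by_contra hc
      obtain ⟨a, b⟩ := O.chv (d + z)
      have h0 := h z
      obtain ⟨q, h2, h3⟩ := b (by omega)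
      have h4 : X u (c + z) = i + 1 + q * m := by omega
      obtain ⟨k, hk⟩ := ((hs u (by omega)).ex (q := q)).2 (O.lft u rfl ((hs u (by omega)).ex.1 ⟨_, h4⟩))
      have h5 : k < c + z := (hs u (by omega)).lt.lt_iff_lt.1 (by omega)
      have h6 : X u k ≤ X u (c + (z - 1)) := (hs u (by omega)).lt.monotone (by omega)
      have h7 := h (z - 1)
      have h8 : X' (u + 1) (d + (z - 1)) < X' (u + 1) (d + z) := (hs' _ hu).lt (by omega)
      have h9 : X (u + 1) (d + (z - 1)) < X (u + 1) (d + z) := (hs _ hu).lt (by omega)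
      obtain ⟨a', b'⟩ := O.chv (d + (z - 1))
      by_cases hh : X' (u + 1) (d + (z - 1)) = X (u + 1) (d + (z - 1))
      · omega
      · obtain ⟨q', h10, h11⟩ := b' hh
        have : X' (u + 1) (d + (z - 1)) = i + q * m := by omega
        have h12 : X (u + 1) (d + (z - 1)) = i + (q - 1) * m + (m - 1) := by linarith
        have h13 : (q' : ℤ) * m + 1 = q * m := by omega
        exact (by
          have h14 : (m : ℤ) ∣ 1 := ⟨q - q', by linarith⟩
          have h15 := Int.le_of_dvd one_pos h14
          have h16 := O.not
          obtain ⟨k, hk⟩ := O.has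
          have h17 : (m : ℤ) = 1 := by
            have : 0 < m := Nat.pos_of_ne_zero fun h => by simp [h] at h14
            omega
          apply h16 (k + μ (u + 1))
          rw [(hs _ hu).per, hk, h17])
  · rw [O.same (u + 1) hu h2]

theorem SOp.eta (O : SOp m i s t₀ X X') (hs : ∀ t < s, IsSeq m (μ t) (X t)) (hs' : ∀ t < s, IsSeq m (μ t) (X' t))
    (mo : ∀ t t', t ≤ t' → t' < s → μ t' ≤ μ t)
    (hP : ∀ t < s, ∀ x : ℕ, x < μ t → P x t = X t (r t + 1 + x)) (hP' : ∀ t < s, ∀ x : ℕ, x < μ t → P' x t = X' t (r t + 1 + x))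
    {t : ℕ} (ht : t < s) : etaCol m μ P t = etaCol m μ P' t := by
  refine eta_congr mo (fun u hu hmu r' => ?_) ht
  rw [pair_iff (hs u (by omega)) (by rw [hmu]; exact hs (u + 1) hu) (hP u (by omega)) (by rw [hmu]; exact hP (u + 1) hu),
    pair_iff (hs' u (by omega)) (by rw [hmu]; exact hs' (u + 1) hu) (hP' u (by omega)) (by rw [hmu]; exact hP' (u + 1) hu)]
  exact O.pair hs hs' hu _ _

end

section
variable {m n l s : ℕ} {A A' : Mat} {i : ℤ} {μ : ℕ → ℕ} {As As' : ℕ → Mat} {N N' : ℕ → ℤ → ℤ → ℤ} {t₀ : ℕ} {X X' Y : ℕ → ℤ → ℤ}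
  {P P' Q : ℕ → ℕ → ℤ} {r : ℕ → ℤ} {G : (ℤ → ℤ → ℤ) → ℤ → Prop}

/-! ### Row operators -/

theorem q0 {i v q : ℤ} (h1 : 1 ≤ i) (h2 : i ≤ m) (h3 : 1 ≤ v) (h4 : v ≤ m) (h : v = i + q * m) : v = i := by
  have : q = 0 := by
    by_contra hc
    rcases lt_or_gt_of_ne hc with hc | hc
    · nlinarith
    · nlinarith
  rw [h, this]; ring

theorem xr_ex (C : GChain G m n s As μ N) (hA : IsGAP m n (As 0)) (hm : 0 < m) (hn : 0 < n) : ∃ X : ℕ → ℤ → ℤ, ∀ t < s, XR (N t) (X t) := by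
  have : ∀ t k, ∃ x, t < s → Rg (N t) k x ∧ ¬ Rg (N t) k (x - 1) := by
    intro t k
    by_cases ht : t < s
    · obtain ⟨c, hc⟩ := (C.1 t ht).1.s.bp (C.gap hA hm hn t ht.le) hm hn k
      exact ⟨c.1, fun _ => hc.1⟩
    · exact ⟨0, fun h => absurd h ht⟩
  choose X hX using this
  exact ⟨X, fun t ht k => hX t k ht⟩

theorem KD.has (K : KD m n s μ N X Y r P Q) (hs : ∀ t < s, IsSeq m (μ t) (X t)) {v : ℤ} (h1 : 1 ≤ v) (h2 : v ≤ m) {t : ℕ} (ht : t < s) :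
    (∃ x < μ t, P x t = v) ↔ ∃ k, X t k = v := by
  constructor
  · rintro ⟨x, hx, h⟩; exact ⟨_, (K.p t ht x hx).symm.trans h⟩
  · rintro ⟨k, hk⟩
    obtain ⟨p, hp, q, hq⟩ := (hs t ht).rep (r t + 1) k
    refine ⟨p, hp, ?_⟩
    rw [K.p t ht p hp]
    obtain ⟨a, b⟩ := K.nr t ht p hp
    rw [hq, (hs t ht).perq] at hk
    exact q0 (q := -q) h1 h2 a b (by linarith)

theorem KD.plus (K : KD m n s μ N X Y r P Q) (hs : ∀ t < s, IsSeq m (μ t) (X t)) (h1 : 1 ≤ i) (h2 : i ≤ (m : ℤ) - 1) (t : ℕ) :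
    PhasPlus μ P i t ↔ t < s ∧ (∃ k, X t k = i) ∧ ¬ ∃ k, X t k = i + 1 := by
  by_cases ht : t < s
  · rw [← K.has hs h1 (by omega) ht, ← K.has hs (v := i + 1) (by omega) (by omega) ht]
    simp [PhasPlus, ht]
  · simp [PhasPlus, ht, K.mu t (by omega)]

theorem KD.minus (K : KD m n s μ N X Y r P Q) (hs : ∀ t < s, IsSeq m (μ t) (X t)) (h1 : 1 ≤ i) (h2 : i ≤ (m : ℤ) - 1) (t : ℕ) :
    PhasMinus μ P i t ↔ t < s ∧ (∃ k, X t k = i + 1) ∧ ¬ ∃ k, X t k = i := by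
  by_cases ht : t < s
  · rw [← K.has hs h1 (by omega) ht, ← K.has hs (v := i + 1) (by omega) (by omega) ht]
    simp [PhasMinus, ht]
  · simp [PhasMinus, ht, K.mu t (by omega)]

theorem xr_col {N N' : ℤ → ℤ → ℤ} (h : ∀ k y, Gc y N' k ↔ Gc y N k) {Y : ℤ → ℤ} (hY : XR (trN N) Y) : XR (trN N') Y :=
  fun k => ⟨(h k (Y k)).2 (hY k).1, fun h' => (hY k).2 ((h k (Y k - 1)).1 h')⟩

theorem row_f (hA : IsGAP m n A) (hm : 2 ≤ m) (hn : 0 < n) (h0 : As 0 = A) (C : Chain m n s As μ N) (K : KD m n s μ N X Y r P Q)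
    (h1 : 1 ≤ i) (h2 : i ≤ (m : ℤ) - 1) (h : fMat m n i A = some A') :
    ∃ t₀ < s, PSurvPlus μ P i t₀ ∧ (∀ t < s, PSurvPlus μ P i t → t ≤ t₀) ∧ KappaRel m n A' s μ (applyPF μ P i t₀) Q := by
  obtain ⟨D, j, F⟩ := fMat_some hA hm hn h
  have hm' : 0 < m := by omega
  have hA' := F.gap' hA hn
  obtain ⟨Bs, Bs', N1, N', t₀, b0, b0', T, e1, e2⟩ := multi (gInv_c hm i 0) hm hn true s F hA As N (C.g 0) (by simpa using h0)
  subst e1 e2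
  have g : IsGAP m n (Bs 0) := by rw [b0]; exact hA
  have g' : IsGAP m n (Bs' 0) := by rw [b0']; exact hA'
  obtain ⟨X', hX'⟩ := xr_ex T.c' g' hm' hn
  have O := T.sop hm K.x hX'
  have hs := fun t ht => (K.x t ht).seq (T.c.1 t ht).1.s
  have hs' := fun t ht => (hX' t ht).seq (T.c'.1 t ht).1.s
  obtain ⟨a, b⟩ := surv_f T hm K.x hX' (K.plus hs h1 h2) (K.minus hs h1 h2)
  refine ⟨t₀, O.lt, a, fun t _ h => b t h, ?_⟩
  have key : ∀ t < s, ∀ x : ℕ, x < μ t → applyPF μ P i t₀ x t = X' t (r t + 1 + x) ∧ 1 ≤ X' t (r t + 1 + x) ∧ X' t (r t + 1 + x) ≤ m := by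
    intro t ht x hx
    have n1 := K.nr t ht x hx
    have p1 := K.p t ht x hx
    unfold applyPF
    by_cases htt : t = t₀
    · subst htt
      obtain ⟨c1, c2⟩ := O.chv (r t + 1 + x)
      by_cases hh : X' t (r t + 1 + x) = X t (r t + 1 + x)
      · rw [if_neg, hh]
        · exact ⟨p1, n1⟩
        · rintro ⟨-, -, h3⟩
          have := O.ch (r t + 1 + x)
          rw [if_pos ⟨0, by rw [← p1, h3]; ring⟩] at this
          omega
      · obtain ⟨q, h3, h4⟩ := c2 hh
        have h5 := q0 h1 (by omega) n1.1 n1.2 h3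
        rw [if_pos ⟨rfl, hx, by rw [p1, h5]⟩]
        omega
    · rw [if_neg fun h => htt h.1, O.same t ht htt]
      exact ⟨p1, n1⟩
  refine (kappa_iff hA' hm' hn).2 ⟨Bs', N', X', Y, r, b0', T.c'.chain g' hm' hn, hX', fun t ht => ?_, fun t ht p hp => (key t ht p hp).2,
    fun t ht x hx => (key t ht x hx).1, fun t ht x hx => ?_, fun x t hx => ?_, K.zq, K.mu⟩
  · exact xr_col (T.r.col t ht) (K.y t ht)
  · rw [← O.eta hs hs' (fun a b hab hb => (C.g 0).mu g hm' hn hab hb) K.p (fun t ht x hx => (key t ht x hx).1) ht]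
    exact K.q t ht x hx
  · unfold applyPF
    rw [if_neg, K.zp x t hx]
    rintro ⟨e, h, -⟩
    have := O.lt
    omega

theorem row_e (hA : IsGAP m n A) (hm : 2 ≤ m) (hn : 0 < n) (h0 : As 0 = A) (C : Chain m n s As μ N) (K : KD m n s μ N X Y r P Q)
    (h1 : 1 ≤ i) (h2 : i ≤ (m : ℤ) - 1) (h : eMat m n i A = some A') :
    ∃ t₀ < s, PSurvMinus μ P i t₀ ∧ (∀ t < s, PSurvMinus μ P i t → t₀ ≤ t) ∧ KappaRel m n A' s μ (applyPE μ P i t₀) Q := by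
  obtain ⟨hA', D, j, F⟩ := eMat_some hA hm hn h
  have hm' : 0 < m := by omega
  obtain ⟨Bs', Bs, N', N1, t₀, b0', b0, T, e1, e2⟩ := multi (gInv_c hm i 0) hm hn false s F hA' As N (C.g 0) (by simpa using h0)
  subst e1 e2
  have g : IsGAP m n (Bs 0) := by rw [b0]; exact hA
  have g' : IsGAP m n (Bs' 0) := by rw [b0']; exact hA'
  obtain ⟨X', hX'⟩ := xr_ex T.c g' hm' hn
  have O := T.sop hm hX' K.x
  have hs := fun t ht => (K.x t ht).seq (T.c'.1 t ht).1.s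
  have hs' := fun t ht => (hX' t ht).seq (T.c.1 t ht).1.s
  obtain ⟨a, b⟩ := surv_e T hm hX' K.x (K.plus hs h1 h2) (K.minus hs h1 h2)
  refine ⟨t₀, O.lt, a, fun t _ h => b t h, ?_⟩
  have key : ∀ t < s, ∀ x : ℕ, x < μ t → applyPE μ P i t₀ x t = X' t (r t + 1 + x) ∧ 1 ≤ X' t (r t + 1 + x) ∧ X' t (r t + 1 + x) ≤ m := by
    intro t ht x hx
    have n1 := K.nr t ht x hx
    have p1 := K.p t ht x hx
    unfold applyPE
    by_cases htt : t = t₀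
    · subst htt
      obtain ⟨c1, c2⟩ := O.chv (r t + 1 + x)
      by_cases hh : X t (r t + 1 + x) = X' t (r t + 1 + x)
      · rw [if_neg, ← hh]
        · exact ⟨p1, n1⟩
        · rintro ⟨-, -, h3⟩
          exact O.not (r t + 1 + x) (by rw [← hh, ← p1, h3])
      · obtain ⟨q, h3, h4⟩ := c2 hh
        have h5 := q0 (i := i + 1) (q := q) (by omega) (by omega) n1.1 n1.2 (by linarith)
        rw [if_pos ⟨rfl, hx, by rw [p1, h5]⟩]
        omega
    · rw [if_neg fun h => htt h.1, ← O.same t ht htt]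
      exact ⟨p1, n1⟩
  refine (kappa_iff hA' hm' hn).2 ⟨Bs', N', X', Y, r, b0', T.c.chain g' hm' hn, hX', fun t ht => ?_, fun t ht p hp => (key t ht p hp).2,
    fun t ht x hx => (key t ht x hx).1, fun t ht x hx => ?_, fun x t hx => ?_, K.zq, K.mu⟩
  · exact xr_col (fun k y => (T.r.col t ht k y).symm) (K.y t ht)
  · rw [O.eta hs' hs (fun a b hab hb => (C.g 0).mu g hm' hn hab hb) (fun t ht x hx => (key t ht x hx).1) K.p ht]
    exact K.q t ht x hx
  · unfold applyPE
    rw [if_neg, K.zp x t hx]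
    rintro ⟨e, h, -⟩
    have := O.lt
    omega

end

section
variable {m n l s : ℕ} {A A' : Mat} {j : ℤ} {μ : ℕ → ℕ} {As As' : ℕ → Mat} {N N' : ℕ → ℤ → ℤ → ℤ} {t₀ : ℕ} {X X' Y : ℕ → ℤ → ℤ}
  {P P' Q : ℕ → ℕ → ℤ} {r : ℕ → ℤ} {G : (ℤ → ℤ → ℤ) → ℤ → Prop} {Z : ℤ → ℤ}

/-! ### Column operators -/

theorem IsSeq.up (h : IsSeq n l Z) {k q : ℤ} (hk : Z k = j + q * n) : Z k + 1 < Z (k + 1) ↔ ¬ ∃ k', Z k' = j + 1 := by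
  rw [← h.ex (q := q), not_exists]
  have h2 := h.inc k
  constructor
  · intro h1 k' hk'
    have h3 : k < k' := h.lt.lt_iff_lt.1 (by omega)
    have := h.lt.monotone (show k + 1 ≤ k' by omega)
    omega
  · intro h1
    have := h1 (k + 1)
    omega

theorem IsSeq.dn (h : IsSeq n l Z) {k q : ℤ} (hk : Z k = j + 1 + q * n) : Z (k - 1) < Z k - 1 ↔ ¬ ∃ k', Z k' = j := by
  rw [← h.ex (q := q), not_exists]
  have h2 := h.lt (show k - 1 < k by omega)
  constructor
  · intro h1 k' hk'
    have h3 : k' < k := h.lt.lt_iff_lt.1 (by omega)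
    have := h.lt.monotone (show k' ≤ k - 1 by omega)
    omega
  · intro h1
    have := h1 (k - 1)
    omega

theorem em_iff {v w : ℤ} : Int.emod v (n : ℤ) = Int.emod w (n : ℤ) ↔ ∃ q : ℤ, v = w + q * n := by
  show v % n = w % n ↔ _
  rw [eq_comm]
  show w ≡ v [ZMOD n] ↔ _
  rw [Int.modEq_iff_dvd]
  constructor
  · rintro ⟨q, hq⟩; exact ⟨q, by linarith⟩
  · rintro ⟨q, hq⟩; exact ⟨q, by linarith⟩

theorem em_j (h0 : 0 ≤ j) (h1 : j ≤ (n : ℤ) - 1) {v : ℤ} : Int.emod v (n : ℤ) = j ↔ ∃ q : ℤ, v = j + q * n := by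
  rw [← em_iff, show Int.emod j (n : ℤ) = j from Int.emod_eq_of_lt h0 (by omega)]

theorem mov_up (h : IsSeq n l Z) {a : ℕ → ℤ} {c : ℤ} (ha : ∀ x < l, a x = Z (c + x)) {k : ℕ} (hk : k < l) :
    QmovUp n l a k ↔ Z (c + k) + 1 < Z (c + k + 1) := by
  unfold QmovUp
  by_cases h1 : k + 1 < l
  · rw [ha k hk, ha (k + 1) h1]
    push_cast
    rw [← add_assoc]
    constructor
    · rintro (h | h)
      · exact h.2
      · omega
    · exact fun h => Or.inl ⟨h1, h⟩
  · have h2 : k + 1 = l := by omega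
    have h3 := h.per c
    rw [show l - 1 = k by omega, ha k hk, ha 0 h.lpos, show c + (k : ℤ) + 1 = c + l by omega, h3]
    simp only [Nat.cast_zero, add_zero]
    constructor
    · rintro (h | h) <;> omega
    · exact fun h => Or.inr ⟨h2, by omega⟩

theorem mov_dn (h : IsSeq n l Z) {a : ℕ → ℤ} {c : ℤ} (ha : ∀ x < l, a x = Z (c + x)) {k : ℕ} (hk : k < l) :
    QmovDown n l a k ↔ Z (c + k - 1) < Z (c + k) - 1 := by
  unfold QmovDown
  by_cases h1 : 0 < k
  · rw [ha k hk, ha (k - 1) (by omega), show c + ((k - 1 : ℕ) : ℤ) = c + k - 1 by omega]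
    constructor
    · rintro (h | h)
      · exact h.2
      · omega
    · exact fun h => Or.inl ⟨h1, h⟩
  · have h2 : k = 0 := by omega
    subst h2
    have h3 := h.per (c - 1)
    have := h.lpos
    rw [ha _ (show l - 1 < l by omega), ha 0 h.lpos, show c + ((l - 1 : ℕ) : ℤ) = c - 1 + l by omega, h3]
    simp only [Nat.cast_zero, add_zero]
    constructor
    · rintro (h | h) <;> omega
    · exact fun h => Or.inr ⟨trivial, by omega⟩

theorem KD.qplus (K : KD m n s μ N X Y r P Q) (hs : ∀ t < s, IsSeq n (μ t) (Y t)) (h1 : 0 ≤ j) (h2 : j ≤ (n : ℤ) - 1) (t : ℕ) :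
    QhasPlus n μ Q j t ↔ t < s ∧ (∃ k, Y t k = j) ∧ ¬ ∃ k, Y t k = j + 1 := by
  unfold QhasPlus
  by_cases ht : t < s
  · have S := hs t ht
    constructor
    · rintro ⟨k, hk, h3, h4⟩
      rw [em_j h1 h2, K.q t ht k hk] at h3
      rw [mov_up S (K.q t ht) hk] at h4
      obtain ⟨q, h3⟩ := h3
      exact ⟨ht, S.ex.1 ⟨_, h3⟩, (S.up h3).1 h4⟩
    · rintro ⟨-, ⟨k, hk⟩, h4⟩
      obtain ⟨p, hp, q, hq⟩ := S.rep (r t + 1 + etaCol m μ P t) k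
      rw [hq, S.perq] at hk
      have h3 : Y t (r t + 1 + etaCol m μ P t + p) = j + (-q) * n := by linarith
      refine ⟨p, hp, ?_, ?_⟩
      · rw [em_j h1 h2, K.q t ht p hp]; exact ⟨_, h3⟩
      · rw [mov_up S (K.q t ht) hp]; exact (S.up h3).2 h4
  · simp [ht, K.mu t (by omega)]

theorem KD.qminus (K : KD m n s μ N X Y r P Q) (hs : ∀ t < s, IsSeq n (μ t) (Y t)) (t : ℕ) :
    QhasMinus n μ Q j t ↔ t < s ∧ (∃ k, Y t k = j + 1) ∧ ¬ ∃ k, Y t k = j := by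
  unfold QhasMinus
  by_cases ht : t < s
  · have S := hs t ht
    constructor
    · rintro ⟨k, hk, h3, h4⟩
      rw [em_iff, K.q t ht k hk] at h3
      rw [mov_dn S (K.q t ht) hk] at h4
      obtain ⟨q, h3⟩ := h3
      exact ⟨ht, S.ex.1 ⟨_, h3⟩, (S.dn h3).1 h4⟩
    · rintro ⟨-, ⟨k, hk⟩, h4⟩
      obtain ⟨p, hp, q, hq⟩ := S.rep (r t + 1 + etaCol m μ P t) k
      rw [hq, S.perq] at hk
      have h3 : Y t (r t + 1 + etaCol m μ P t + p) = j + 1 + (-q) * n := by linarith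
      refine ⟨p, hp, ?_, ?_⟩
      · rw [em_iff, K.q t ht p hp]; exact ⟨_, h3⟩
      · rw [mov_dn S (K.q t ht) hp]; exact (S.dn h3).2 h4
  · simp [ht, K.mu t (by omega)]

theorem col_f (hA : IsGAP m n A) (hm : 0 < m) (hn : 2 ≤ n) (h0 : As 0 = A) (C : Chain m n s As μ N) (K : KD m n s μ N X Y r P Q)
    (h1 : 0 ≤ j) (h2 : j ≤ (n : ℤ) - 1) (h : fMatT m n j A = some A') :
    ∃ t₀ < s, QSurvPlus n μ Q j t₀ ∧ (∀ t < s, QSurvPlus n μ Q j t → t ≤ t₀) ∧ KappaRel m n A' s μ P (applyQF n μ Q j t₀) := by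
  obtain ⟨B, hB, rfl⟩ := Option.map_eq_some_iff.1 h
  have hn' : 0 < n := by omega
  have hT := hA.trans hm hn'
  obtain ⟨D, c, F⟩ := fMat_some hT hn hm hB
  have hB' := F.gap' hT hm
  obtain ⟨Bs, Bs', N1, N', t₀, b0, b0', T, e1, e2⟩ := multi (gInv_r hn j) hn hm true s F hT _ _ (C.g (j + 1)).tr (by simp [h0])
  subst e1 e2
  have g' : IsGAP n m (Bs' 0) := by rw [b0']; exact hB'
  obtain ⟨Y', hY'⟩ := xr_ex T.c' g' hn' hm
  have O := T.sop hn K.y hY'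
  have hs := fun t ht => (K.y t ht).seq (T.c.1 t ht).1.s
  obtain ⟨a, b⟩ := surv_f T hn K.y hY' (K.qplus hs h1 h2) (K.qminus hs)
  refine ⟨t₀, O.lt, a, fun t _ h => b t h, ?_⟩
  refine (kappa_iff (hB'.trans hn' hm) hm hn').2 ⟨_, _, X, Y', r, by simp only [b0'], T.c'.tr'.chain (g'.trans hn' hm) hm hn',
    fun t ht => ?_, hY', K.nr, K.p, fun t ht x hx => ?_, K.zp, fun x t hx => ?_, K.mu⟩
  · exact xr_col (T.r.col t ht) (N := trN (N t)) (K.x t ht)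
  · have q1 := K.q t ht x hx
    unfold applyQF
    by_cases htt : t = t₀
    · subst htt
      have e1 : Int.emod (Q x t) (n : ℤ) = j ↔ ∃ q : ℤ, Y t (r t + 1 + etaCol m μ P t + x) = j + q * n := by rw [em_j h1 h2, q1]
      rw [O.ch]
      by_cases hh : ∃ q : ℤ, Y t (r t + 1 + etaCol m μ P t + x) = j + q * n
      · rw [if_pos hh, if_pos, q1]
        refine ⟨rfl, hx, e1.2 hh, ?_⟩
        obtain ⟨q, hq⟩ := hh
        rw [mov_up (hs t ht) (K.q t ht) hx, (hs t ht).up hq]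
        rintro ⟨k, hk⟩; exact O.not k hk
      · rw [if_neg hh, if_neg fun h => hh (e1.1 h.2.2.1), q1]
    · rw [if_neg fun h => htt h.1, O.same t ht htt]
      exact q1
  · unfold applyQF
    rw [if_neg, K.zq x t hx]
    rintro ⟨e, h, -⟩
    have := O.lt
    omega

theorem col_e (hA : IsGAP m n A) (hm : 0 < m) (hn : 2 ≤ n) (h0 : As 0 = A) (C : Chain m n s As μ N) (K : KD m n s μ N X Y r P Q)
    (h1 : 0 ≤ j) (h2 : j ≤ (n : ℤ) - 1) (h : eMatT m n j A = some A') :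
    ∃ t₀ < s, QSurvMinus n μ Q j t₀ ∧ (∀ t < s, QSurvMinus n μ Q j t → t₀ ≤ t) ∧ KappaRel m n A' s μ P (applyQE n μ Q j t₀) := by
  obtain ⟨B, hB, rfl⟩ := Option.map_eq_some_iff.1 h
  have hn' : 0 < n := by omega
  have hT := hA.trans hm hn'
  obtain ⟨hB', D, c, F⟩ := eMat_some hT hn hm hB
  obtain ⟨Bs', Bs, N', N1, t₀, b0', b0, T, e1, e2⟩ := multi (gInv_r hn j) hn hm false s F hB' _ _ (C.g (j + 1)).tr (by simp [h0])
  subst e1 e2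
  have g' : IsGAP n m (Bs' 0) := by rw [b0']; exact hB'
  obtain ⟨Y', hY'⟩ := xr_ex T.c g' hn' hm
  have O := T.sop hn hY' K.y
  have hs := fun t ht => (K.y t ht).seq (T.c'.1 t ht).1.s
  have hs' := fun t ht => (hY' t ht).seq (T.c.1 t ht).1.s
  obtain ⟨a, b⟩ := surv_e T hn hY' K.y (K.qplus hs h1 h2) (K.qminus hs)
  refine ⟨t₀, O.lt, a, fun t _ h => b t h, ?_⟩
  refine (kappa_iff (hB'.trans hn' hm) hm hn').2 ⟨_, _, X, Y', r, by simp only [b0'], T.c.tr'.chain (g'.trans hn' hm) hm hn',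
    fun t ht => ?_, hY', K.nr, K.p, fun t ht x hx => ?_, K.zp, fun x t hx => ?_, K.mu⟩
  · exact xr_col (fun k y => (T.r.col t ht k y).symm) (N := trN (N t)) (K.x t ht)
  · have q1 := K.q t ht x hx
    unfold applyQE
    by_cases htt : t = t₀
    · subst htt
      obtain ⟨c1, c2⟩ := O.chv (r t + 1 + etaCol m μ P t + x)
      have e1 : Int.emod (Q x t) (n : ℤ) = Int.emod (j + 1) (n : ℤ) ↔ ∃ q : ℤ, Y t (r t + 1 + etaCol m μ P t + x) = j + 1 + q * n := by rw [em_iff, q1]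
      by_cases hh : Y t (r t + 1 + etaCol m μ P t + x) = Y' t (r t + 1 + etaCol m μ P t + x)
      · rw [if_neg, q1, hh]
        rintro ⟨-, -, hq, -⟩
        obtain ⟨q, hq⟩ := e1.1 hq
        rw [hh] at hq
        obtain ⟨k, hk⟩ := (hs' t ht).ex.1 ⟨_, hq⟩
        exact O.not k hk
      · obtain ⟨q, h3, h4⟩ := c2 hh
        have h5 : Y t (r t + 1 + etaCol m μ P t + x) = j + 1 + q * n := by linarith
        rw [if_pos]
        · omega
        refine ⟨rfl, hx, e1.2 ⟨q, h5⟩, ?_⟩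
        rw [mov_dn (hs t ht) (K.q t ht) hx, (hs t ht).dn h5]
        exact ((K.qminus hs t).1 a.1).2.2
    · rw [if_neg fun h => htt h.1, ← O.same t ht htt]
      exact q1
  · unfold applyQE
    rw [if_neg, K.zq x t hx]
    rintro ⟨e, h, -⟩
    have := O.lt
    omega

end

/-- For `m, n ≥ 2`, the affine RSK bijection `κ` commutes
with the crystal operators: `κ(f̃_i A) = f̃_i κ(A)` and `κ(ẽ_i A) = ẽ_i κ(A)`
for `i ∈ {1, …, m-1}` (acting on the `P`-component), and
`κ(f̃^t_j A) = f̃^t_j κ(A)`, `κ(ẽ^t_j A) = ẽ^t_j κ(A)` for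
`j ∈ {0, 1, …, n-1}` (acting on the `Q`-component), with the convention
`κ(0) = 0`. The operators on the tableau components act by the signature rule
on the tensor product of the columns read from right to left: `f̃` acts on
the rightmost column carrying a surviving `+` and `ẽ` on the leftmost column
carrying a surviving `-`. -/
theorem affine_RSK_crystal_equivariance (m n : ℕ) (hm : 2 ≤ m) (hn : 2 ≤ n)
    (A : Mat) (hA : IsGAP m n A)
    (s : ℕ) (μ : ℕ → ℕ) (P Q : ℕ → ℕ → ℤ) (hκ : KappaRel m n A s μ P Q) :
    (∀ i : ℤ, 1 ≤ i → i ≤ (m : ℤ) - 1 →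
      ((fMat m n i A = none ↔ ¬ ∃ t < s, PSurvPlus μ P i t) ∧
        ∀ A' : Mat, fMat m n i A = some A' →
          ∃ t₀ < s, PSurvPlus μ P i t₀ ∧ (∀ t < s, PSurvPlus μ P i t → t ≤ t₀) ∧
            KappaRel m n A' s μ (applyPF μ P i t₀) Q)) ∧
    (∀ i : ℤ, 1 ≤ i → i ≤ (m : ℤ) - 1 →
      ((eMat m n i A = none ↔ ¬ ∃ t < s, PSurvMinus μ P i t) ∧
        ∀ A' : Mat, eMat m n i A = some A' →
          ∃ t₀ < s, PSurvMinus μ P i t₀ ∧ (∀ t < s, PSurvMinus μ P i t → t₀ ≤ t) ∧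
            KappaRel m n A' s μ (applyPE μ P i t₀) Q)) ∧
    (∀ j : ℤ, 0 ≤ j → j ≤ (n : ℤ) - 1 →
      ((fMatT m n j A = none ↔ ¬ ∃ t < s, QSurvPlus n μ Q j t) ∧
        ∀ A' : Mat, fMatT m n j A = some A' →
          ∃ t₀ < s, QSurvPlus n μ Q j t₀ ∧ (∀ t < s, QSurvPlus n μ Q j t → t ≤ t₀) ∧
            KappaRel m n A' s μ P (applyQF n μ Q j t₀))) ∧
    ∀ j : ℤ, 0 ≤ j → j ≤ (n : ℤ) - 1 →
      ((eMatT m n j A = none ↔ ¬ ∃ t < s, QSurvMinus n μ Q j t) ∧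
        ∀ A' : Mat, eMatT m n j A = some A' →
          ∃ t₀ < s, QSurvMinus n μ Q j t₀ ∧ (∀ t < s, QSurvMinus n μ Q j t → t₀ ≤ t) ∧
            KappaRel m n A' s μ P (applyQE n μ Q j t₀)) := by
  have hm' : 0 < m := by omega
  have hn' : 0 < n := by omega
  obtain ⟨As, N, X, Y, r, h0, C, K⟩ := (kappa_iff hA hm' hn').1 hκ
  have hs := fun t ht => (K.x t ht).seq ((C.g 0).1 t ht).1.s
  have hy := fun t ht => (K.y t ht).seq ((C.g 0).1 t ht).1.s.trans
  have hT := hA.trans hm' hn'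
  have hT0 : (fun t => transM (As t)) 0 = transM A := by simp only [h0]
  refine ⟨fun i h1 h2 => ⟨⟨fun h => ?_, fun h => ?_⟩, fun A' h => row_f hA hm hn' h0 C K h1 h2 h⟩,
    fun i h1 h2 => ⟨⟨fun h => ?_, fun h => ?_⟩, fun A' h => row_e hA hm hn' h0 C K h1 h2 h⟩,
    fun i h1 h2 => ⟨⟨fun h => ?_, fun h => ?_⟩, fun A' h => col_f hA hm' hn h0 C K h1 h2 h⟩,
    fun i h1 h2 => ⟨⟨fun h => ?_, fun h => ?_⟩, fun A' h => col_e hA hm' hn h0 C K h1 h2 h⟩⟩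
  · rintro ⟨t, -, ht⟩
    exact none_f hA hm hn' h (C.g 0) h0 K.x (K.plus hs h1 h2) (K.minus hs h1 h2) t ht
  · by_contra hc
    obtain ⟨A', hA'⟩ := Option.ne_none_iff_exists'.1 hc
    obtain ⟨t, ht, h3, -⟩ := row_f hA hm hn' h0 C K h1 h2 hA'
    exact h ⟨t, ht, h3⟩
  · rintro ⟨t, -, ht⟩
    exact none_e hA hm hn' h (C.g 0) h0 K.x (K.plus hs h1 h2) (K.minus hs h1 h2) t ht
  · by_contra hc
    obtain ⟨A', hA'⟩ := Option.ne_none_iff_exists'.1 hc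
    obtain ⟨t, ht, h3, -⟩ := row_e hA hm hn' h0 C K h1 h2 hA'
    exact h ⟨t, ht, h3⟩
  · rintro ⟨t, -, ht⟩
    exact none_f hT hn hm' (Option.map_eq_none_iff.1 h) (C.g 0).tr hT0 K.y (K.qplus hy h1 h2) (K.qminus hy) t ht
  · by_contra hc
    obtain ⟨A', hA'⟩ := Option.ne_none_iff_exists'.1 hc
    obtain ⟨t, ht, h3, -⟩ := col_f hA hm' hn h0 C K h1 h2 hA'
    exact h ⟨t, ht, h3⟩
  · rintro ⟨t, -, ht⟩
    exact none_e hT hn hm' (Option.map_eq_none_iff.1 h) (C.g 0).tr hT0 K.y (K.qplus hy h1 h2) (K.qminus hy) t ht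
  · by_contra hc
    obtain ⟨A', hA'⟩ := Option.ne_none_iff_exists'.1 hc
    obtain ⟨t, ht, h3, -⟩ := col_e hA hm' hn h0 C K h1 h2 hA'
    exact h ⟨t, ht, h3⟩

end AffineRSK
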